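/- Let δ be a positive real number that is not an integer, and let ℓ ∈ ℕ. Then every Λ ⊆ ℤ with d̄(Λ) > 0 contains a configuration {m, m+[n^δ], m+2[n^δ], …, m+ℓ[n^δ]} for some m ∈ ℤ and n ∈ ℕ with [n^δ] ≠ 0. -/

import Mathlib

open Filter

/-- The upper density of a set of integers. -/
noncomputable def upperDensity (Λ : Set ℤ) : ℝ :=
  Filter.limsup
    (fun N : ℕ => (Nat.card ↥(Λ ∩ Set.Icc (-(N : ℤ)) (N : ℤ)) : ℝ) / (2 * N + 1))
    Filter.atTop

set_option linter.all false

/-! Part 0 -/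

namespace Sz

/-- bounded real functions -/
def bdd (Ω : Type) : Subalgebra ℝ (Ω → ℝ) where
  carrier := {f | ∃ C, ∀ ω, |f ω| ≤ C}
  mul_mem' := by
    rintro f g ⟨C, hC⟩ ⟨D, hD⟩
    refine ⟨C * D, fun ω => ?_⟩
    rw [Pi.mul_apply, abs_mul]
    exact mul_le_mul (hC ω) (hD ω) (abs_nonneg _) ((abs_nonneg _).trans (hC ω))
  add_mem' := by
    rintro f g ⟨C, hC⟩ ⟨D, hD⟩
    exact ⟨C + D, fun ω => (abs_add_le _ _).trans (add_le_add (hC ω) (hD ω))⟩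
  algebraMap_mem' := fun r => ⟨|r|, fun ω => le_of_eq (by simp)⟩

abbrev Bd (Ω : Type) := ↥(bdd Ω)

instance (Ω : Type) : CoeFun (Bd Ω) (fun _ => Ω → ℝ) := ⟨fun f => f.1⟩

namespace Bd
variable {Ω Ω' Ω'' : Type}

@[ext] theorem ext' {f g : Bd Ω} (h : ∀ ω, f ω = g ω) : f = g := Subtype.ext (funext h)

def mk' (f : Ω → ℝ) (C : ℝ) (h : ∀ ω, |f ω| ≤ C) : Bd Ω := ⟨f, C, h⟩
@[simp] theorem mk'_apply (f : Ω → ℝ) (C : ℝ) (h : ∀ ω, |f ω| ≤ C) (ω : Ω) : mk' f C h ω = f ω := rfl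

theorem bound (f : Bd Ω) : ∃ C, 0 < C ∧ ∀ ω, |f ω| ≤ C := by
  obtain ⟨C, hC⟩ := f.2
  exact ⟨max C 1, by positivity, fun ω => (hC ω).trans (le_max_left _ _)⟩

@[simp] theorem add_apply (f g : Bd Ω) (ω : Ω) : (f + g) ω = f ω + g ω := rfl
@[simp] theorem sub_apply (f g : Bd Ω) (ω : Ω) : (f - g) ω = f ω - g ω := rfl
@[simp] theorem mul_apply (f g : Bd Ω) (ω : Ω) : (f * g) ω = f ω * g ω := rfl
@[simp] theorem neg_apply (f : Bd Ω) (ω : Ω) : (-f) ω = -f ω := rfl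
@[simp] theorem smul_apply (c : ℝ) (f : Bd Ω) (ω : Ω) : (c • f) ω = c * f ω := rfl
@[simp] theorem one_apply (ω : Ω) : (1 : Bd Ω) ω = 1 := rfl
@[simp] theorem zero_apply (ω : Ω) : (0 : Bd Ω) ω = 0 := rfl
@[simp] theorem pow_apply (f : Bd Ω) (n : ℕ) (ω : Ω) : (f ^ n) ω = f ω ^ n := rfl
@[simp] theorem algebraMap_apply' (c : ℝ) (ω : Ω) : (algebraMap ℝ (Bd Ω) c) ω = c := rfl
@[simp] theorem ofNat_apply (n : ℕ) [n.AtLeastTwo] (ω : Ω) : (OfNat.ofNat n : Bd Ω) ω = OfNat.ofNat n := rfl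

/-- evaluation as a ring hom -/
def ev (ω : Ω) : Bd Ω →ₐ[ℝ] ℝ := (Pi.evalAlgHom ℝ (fun _ : Ω => ℝ) ω).comp (bdd Ω).val
theorem ev_apply (f : Bd Ω) (ω : Ω) : ev ω f = f ω := rfl

@[simp] theorem sum_apply {ι : Type*} (s : Finset ι) (F : ι → Bd Ω) (ω : Ω) :
    (∑ i ∈ s, F i) ω = ∑ i ∈ s, F i ω := map_sum (ev ω) F s
@[simp] theorem prod_apply {ι : Type*} (s : Finset ι) (F : ι → Bd Ω) (ω : Ω) :
    (∏ i ∈ s, F i) ω = ∏ i ∈ s, F i ω := map_prod (ev ω) F s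

/-- composition -/
def comp (φ : Ω' → Ω) : Bd Ω →ₐ[ℝ] Bd Ω' where
  toFun f := ⟨fun x => f (φ x), by obtain ⟨C, hC⟩ := f.2; exact ⟨C, fun x => hC _⟩⟩
  map_one' := rfl
  map_mul' _ _ := rfl
  map_zero' := rfl
  map_add' _ _ := rfl
  commutes' _ := rfl

@[simp] theorem comp_apply (φ : Ω' → Ω) (f : Bd Ω) (x : Ω') : comp φ f x = f (φ x) := rfl
theorem comp_comp (φ : Ω' → Ω) (ψ : Ω'' → Ω') (f : Bd Ω) : comp ψ (comp φ f) = comp (φ ∘ ψ) f := rfl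

def abs (f : Bd Ω) : Bd Ω := ⟨fun ω => |f ω|, by obtain ⟨C, hC⟩ := f.2; exact ⟨C, fun ω => by simpa using hC ω⟩⟩
@[simp] theorem abs_apply (f : Bd Ω) (ω : Ω) : abs f ω = |f ω| := rfl

/-- composition with a continuous real function -/
def post (φ : ℝ → ℝ) (hφ : Continuous φ) (f : Bd Ω) : Bd Ω := ⟨fun ω => φ (f ω), by
  obtain ⟨C, hC⟩ := f.2
  obtain ⟨D, hD⟩ := (isCompact_Icc (a := -C) (b := C)).exists_bound_of_continuousOn hφ.continuousOn
  exact ⟨D, fun ω => hD _ (abs_le.mp (hC ω))⟩⟩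
@[simp] theorem post_apply (φ : ℝ → ℝ) (hφ : Continuous φ) (f : Bd Ω) (ω : Ω) : post φ hφ f ω = φ (f ω) := rfl

end Bd

/-- finitely additive means -/
structure Mean (Ω : Type) where
  lin : Bd Ω →ₗ[ℝ] ℝ
  nonneg' : ∀ f : Bd Ω, (∀ ω, 0 ≤ f ω) → 0 ≤ lin f
  one' : lin 1 = 1

instance (Ω : Type) : FunLike (Mean Ω) (Bd Ω) ℝ where
  coe m := m.lin
  coe_injective := by
    rintro ⟨a, _, _⟩ ⟨b, _, _⟩ h
    congr; exact DFunLike.coe_injective h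

instance (Ω : Type) : LinearMapClass (Mean Ω) ℝ (Bd Ω) ℝ where
  map_add m := m.lin.map_add
  map_smulₛₗ m := m.lin.map_smul

namespace Mean
variable {Ω Ω' P : Type} (m : Mean Ω)

theorem nonneg {f : Bd Ω} (h : ∀ ω, 0 ≤ f ω) : 0 ≤ m f := m.nonneg' f h
@[simp] theorem one : m 1 = 1 := m.one'
theorem smul' (c : ℝ) (f : Bd Ω) : m (c • f) = c * m f := map_smul m c f
@[simp] theorem const (c : ℝ) : m (algebraMap ℝ _ c) = c := by
  rw [Algebra.algebraMap_eq_smul_one, smul', one, mul_one]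

theorem mono {f g : Bd Ω} (h : ∀ ω, f ω ≤ g ω) : m f ≤ m g := by
  have := m.nonneg (f := g - f) (fun ω => by simpa using h ω)
  rw [map_sub] at this; linarith

theorem le_const {f : Bd Ω} {c : ℝ} (h : ∀ ω, f ω ≤ c) : m f ≤ c := by
  have := m.mono (f := f) (g := algebraMap ℝ _ c) h
  simpa using this
theorem const_le {f : Bd Ω} {c : ℝ} (h : ∀ ω, c ≤ f ω) : c ≤ m f := by
  have := m.mono (g := f) (f := algebraMap ℝ _ c) h
  simpa using this
theorem abs_le {f : Bd Ω} {c : ℝ} (h : ∀ ω, |f ω| ≤ c) : |m f| ≤ c :=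
  _root_.abs_le.mpr ⟨m.const_le fun ω => (_root_.abs_le.mp (h ω)).1, m.le_const fun ω => (_root_.abs_le.mp (h ω)).2⟩
theorem abs_le_abs (f : Bd Ω) : |m f| ≤ m f.abs := by
  rw [_root_.abs_le]
  constructor
  · have := m.mono (f := -f.abs) (g := f) (fun ω => by simpa using neg_abs_le _)
    rw [map_neg] at this; linarith
  · exact m.mono fun ω => le_abs_self _

theorem sq_nonneg' (f : Bd Ω) : 0 ≤ m (f * f) := m.nonneg fun ω => mul_self_nonneg _

theorem cs (f g : Bd Ω) : m (f * g) ^ 2 ≤ m (f * f) * m (g * g) := by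
  have h : ∀ x : ℝ, 0 ≤ m (g * g) * (x * x) + (2 * m (f * g)) * x + m (f * f) := by
    intro x
    have := m.sq_nonneg' (f + x • g)
    have e : (f + x • g) * (f + x • g) = f * f + (2 * x) • (f * g) + (x * x) • (g * g) := by
      ext ω; simp; ring
    rw [e, map_add, map_add, smul', smul'] at this
    linarith
  have := discrim_le_zero h
  unfold discrim at this
  nlinarith

theorem sq_le (f : Bd Ω) : m f ^ 2 ≤ m (f * f) := by
  have := m.cs f 1
  simpa using this

theorem abs_sq_le (f : Bd Ω) : m f.abs ^ 2 ≤ m (f * f) := by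
  have := m.sq_le f.abs
  have e : f.abs * f.abs = f * f := by ext ω; simp
  rwa [e] at this

/-- push-forward of a mean -/
def map (φ : Ω → Ω') (m : Mean Ω) : Mean Ω' where
  lin := m.lin ∘ₗ (Bd.comp φ).toLinearMap
  nonneg' f h := m.nonneg' _ fun ω => h _
  one' := m.one'
@[simp] theorem map_apply (φ : Ω → Ω') (f : Bd Ω') : map φ m f = m (Bd.comp φ f) := rfl

/-- partial mean -/
def part (m : Mean Ω) : Bd (P × Ω) →ₗ[ℝ] Bd P where
  toFun F := ⟨fun p => m (Bd.comp (fun ω => (p, ω)) F), by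
    obtain ⟨C, hC⟩ := F.2; exact ⟨C, fun p => m.abs_le fun ω => hC _⟩⟩
  map_add' F G := by ext p; exact map_add m (Bd.comp (fun ω => (p, ω)) F) (Bd.comp (fun ω => (p, ω)) G)
  map_smul' c F := by ext p; exact map_smul m c (Bd.comp (fun ω => (p, ω)) F)
theorem part_apply (F : Bd (P × Ω)) (p : P) : m.part F p = m (Bd.comp (fun ω => (p, ω)) F) := rfl

/-- iterated mean, `n` outside -/
def prod (n : Mean P) (m : Mean Ω) : Mean (P × Ω) where
  lin := n.lin ∘ₗ m.part
  nonneg' F h := n.nonneg' _ fun p => m.nonneg' _ fun ω => h _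
  one' := by
    have : m.part (1 : Bd (P × Ω)) = 1 := by ext p; exact m.one'
    simp [this, n.one']
theorem prod_apply (n : Mean P) (m : Mean Ω) (F : Bd (P × Ω)) : n.prod m F = n (m.part F) := rfl

theorem eq_zero_of_sq {f : Bd Ω} (h : m (f * f) = 0) (g : Bd Ω) : m (f * g) = 0 := by
  have := m.cs f g
  rw [h, zero_mul] at this
  exact pow_eq_zero_iff (two_ne_zero) |>.mp (le_antisymm this (sq_nonneg _))

end Mean

end Sz

/-! Part 1 -/

namespace Sz
open Topology

/-- ultralimit as a mean -/
theorem exists_ulim {ι : Type} (U : Ultrafilter ι) (f : Bd ι) : ∃ a : ℝ, Tendsto f.1 (U : Filter ι) (𝓝 a) := by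
  obtain ⟨C, -, hC⟩ := f.bound
  have h := (isCompact_Icc (a := -C) (b := C)).ultrafilter_le_nhds (U.map f.1) (by
    rw [le_principal_iff, Ultrafilter.mem_coe, Ultrafilter.mem_map]
    exact univ_mem' fun ω => abs_le.mp (hC ω))
  obtain ⟨a, -, ha⟩ := h
  exact ⟨a, ha⟩

noncomputable def ultraMean {ι : Type} (U : Ultrafilter ι) : Mean ι where
  lin := {
    toFun f := (exists_ulim U f).choose
    map_add' f g := tendsto_nhds_unique (exists_ulim U (f + g)).choose_spec
      ((exists_ulim U f).choose_spec.add (exists_ulim U g).choose_spec)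
    map_smul' c g := tendsto_nhds_unique (exists_ulim U (c • g)).choose_spec
      ((exists_ulim U g).choose_spec.const_mul c) }
  nonneg' f h := ge_of_tendsto' (exists_ulim U f).choose_spec h
  one' := tendsto_nhds_unique (exists_ulim U 1).choose_spec tendsto_const_nhds

theorem ultraMean_tendsto {ι : Type} (U : Ultrafilter ι) (f : Bd ι) :
    Tendsto f.1 (U : Filter ι) (𝓝 (ultraMean U f)) := (exists_ulim U f).choose_spec

theorem ultraMean_eq {ι : Type} (U : Ultrafilter ι) (f : Bd ι) {a : ℝ}
    (h : Tendsto f.1 (U : Filter ι) (𝓝 a)) : ultraMean U f = a :=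
  tendsto_nhds_unique (ultraMean_tendsto U f) h

/-- amenability of commutative monoids -/
def amSet {Q : Type} [AddCommMonoid Q] (φ : Bd Q) : Set ℝ :=
  {c | ∃ (ι : Type) (_ : Fintype ι) (_ : Nonempty ι) (s : ι → Q), ∀ x, ∑ i, φ (x + s i) ≤ Fintype.card ι * c}

theorem amSet_lb {Q : Type} [AddCommMonoid Q] (φ : Bd Q) {C : ℝ} (hC : ∀ x, C ≤ φ x) :
    ∀ c ∈ amSet φ, C ≤ c := by
  rintro c ⟨ι, _, _, s, h⟩
  have h1 := h 0
  have h2 : ∑ i : ι, C ≤ ∑ i, φ (0 + s i) := Finset.sum_le_sum fun i _ => hC _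
  simp only [Finset.sum_const, Finset.card_univ, nsmul_eq_mul] at h2
  have : (0 : ℝ) < Fintype.card ι := by exact_mod_cast Fintype.card_pos
  exact le_of_mul_le_mul_left (h2.trans h1) this

theorem amSet_ub {Q : Type} [AddCommMonoid Q] (φ : Bd Q) {C : ℝ} (hC : ∀ x, φ x ≤ C) : C ∈ amSet φ :=
  ⟨Unit, inferInstance, inferInstance, fun _ => 0, fun x => by simpa using hC x⟩

theorem amSet_bdd {Q : Type} [AddCommMonoid Q] (φ : Bd Q) : BddBelow (amSet φ) := by
  obtain ⟨C, -, hC⟩ := φ.bound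
  exact ⟨-C, amSet_lb φ fun x => (abs_le.mp (hC x)).1⟩

theorem amSet_ne {Q : Type} [AddCommMonoid Q] (φ : Bd Q) : (amSet φ).Nonempty := by
  obtain ⟨C, -, hC⟩ := φ.bound
  exact ⟨C, amSet_ub φ fun x => (abs_le.mp (hC x)).2⟩

theorem amSet_smul {Q : Type} [AddCommMonoid Q] (φ : Bd Q) {c : ℝ} (hc : 0 < c) {x : ℝ} (h : x ∈ amSet φ) :
    c * x ∈ amSet (c • φ) := by
  obtain ⟨ι, i1, i2, s, h⟩ := h
  refine ⟨ι, i1, i2, s, fun y => ?_⟩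
  have := mul_le_mul_of_nonneg_left (h y) hc.le
  simp only [Bd.smul_apply, ← Finset.mul_sum]
  linarith

theorem amSet_add {Q : Type} [AddCommMonoid Q] (φ ψ : Bd Q) {x y : ℝ} (h : x ∈ amSet φ) (h' : y ∈ amSet ψ) :
    x + y ∈ amSet (φ + ψ) := by
  obtain ⟨ι, i1, i2, s, h⟩ := h
  obtain ⟨κ, j1, j2, t, h'⟩ := h'
  refine ⟨ι × κ, inferInstance, inferInstance, fun p => s p.1 + t p.2, fun z => ?_⟩
  simp only [Bd.add_apply, Finset.sum_add_distrib, Fintype.sum_prod_type, Fintype.card_prod, Nat.cast_mul]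
  have e1 : ∑ i, ∑ j, φ (z + (s i + t j)) ≤ Fintype.card κ * (Fintype.card ι * x) := by
    rw [Finset.sum_comm]
    have : ∀ j ∈ Finset.univ, ∑ i, φ (z + (s i + t j)) ≤ Fintype.card ι * x := fun j _ => by
      have := h (z + t j)
      simpa [add_assoc, add_comm, add_left_comm] using this
    have := Finset.sum_le_sum this
    simpa [Finset.card_univ] using this
  have e2 : ∑ i, ∑ j, ψ (z + (s i + t j)) ≤ Fintype.card ι * (Fintype.card κ * y) := by
    have : ∀ i ∈ Finset.univ, ∑ j, ψ (z + (s i + t j)) ≤ Fintype.card κ * y := fun i _ => by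
      have := h' (z + s i)
      simpa [add_assoc] using this
    have := Finset.sum_le_sum this
    simpa [Finset.card_univ] using this
  nlinarith

theorem exists_inv_mean (Q : Type) [AddCommMonoid Q] :
    ∃ n : Mean Q, ∀ (s : Q) (f : Bd Q), n (Bd.comp (fun x => x + s) f) = n f := by
  obtain ⟨g, -, hg⟩ := exists_extension_of_le_sublinear (E := Bd Q) ⟨⊥, 0⟩ (fun φ => sInf (amSet φ))
    (by
      intro c hc φ
      apply le_antisymm
      · rw [← div_le_iff₀' hc]
        refine le_csInf (amSet_ne _) fun x hx => ?_
        rw [div_le_iff₀' hc]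
        exact csInf_le (amSet_bdd _) (amSet_smul _ hc hx)
      · refine le_csInf (amSet_ne _) fun x hx => ?_
        have := amSet_smul _ (inv_pos.mpr hc) hx
        rw [inv_smul_smul₀ hc.ne'] at this
        rw [← le_div_iff₀' hc, div_eq_inv_mul]
        exact csInf_le (amSet_bdd _) this)
    (by
      intro φ ψ
      rw [← sub_le_iff_le_add]
      refine le_csInf (amSet_ne _) fun x hx => ?_
      rw [sub_le_iff_le_add, ← sub_le_iff_le_add']
      refine le_csInf (amSet_ne _) fun y hy => ?_
      rw [sub_le_iff_le_add']
      exact csInf_le (amSet_bdd _) (amSet_add _ _ hx hy))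
    (by
      rintro ⟨x, hx⟩
      have hx' : x = 0 := by simpa using hx
      subst hx'
      refine le_csInf (amSet_ne _) fun y hy => ?_
      exact amSet_lb (0 : Bd Q) (C := 0) (fun x => le_rfl) y hy)
  have key : ∀ (φ : Bd Q) {C : ℝ}, C ∈ amSet φ → g φ ≤ C := fun φ C h => (hg φ).trans (csInf_le (amSet_bdd _) h)
  have inv1 : ∀ (s : Q) (f : Bd Q), g (Bd.comp (fun x => x + s) f - f) ≤ 0 := by
    intro s f
    obtain ⟨C, hC0, hC⟩ := f.bound
    have : ∀ n : ℕ, g (Bd.comp (fun x => x + s) f - f) ≤ 2 * C / (n + 1) := by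
      intro n
      apply key
      refine ⟨Fin (n + 1), inferInstance, inferInstance, fun i => (i : ℕ) • s, fun x => ?_⟩
      rw [Fin.sum_univ_eq_sum_range (fun i => (Bd.comp (fun x => x + s) f - f) (x + i • s)) (n + 1)]
      have : ∀ i, (Bd.comp (fun x => x + s) f - f) (x + i • s) = f (x + (i + 1) • s) - f (x + i • s) := fun i => by
        simp [add_smul, add_assoc]
      simp only [this, Finset.sum_range_sub (fun i => f (x + i • s))]
      have h1 := abs_le.mp (hC (x + (n + 1) • s))
      have h2 := abs_le.mp (hC (x + 0 • s))
      have : (Fintype.card (Fin (n + 1)) : ℝ) * (2 * C / (n + 1)) = 2 * C := by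
        simp; field_simp
      rw [this]; linarith
    have lim : Tendsto (fun n : ℕ => 2 * C / ((n : ℝ) + 1)) atTop (𝓝 0) :=
      tendsto_const_nhds.div_atTop (tendsto_natCast_atTop_atTop.atTop_add tendsto_const_nhds)
    exact ge_of_tendsto' lim this
  have inv2 : ∀ (s : Q) (f : Bd Q), g (Bd.comp (fun x => x + s) f) = g f := by
    intro s f
    have h1 := inv1 s f
    have h2 := inv1 s (-f)
    rw [map_neg, sub_neg_eq_add, neg_add_eq_sub] at h2
    rw [map_sub] at h1 h2
    linarith
  refine ⟨⟨g, ?_, ?_⟩, inv2⟩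
  · intro f hf
    have := key (-f) (C := 0) (amSet_ub _ fun x => by simpa using hf x)
    rw [map_neg] at this; linarith
  · have h1 := key 1 (C := 1) (amSet_ub _ fun x => le_rfl)
    have h2 := key (-1) (C := -1) (amSet_ub _ fun x => le_rfl)
    rw [map_neg] at h2; linarith

/-- the mean on the reals used throughout -/
theorem exists_E : ∃ E : Mean ℝ, (∀ (s : ℝ) (f : Bd ℝ), E (Bd.comp (fun x => x + s) f) = E f) ∧
    (∀ (b : ℕ), 0 < b → ∀ f : Bd ℝ, E (Bd.comp (fun x : ℝ => (b : ℝ) * x) f) = E f) ∧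
    (∀ (x : ℝ) (f : Bd ℝ), (∀ t, x ≤ t → f t = 0) → E f = 0) := by
  obtain ⟨n, hn⟩ := exists_inv_mean NNReal
  obtain ⟨n', hn'⟩ := exists_inv_mean (Additive ℕ+)
  let m0 : Mean ℝ := Mean.map (fun x : NNReal => (x : ℝ)) n
  have h1 : ∀ (s : NNReal) (f : Bd ℝ), m0 (Bd.comp (fun x : ℝ => x + (s : ℝ)) f) = m0 f := by
    intro s f
    exact hn s (Bd.comp (fun x : NNReal => (x : ℝ)) f)
  have h2 : ∀ (s : ℝ) (f : Bd ℝ), m0 (Bd.comp (fun x => x + s) f) = m0 f := by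
    intro s f
    rcases le_total 0 s with hs | hs
    · have := h1 s.toNNReal f
      rwa [Real.coe_toNNReal _ hs] at this
    · have := h1 (-s).toNNReal (Bd.comp (fun x => x + s) f)
      rw [Real.coe_toNNReal _ (by linarith)] at this
      rw [← this]
      congr 1; ext x; simp
  have h3 : ∀ (x : ℝ) (f : Bd ℝ), (∀ t, x ≤ t → f t = 0) → m0 f = 0 := by
    intro x f hf
    rw [← h2 (max x 0) f]
    have : Bd.comp (fun x : NNReal => (x : ℝ)) (Bd.comp (fun y : ℝ => y + max x 0) f) = 0 := by
      ext y
      exact hf _ (by linarith [le_max_left x 0, y.coe_nonneg])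
    rw [Mean.map_apply, this, map_zero]
  let E : Mean ℝ := Mean.map (fun p : Additive ℕ+ × ℝ => ((p.1.toMul : ℕ) : ℝ) * p.2) (n'.prod m0)
  refine ⟨E, ?_, ?_, ?_⟩
  · intro s f
    change n' _ = n' _
    congr 1
    ext b
    simp only [Mean.part_apply]
    rw [← h2 ((((Additive.toMul b : ℕ+) : ℕ) : ℝ)⁻¹ * s) (Bd.comp (fun ω => (b, ω)) ((Bd.comp (fun p : Additive ℕ+ × ℝ => ((p.1.toMul : ℕ) : ℝ) * p.2)).toLinearMap f))]
    congr 1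
    ext x
    have : (((Additive.toMul b : ℕ+) : ℕ) : ℝ) ≠ 0 := by positivity
    simp [mul_add, mul_inv_cancel_left₀ this]
  · intro b hb f
    change n' _ = n' _
    refine Eq.trans ?_ (hn' (Additive.ofMul (b.toPNat hb)) _)
    congr 1
    ext c
    simp only [Mean.part_apply, Bd.comp_apply]
    congr 1
    ext x
    simp only [AlgHom.toLinearMap_apply, Bd.comp_apply, toMul_add, PNat.mul_coe, toMul_ofMul, PNat.mk_coe, Nat.cast_mul]
    simp only [Nat.toPNat, PNat.mk_coe]; congr 1; ring_nf
  · intro x f hf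
    change n' _ = 0
    convert map_zero n'
    ext b
    apply h3 (max x 0)
    intro t ht
    apply hf
    have h1 : (1 : ℝ) ≤ (((Additive.toMul b : ℕ+) : ℕ) : ℝ) := by exact_mod_cast (Additive.toMul b).one_le
    have h2 := le_max_left x 0
    have h3 := le_max_right x 0
    simp only
    nlinarith

end Sz

/-! Part 2 -/

namespace Sz
open Topology
variable {Ω : Type}

/-- squared L2 distance -/
def Mean.d2 (m : Mean Ω) (f g : Bd Ω) : ℝ := m ((f - g) * (f - g))

theorem Mean.d2_nonneg (m : Mean Ω) (f g : Bd Ω) : 0 ≤ m.d2 f g := m.sq_nonneg' _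
theorem Mean.d2_comm (m : Mean Ω) (f g : Bd Ω) : m.d2 f g = m.d2 g f := by
  unfold Mean.d2; congr 1; ring
theorem Mean.d2_tri (m : Mean Ω) (f g h : Bd Ω) : m.d2 f h ≤ 2 * m.d2 f g + 2 * m.d2 g h := by
  unfold Mean.d2
  rw [← m.smul', ← m.smul', ← map_add]
  refine m.mono fun ω => ?_
  simp
  nlinarith [sq_nonneg (f ω - g ω - (g ω - h ω))]
theorem Mean.d2_mul (m : Mean Ω) (f g h : Bd Ω) {C : ℝ} (hC : ∀ ω, |h ω| ≤ C) :
    m.d2 (f * h) (g * h) ≤ C ^ 2 * m.d2 f g := by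
  unfold Mean.d2
  rw [← m.smul']
  refine m.mono fun ω => ?_
  simp
  have : h ω ^ 2 ≤ C ^ 2 := sq_le_sq' (_root_.abs_le.mp (hC ω)).1 (_root_.abs_le.mp (hC ω)).2
  nlinarith [mul_le_mul_of_nonneg_right this (mul_self_nonneg (f ω - g ω))]
theorem Mean.abs_sub_le (m : Mean Ω) (f g : Bd Ω) : m (f - g).abs ≤ Real.sqrt (m.d2 f g) :=
  Real.le_sqrt_of_sq_le (m.abs_sq_le _)
theorem Mean.le_of_d2 (m : Mean Ω) (f g : Bd Ω) : |m f - m g| ≤ Real.sqrt (m.d2 f g) := by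
  rw [← map_sub]; exact (m.abs_le_abs _).trans (m.abs_sub_le f g)

def L2C (m : Mean Ω) : Prop := ∀ (F : ℕ → Bd Ω) (C : ℝ), (∀ n ω, |F n ω| ≤ C) →
  (∀ ε > 0, ∃ N, ∀ n ≥ N, ∀ k ≥ N, m.d2 (F n) (F k) ≤ ε) →
  ∃ G : Bd Ω, (∀ ω, |G ω| ≤ C) ∧ Tendsto (fun n => m.d2 (F n) G) atTop (𝓝 0)

theorem L2C_prod (U : Ultrafilter ℕ) (hU : (U : Filter ℕ) ≤ atTop) (m0 : Mean Ω) : L2C ((ultraMean U).prod m0) := by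
  intro F C hF hc
  set m := (ultraMean U).prod m0 with hm
  have hc' : ∀ j : ℕ, ∃ N, ∀ n ≥ N, ∀ k ≥ N, m.d2 (F n) (F k) ≤ 1 / ((j : ℝ) + 1) := fun j => hc _ (by positivity)
  choose N0 hN0 using hc'
  let N : ℕ → ℕ := fun j => ∑ i ∈ Finset.range (j + 1), N0 i
  have hNN : ∀ a b, a ≤ b → N0 a ≤ N b := fun a b hab =>
    Finset.single_le_sum (f := N0) (fun _ _ => Nat.zero_le _) (Finset.mem_range.mpr (by omega))
  let q : ℕ → ℕ → ℕ → ℝ := fun a b i => m0.part ((F (N a) - F (N b)) * (F (N a) - F (N b))) i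
  have hq : ∀ a b, a ≤ b → ∀ᶠ i in (U : Filter ℕ), q a b i < 2 / ((a : ℝ) + 1) := by
    intro a b hab
    have h1 : m.d2 (F (N a)) (F (N b)) ≤ 1 / ((a : ℝ) + 1) := hN0 a _ (hNN a a le_rfl) _ (hNN a b hab)
    have h2 := ultraMean_tendsto U (m0.part ((F (N a) - F (N b)) * (F (N a) - F (N b))))
    refine h2.eventually_lt_const (lt_of_le_of_lt h1 ?_)
    gcongr; norm_num
  let S : ℕ → ℕ → Prop := fun i j => ∀ a ≤ j, q a j i < 2 / ((a : ℝ) + 1)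
  have hS : ∀ j, ∀ᶠ i in (U : Filter ℕ), S i j := by
    intro j
    have : ∀ a ∈ Finset.range (j+1), ∀ᶠ i in (U : Filter ℕ), q a j i < 2 / ((a : ℝ) + 1) :=
      fun a ha => hq a j (by simpa [Nat.lt_succ_iff] using ha)
    have := (Filter.eventually_all_finset (Finset.range (j+1))).mpr this
    filter_upwards [this] with i hi a ha
    exact hi a (by simpa [Nat.lt_succ_iff] using ha)
  classical
  let n : ℕ → ℕ := fun i => Nat.findGreatest (S i) i
  refine ⟨⟨fun p => F (N (n p.1)) p, C, fun p => hF _ _⟩, fun p => hF _ _, ?_⟩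
  set G : Bd (ℕ × Ω) := ⟨fun p => F (N (n p.1)) p, C, fun p => hF _ _⟩ with hG
  have hd : ∀ a, m.d2 (F (N a)) G ≤ 2 / ((a : ℝ) + 1) := by
    intro a
    refine le_of_tendsto (ultraMean_tendsto U _) ?_
    filter_upwards [hS a, hU (Ici_mem_atTop a)] with i hi hai
    have h1 : a ≤ n i := Nat.le_findGreatest hai hi
    have h2 : S i (n i) := Nat.findGreatest_spec (P := S i) hai hi
    exact (h2 a h1).le
  rw [Metric.tendsto_atTop]
  intro ε hε
  obtain ⟨a, ha⟩ := exists_nat_gt (6 / ε)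
  refine ⟨N a, fun k hk => ?_⟩
  rw [Real.dist_0_eq_abs, abs_of_nonneg (m.d2_nonneg _ _)]
  have h1 := m.d2_tri (F k) (F (N a)) G
  have h2 : m.d2 (F k) (F (N a)) ≤ 1 / ((a : ℝ) + 1) := hN0 a _ ((hNN a a le_rfl).trans hk) _ (hNN a a le_rfl)
  have h3 := hd a
  have h4 : 6 / ((a : ℝ) + 1) < ε := by
    rw [div_lt_iff₀ (by positivity)]
    rw [div_lt_iff₀ hε] at ha
    nlinarith
  have : 6 / ((a : ℝ) + 1) = 2 * (1 / ((a : ℝ) + 1)) + 2 * (2 / ((a : ℝ) + 1)) := by ring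
  linarith

/-- closed algebras -/
def Clo (m : Mean Ω) (A : Subalgebra ℝ (Bd Ω)) : Prop :=
  ∀ f : Bd Ω, (∀ ε > 0, ∃ g ∈ A, m.d2 f g ≤ ε) → f ∈ A

theorem Clo.of_tendsto {m : Mean Ω} {A : Subalgebra ℝ (Bd Ω)} (hA : Clo m A) {F : ℕ → Bd Ω} (hF : ∀ n, F n ∈ A)
    {G : Bd Ω} (h : Tendsto (fun n => m.d2 (F n) G) atTop (𝓝 0)) : G ∈ A := by
  refine hA G fun ε hε => ?_
  obtain ⟨n, hn⟩ := (h.eventually_lt_const hε).exists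
  exact ⟨F n, hF n, by rw [m.d2_comm]; exact hn.le⟩

theorem Clo.post {m : Mean Ω} {A : Subalgebra ℝ (Bd Ω)} (hA : Clo m A) {f : Bd Ω} (hf : f ∈ A)
    {φ : ℝ → ℝ} (hφ : Continuous φ) : Bd.post φ hφ f ∈ A := by
  refine hA _ fun ε hε => ?_
  obtain ⟨C, hC0, hC⟩ := f.bound
  obtain ⟨p, hp⟩ := exists_polynomial_near_of_continuousOn (-C) C φ hφ.continuousOn (min ε 1) (by positivity)
  refine ⟨Polynomial.aeval f p, ?_, ?_⟩
  · have := (Polynomial.aeval (⟨f, hf⟩ : A) p).2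
    rwa [Polynomial.aeval_subalgebra_coe] at this
  · refine m.le_const fun ω => ?_
    have e : (Polynomial.aeval f p) ω = p.eval (f ω) := by
      have := Polynomial.aeval_algHom_apply (Bd.ev ω) f p
      simp only [Bd.ev_apply] at this
      rw [← this]; simp [Polynomial.aeval_def]
    simp only [Bd.mul_apply, Bd.sub_apply, Bd.post_apply, e]
    have := hp (f ω) (abs_le.mp (hC ω))
    have h1 : |p.eval (f ω) - φ (f ω)| ≤ min ε 1 := this.le
    have h2 : (φ (f ω) - p.eval (f ω)) * (φ (f ω) - p.eval (f ω)) = |p.eval (f ω) - φ (f ω)| * |p.eval (f ω) - φ (f ω)| := by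
      rw [abs_mul_abs_self]; ring
    rw [h2]
    calc _ ≤ min ε 1 * min ε 1 := by gcongr
      _ ≤ ε * 1 := by gcongr; exact min_le_left _ _; exact min_le_right _ _
      _ = ε := mul_one _

theorem eq_of_quad {a b c : ℝ} (h : ∀ t : ℝ, 0 ≤ 2 * t * (a - b) + t ^ 2 * c) : a = b := by
  have h' : ∀ t : ℝ, 0 ≤ c * (t * t) + (2 * (a - b)) * t + 0 := fun t => by have := h t; nlinarith
  have := discrim_le_zero h'
  unfold discrim at this
  nlinarith [sq_nonneg (a - b)]

/-- Lemma R -/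
theorem lemR {m : Mean Ω} (hm : L2C m) {A : Subalgebra ℝ (Bd Ω)} (hA : Clo m A) (ψ : Bd Ω →ₗ[ℝ] ℝ) {C : ℝ} (hC : 0 ≤ C)
    (hψ : ∀ g ∈ A, |ψ g| ≤ C * m g.abs) :
    ∃ G ∈ A, (∀ ω, |G ω| ≤ C) ∧ ∀ h ∈ A, m (G * h) = ψ h := by
  let J : Bd Ω → ℝ := fun g => m (g * g) - 2 * ψ g
  let K : Set (Bd Ω) := {g | g ∈ A ∧ ∀ ω, |g ω| ≤ C}
  have hK0 : (0 : Bd Ω) ∈ K := ⟨A.zero_mem, fun ω => by simpa using hC⟩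
  have hlb : BddBelow (J '' K) := by
    refine ⟨-(2 * (C * C)), ?_⟩
    rintro _ ⟨g, ⟨hg, hgC⟩, rfl⟩
    have h1 := hψ g hg
    have h2 : m g.abs ≤ C := m.le_const hgC
    have h3 := m.sq_nonneg' g
    have h4 := (abs_le.mp h1).2
    have h5 := mul_le_mul_of_nonneg_left h2 hC
    simp only [J]; linarith
  set I := sInf (J '' K)
  have hI : ∀ g ∈ K, I ≤ J g := fun g hg => csInf_le hlb ⟨g, hg, rfl⟩
  have hex : ∀ n : ℕ, ∃ g ∈ K, J g < I + 1 / ((n : ℝ) + 1) := by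
    intro n
    obtain ⟨_, ⟨g, hg, rfl⟩, h⟩ := exists_lt_of_csInf_lt ((Set.nonempty_of_mem hK0).image J) (show I < I + 1 / ((n : ℝ) + 1) by
      have : 0 < 1 / ((n : ℝ) + 1) := by positivity
      linarith)
    exact ⟨g, hg, h⟩
  choose F hFK hFJ using hex
  have hmid : ∀ g ∈ K, ∀ g' ∈ K, m.d2 g g' ≤ 2 * (J g + J g' - 2 * I) := by
    intro g hg g' hg'
    have h1 : (1/2 : ℝ) • (g + g') ∈ K := ⟨A.smul_mem (A.add_mem hg.1 hg'.1) _, fun ω => by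
      have a := abs_le.mp (hg.2 ω)
      have b := abs_le.mp (hg'.2 ω)
      simp only [Bd.smul_apply, Bd.add_apply]
      rw [abs_le]; constructor <;> linarith⟩
    have h2 := hI _ h1
    simp only [J, map_smul, map_add, smul_eq_mul] at h2 ⊢
    have e1 : ((1/2 : ℝ) • (g + g')) * ((1/2 : ℝ) • (g + g')) = (1/2 : ℝ) • (g * g) + (1/2 : ℝ) • (g' * g') - (1/4 : ℝ) • ((g - g') * (g - g')) := by
      ext ω; simp; ring
    rw [e1, map_sub, map_add, m.smul', m.smul', m.smul'] at h2
    unfold Mean.d2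
    linarith
  have hcau : ∀ ε > 0, ∃ N, ∀ n ≥ N, ∀ k ≥ N, m.d2 (F n) (F k) ≤ ε := by
    intro ε hε
    obtain ⟨N, hN⟩ := exists_nat_gt (4 / ε)
    refine ⟨N, fun n hn k hk => ?_⟩
    have h1 := hmid _ (hFK n) _ (hFK k)
    have h2 : ∀ n ≥ N, 1 / ((n : ℝ) + 1) ≤ ε / 4 := by
      intro n hn
      have : (N : ℝ) ≤ n := by exact_mod_cast hn
      rw [div_le_iff₀ (by positivity)]
      rw [div_lt_iff₀ hε] at hN
      nlinarith
    have := h2 n hn; have := h2 k hk; have := hFJ n; have := hFJ k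
    linarith
  obtain ⟨G, hGC, hG⟩ := hm F C (fun n => (hFK n).2) hcau
  have hGA : G ∈ A := hA.of_tendsto (fun n => (hFK n).1) hG
  have hsq : Tendsto (fun n => Real.sqrt (m.d2 (F n) G)) atTop (𝓝 0) := by
    simpa using hG.sqrt
  have hJG : J G ≤ I := by
    have b : ∀ n : ℕ, J G ≤ I + 1 / ((n : ℝ) + 1) + 4 * C * Real.sqrt (m.d2 (F n) G) := by
      intro n
      have h1 := hFJ n
      have h2 : ψ (F n) - ψ G ≤ C * Real.sqrt (m.d2 (F n) G) := by
        rw [← map_sub]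
        exact (le_abs_self _).trans ((hψ _ (A.sub_mem (hFK n).1 hGA)).trans (mul_le_mul_of_nonneg_left (m.abs_sub_le _ _) hC))
      have h3 : m (G * G) - m (F n * F n) ≤ 2 * C * Real.sqrt (m.d2 (F n) G) := by
        rw [← map_sub]
        refine le_trans ?_ (mul_le_mul_of_nonneg_left (m.abs_sub_le _ _) (by positivity))
        rw [← m.smul']
        refine m.mono fun ω => ?_
        simp only [Bd.sub_apply, Bd.mul_apply, Bd.smul_apply, Bd.abs_apply]
        have e : G ω * G ω - F n ω * F n ω ≤ |G ω + F n ω| * |F n ω - G ω| := by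
          rw [← abs_mul]
          refine le_trans (le_of_eq ?_) (neg_le_abs _)
          ring
        refine e.trans (mul_le_mul_of_nonneg_right ?_ (abs_nonneg _))
        have := abs_add_le (G ω) (F n ω)
        linarith [hGC ω, (hFK n).2 ω]
      simp only [J] at h1 ⊢
      linarith
    have lim : Tendsto (fun n : ℕ => I + 1 / ((n : ℝ) + 1) + 4 * C * Real.sqrt (m.d2 (F n) G)) atTop (𝓝 (I + 0 + 4 * C * 0)) :=
      (tendsto_const_nhds.add tendsto_one_div_add_atTop_nhds_zero_nat).add (hsq.const_mul _)
    have := ge_of_tendsto' lim b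
    simpa using this
  have hmin : ∀ u ∈ A, I ≤ J u := by
    intro u hu
    have hcl : Continuous fun x : ℝ => max (-C) (min C x) := by fun_prop
    have h1 : Bd.post _ hcl u ∈ A := hA.post hu hcl
    set v := Bd.post _ hcl u with hv
    have hvC : ∀ ω, |v ω| ≤ C := by
      intro ω
      rw [abs_le]
      exact ⟨le_max_left _ _, max_le (by linarith) (min_le_left _ _)⟩
    refine (hI v ⟨h1, hvC⟩).trans ?_
    have h2 := hψ (u - v) (A.sub_mem hu h1)
    have h3 := (abs_le.mp h2).2
    rw [map_sub] at h3
    have h4 : 0 ≤ m (u * u - v * v - (2 * C) • (u - v).abs) := by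
      refine m.nonneg fun ω => ?_
      simp only [Bd.sub_apply, Bd.mul_apply, Bd.smul_apply, Bd.abs_apply]
      have hvω : v ω = max (-C) (min C (u ω)) := rfl
      rw [hvω]
      rcases le_total (u ω) C with h | h
      · rw [min_eq_right h]
        rcases le_total (-C) (u ω) with h' | h'
        · rw [max_eq_right h']; simp
        · rw [max_eq_left h', abs_of_nonpos (by linarith)]; nlinarith [sq_nonneg (u ω + C)]
      · rw [min_eq_left h, max_eq_right (by linarith), abs_of_nonneg (by linarith)]; nlinarith [sq_nonneg (u ω - C)]
    rw [map_sub, map_sub, m.smul'] at h4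
    simp only [J]; linarith
  refine ⟨G, hGA, hGC, fun h hh => eq_of_quad (c := m (h * h)) fun t => ?_⟩
  have h1 := hJG.trans (hmin (G + t • h) (A.add_mem hGA (A.smul_mem hh t)))
  simp only [J, map_add, map_smul, smul_eq_mul] at h1
  have e : (G + t • h) * (G + t • h) = G * G + (2 * t) • (G * h) + (t ^ 2) • (h * h) := by ext ω; simp; ring
  rw [e, map_add, map_add, m.smul', m.smul'] at h1
  linarith

/-- conditional expectation -/
theorem exists_ce {m : Mean Ω} (hm : L2C m) {A : Subalgebra ℝ (Bd Ω)} (hA : Clo m A) (f : Bd Ω) :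
    ∃ G ∈ A, (∀ h ∈ A, m (G * h) = m (f * h)) ∧ ∀ a b, (∀ ω, a ≤ f ω ∧ f ω ≤ b) → ∀ ω, a ≤ G ω ∧ G ω ≤ b := by
  by_cases hΩ : IsEmpty Ω
  · exact ⟨f, by rw [show f = 0 from by ext ω; exact hΩ.elim ω]; exact A.zero_mem, fun _ _ => rfl, fun a b h => h⟩
  rw [not_isEmpty_iff] at hΩ
  obtain ⟨C, -, hC⟩ := f.bound
  have hb1 : BddBelow (Set.range f.1) := ⟨-C, by rintro _ ⟨ω, rfl⟩; exact (abs_le.mp (hC ω)).1⟩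
  have hb2 : BddAbove (Set.range f.1) := ⟨C, by rintro _ ⟨ω, rfl⟩; exact (abs_le.mp (hC ω)).2⟩
  set a := iInf f.1
  set b := iSup f.1
  have ha : ∀ ω, a ≤ f ω := fun ω => ciInf_le hb1 ω
  have hb : ∀ ω, f ω ≤ b := fun ω => le_ciSup hb2 ω
  set g : Bd Ω := f - algebraMap ℝ _ ((a + b) / 2)
  have hab : a ≤ b := (ha hΩ.some).trans (hb hΩ.some)
  have hg : ∀ ω, |g ω| ≤ (b - a) / 2 := by
    intro ω
    simp only [g, Bd.sub_apply, Bd.algebraMap_apply']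
    rw [abs_le]; constructor <;> linarith [ha ω, hb ω]
  obtain ⟨G, hGA, hGC, hG⟩ := lemR hm hA (m.lin ∘ₗ LinearMap.mulLeft ℝ g) (C := (b - a) / 2) (by linarith) (by
    intro h hh
    change |m (g * h)| ≤ _
    refine (m.abs_le_abs _).trans ?_
    rw [← m.smul']
    refine m.mono fun ω => ?_
    simp only [Bd.abs_apply, Bd.mul_apply, abs_mul, Bd.smul_apply]
    exact mul_le_mul_of_nonneg_right (hg ω) (abs_nonneg _))
  refine ⟨G + algebraMap ℝ _ ((a + b) / 2), A.add_mem hGA (A.algebraMap_mem _), fun h hh => ?_, fun a' b' h ω => ?_⟩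
  · have h1 : m (G * h) = m (g * h) := hG h hh
    rw [add_mul, map_add, h1, ← map_add]
    congr 1; simp only [g]; ring
  · have h1 : a' ≤ a := le_ciInf fun ω => (h ω).1
    have h2 : b ≤ b' := ciSup_le fun ω => (h ω).2
    have := abs_le.mp (hGC ω)
    simp only [Bd.add_apply, Bd.algebraMap_apply']
    constructor <;> linarith

end Sz

/-! Part 3 -/

namespace Sz
open Topology
variable {Ω : Type}

section HL
variable {H : Type} [NormedAddCommGroup H] [InnerProductSpace ℝ H] [CompleteSpace H]

theorem hl {S : Type} [AddCommGroup S] (n : Mean S) (hn : ∀ (s : S) (f : Bd S), n (Bd.comp (fun x => x + s) f) = n f)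
    (a : S → H) (c : Bd S) (hc : ∀ s s', inner ℝ (a s) (a s') = c (s' - s)) (p : H) (v : ℝ)
    (hp : ∀ s, inner ℝ p (a s) = v) : v ^ 2 ≤ inner ℝ p p * n c := by
  have hc0 : 0 ≤ c 0 := by have := hc 0 0; rw [sub_self] at this; rw [← this]; exact real_inner_self_nonneg
  have hns : ∀ s, ‖a s‖ ≤ Real.sqrt (c 0) := by
    intro s
    have := hc s s
    rw [sub_self, real_inner_self_eq_norm_sq] at this
    rw [← this, Real.sqrt_sq (norm_nonneg _)]
  have hbd : ∀ w s, |inner ℝ w (a s)| ≤ ‖w‖ * Real.sqrt (c 0) := fun w s =>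
    (abs_real_inner_le_norm _ _).trans (mul_le_mul_of_nonneg_left (hns s) (norm_nonneg _))
  let Fw : H → Bd S := fun w => Bd.mk' (fun s => inner ℝ w (a s)) _ (hbd w)
  let ψ : H →ₗ[ℝ] ℝ := {
    toFun := fun w => n (Fw w)
    map_add' := fun w w' => by
      rw [← map_add]; congr 1; ext s; simp [Fw, inner_add_left]
    map_smul' := fun r w => by
      rw [← map_smul]; congr 1; ext s; simp [Fw, inner_smul_left] }
  let ψ' : H →L[ℝ] ℝ := ψ.mkContinuous (Real.sqrt (c 0)) (fun w => by
    rw [mul_comm]; exact n.abs_le (hbd w))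
  let b : H := (InnerProductSpace.toDual ℝ H).symm ψ'
  have hb : ∀ w, inner ℝ b w = n (Fw w) := fun w => InnerProductSpace.toDual_symm_apply
  have hψa : ∀ s, n (Fw (a s)) = n c := by
    intro s
    rw [← hn (-s) c]
    congr 1; ext s'; simp [Fw, hc, sub_eq_add_neg]
  have h1 : inner ℝ b b = n c := by
    rw [hb]
    have : Fw b = algebraMap ℝ _ (n c) := by
      ext s; simp only [Fw, Bd.mk'_apply, hb, hψa]; rfl
    rw [this, Mean.const]
  have h2 : inner ℝ b p = v := by
    rw [hb]
    have : Fw p = algebraMap ℝ _ v := by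
      ext s; simp only [Fw, Bd.mk'_apply, hp]; rfl
    rw [this, Mean.const]
  rw [← h2, ← h1, sq, mul_comm (inner ℝ p p)]
  have := real_inner_mul_inner_self_le b p
  exact this
end HL

/-- GNS construction -/
def Pre (m : Mean Ω) : Type := Bd Ω
instance (m : Mean Ω) : AddCommGroup (Pre m) := inferInstanceAs (AddCommGroup (Bd Ω))
instance (m : Mean Ω) : Module ℝ (Pre m) := inferInstanceAs (Module ℝ (Bd Ω))
def Pre.of (m : Mean Ω) : Bd Ω →ₗ[ℝ] Pre m := LinearMap.id
def Pre.to (m : Mean Ω) : Pre m →ₗ[ℝ] Bd Ω := LinearMap.id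

abbrev preCore (m : Mean Ω) : PreInnerProductSpace.Core ℝ (Pre m) where
  inner f g := m (Pre.to m f * Pre.to m g)
  conj_inner_symm f g := by simp [mul_comm]
  re_inner_nonneg f := m.sq_nonneg' _
  add_left f g h := by simp [add_mul]
  smul_left f g r := by simp [Mean.smul']

noncomputable instance (m : Mean Ω) : SeminormedAddCommGroup (Pre m) :=
  @InnerProductSpace.Core.toSeminormedAddCommGroup ℝ (Pre m) _ _ _ (preCore m)
noncomputable instance (m : Mean Ω) : InnerProductSpace ℝ (Pre m) :=
  InnerProductSpace.ofCore (preCore m)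

abbrev Hil (m : Mean Ω) : Type := UniformSpace.Completion (Pre m)

noncomputable def gns (m : Mean Ω) : Bd Ω →ₗ[ℝ] Hil m :=
  (UniformSpace.Completion.toComplL (𝕜 := ℝ) (E := Pre m)).toLinearMap ∘ₗ Pre.of m

theorem gns_inner (m : Mean Ω) (f g : Bd Ω) : inner ℝ (gns m f) (gns m g) = m (f * g) :=
  UniformSpace.Completion.inner_coe (𝕜 := ℝ) (E := Pre m) (Pre.of m f) (Pre.of m g)

theorem gns_norm_sq (m : Mean Ω) (f : Bd Ω) : ‖gns m f‖ ^ 2 = m (f * f) := by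
  rw [← real_inner_self_eq_norm_sq, gns_inner]

theorem gns_dense (m : Mean Ω) : DenseRange (gns m) :=
  UniformSpace.Completion.denseRange_coe (α := Pre m)

/-- the isometry induced by a mean preserving map -/
theorem exists_koop (m : Mean Ω) (φ : Ω → Ω) (hφ : ∀ f, m (Bd.comp φ f) = m f) :
    ∃ K : Hil m →ₗᵢ[ℝ] Hil m, ∀ f, K (gns m f) = gns m (Bd.comp φ f) := by
  let K0 : Pre m →ₗᵢ[ℝ] Pre m := {
    toLinearMap := Pre.of m ∘ₗ (Bd.comp φ).toLinearMap ∘ₗ Pre.to m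
    norm_map' := fun f => by
      have h1 : ∀ g : Pre m, ‖g‖ ^ 2 = m (Pre.to m g * Pre.to m g) := fun g => (real_inner_self_eq_norm_sq g).symm
      have := h1 ((Pre.of m ∘ₗ (Bd.comp φ).toLinearMap ∘ₗ Pre.to m) f)
      have h2 : m (Bd.comp φ (Pre.to m f) * Bd.comp φ (Pre.to m f)) = ‖f‖ ^ 2 := by
        rw [← map_mul, hφ, h1]
      have h3 := this.trans h2
      exact (pow_left_inj₀ (norm_nonneg _) (norm_nonneg _) two_ne_zero).mp h3 }
  let K1 : Hil m →L[ℝ] Hil m := K0.toContinuousLinearMap.completion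
  have hK1 : ∀ f : Pre m, K1 (f : Hil m) = (K0 f : Hil m) := fun f => UniformSpace.Completion.map_coe K0.toContinuousLinearMap.uniformContinuous f
  refine ⟨⟨K1.toLinearMap, fun x => ?_⟩, fun f => hK1 f⟩
  change ‖K1 x‖ = ‖x‖
  induction x using UniformSpace.Completion.induction_on with
  | hp => exact isClosed_eq (by fun_prop) (by fun_prop)
  | ih f => rw [hK1, UniformSpace.Completion.norm_coe, UniformSpace.Completion.norm_coe, K0.norm_map]

end Sz

/-! Part 4 -/

namespace Sz
open Topology

noncomputable def EE : Mean ℝ := exists_E.choose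
theorem EE_add (s : ℝ) (f : Bd ℝ) : EE (Bd.comp (fun x => x + s) f) = EE f := exists_E.choose_spec.1 s f
theorem EE_mul (b : ℕ) (hb : 0 < b) (f : Bd ℝ) : EE (Bd.comp (fun x : ℝ => (b : ℝ) * x) f) = EE f :=
  exists_E.choose_spec.2.1 b hb f
theorem EE_supp (x : ℝ) (f : Bd ℝ) (h : ∀ t, x ≤ t → f t = 0) : EE f = 0 := exists_E.choose_spec.2.2 x f h

/-- flows with an invariant complete mean -/
structure Sys where
  Ω : Type
  m : Mean Ω
  T : ℝ → Ω → Ω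
  T_zero : ∀ ω, T 0 ω = ω
  T_add : ∀ s s' ω, T (s + s') ω = T s (T s' ω)
  inv : ∀ s (f : Bd Ω), m (Bd.comp (T s) f) = m f
  cpl : L2C m

namespace Sys
variable (X : Sys)

/-- translation operators -/
def tr (s : ℝ) : Bd X.Ω →ₐ[ℝ] Bd X.Ω := Bd.comp (X.T s)
@[simp] theorem tr_apply (s : ℝ) (f : Bd X.Ω) (ω : X.Ω) : X.tr s f ω = f (X.T s ω) := rfl
theorem tr_tr (s s' : ℝ) (f : Bd X.Ω) : X.tr s (X.tr s' f) = X.tr (s + s') f := by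
  ext ω; simp [add_comm s, X.T_add]
@[simp] theorem tr_zero (f : Bd X.Ω) : X.tr 0 f = f := by ext ω; simp [X.T_zero]
@[simp] theorem m_tr (s : ℝ) (f : Bd X.Ω) : X.m (X.tr s f) = X.m f := X.inv s f
theorem d2_tr (s : ℝ) (f g : Bd X.Ω) : X.m.d2 (X.tr s f) (X.tr s g) = X.m.d2 f g := by
  unfold Mean.d2; rw [← map_sub, ← map_mul, m_tr]
theorem m_tr_mul (s : ℝ) (f g : Bd X.Ω) : X.m (X.tr s f * g) = X.m (f * X.tr (-s) g) := by
  rw [← X.m_tr s (f * X.tr (-s) g), map_mul (X.tr s), tr_tr]; simp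

/-- parametrised translation -/
def act {P : Type} (x : P → ℝ) : Bd X.Ω →ₐ[ℝ] Bd (P × X.Ω) := Bd.comp (fun p => X.T (x p.1) p.2)
@[simp] theorem act_apply {P : Type} (x : P → ℝ) (f : Bd X.Ω) (p : P × X.Ω) : X.act x f p = f (X.T (x p.1) p.2) := rfl
theorem comp_act {P : Type} (x : P → ℝ) (f : Bd X.Ω) (p : P) :
    Bd.comp (fun ω => (p, ω)) (X.act x f) = X.tr (x p) f := rfl

def TInv (Z : Subalgebra ℝ (Bd X.Ω)) : Prop := ∀ s f, f ∈ Z → X.tr s f ∈ Z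

end Sys

section
variable {Ω : Type}

/-- L2 closure -/
def cl (m : Mean Ω) (A : Subalgebra ℝ (Bd Ω)) : Subalgebra ℝ (Bd Ω) where
  carrier := {f | ∀ ε > 0, ∃ g ∈ A, m.d2 f g ≤ ε}
  mul_mem' := by
    intro f f' hf hf' ε hε
    obtain ⟨C, hC0, hC⟩ := f.bound
    obtain ⟨D', hD', h1⟩ := hf' (ε / (4 * C ^ 2)) (by positivity)
    obtain ⟨B, hB0, hB⟩ := D'.bound
    obtain ⟨D, hD, h2⟩ := hf (ε / (4 * B ^ 2)) (by positivity)
    refine ⟨D * D', A.mul_mem hD hD', ?_⟩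
    have a := m.d2_tri (f * f') (f * D') (D * D')
    have b := m.d2_mul f' D' f hC
    have c := m.d2_mul f D D' hB
    rw [mul_comm f' f, mul_comm D' f] at b
    have h1' := mul_le_mul_of_nonneg_left h1 (show 0 ≤ C ^ 2 by positivity)
    have h2' := mul_le_mul_of_nonneg_left h2 (show 0 ≤ B ^ 2 by positivity)
    have e1 : C ^ 2 * (ε / (4 * C ^ 2)) = ε / 4 := by field_simp
    have e2 : B ^ 2 * (ε / (4 * B ^ 2)) = ε / 4 := by field_simp
    linarith
  add_mem' := by
    intro f f' hf hf' ε hε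
    obtain ⟨D', hD', h1⟩ := hf' (ε / 4) (by positivity)
    obtain ⟨D, hD, h2⟩ := hf (ε / 4) (by positivity)
    refine ⟨D + D', A.add_mem hD hD', ?_⟩
    have a := m.d2_tri (f + f') (f + D') (D + D')
    have b : m.d2 (f + f') (f + D') = m.d2 f' D' := by unfold Mean.d2; congr 1; ring
    have c : m.d2 (f + D') (D + D') = m.d2 f D := by unfold Mean.d2; congr 1; ring
    linarith
  algebraMap_mem' r := fun ε hε => ⟨_, A.algebraMap_mem r, by simp [Mean.d2, hε.le]⟩

theorem mem_cl (m : Mean Ω) (A : Subalgebra ℝ (Bd Ω)) (f : Bd Ω) : f ∈ cl m A ↔ ∀ ε > 0, ∃ g ∈ A, m.d2 f g ≤ ε := Iff.rfl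
theorem le_cl (m : Mean Ω) (A : Subalgebra ℝ (Bd Ω)) {f : Bd Ω} (hf : f ∈ A) : f ∈ cl m A :=
  fun ε hε => ⟨f, hf, by simp [Mean.d2, hε.le]⟩

theorem clo_cl (m : Mean Ω) (A : Subalgebra ℝ (Bd Ω)) : Clo m (cl m A) := by
  intro f hf ε hε
  obtain ⟨g, hg, h1⟩ := hf (ε / 4) (by positivity)
  obtain ⟨D, hD, h2⟩ := hg (ε / 4) (by positivity)
  exact ⟨D, hD, by have := m.d2_tri f g D; linarith⟩

end

theorem tinv_cl (X : Sys) {A : Subalgebra ℝ (Bd X.Ω)} (hA : X.TInv A) : X.TInv (cl X.m A) := by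
  intro s f hf ε hε
  obtain ⟨g, hg, h⟩ := hf ε hε
  exact ⟨X.tr s g, hA s g hg, by rwa [X.d2_tr]⟩

section ce
variable {Ω : Type} {m : Mean Ω} (hm : L2C m) {Z : Subalgebra ℝ (Bd Ω)} (hZ : Clo m Z)

noncomputable def ce (f : Bd Ω) : Bd Ω := (exists_ce hm hZ f).choose
theorem ce_mem (f : Bd Ω) : ce hm hZ f ∈ Z := (exists_ce hm hZ f).choose_spec.1
theorem ce_mul (f : Bd Ω) {h : Bd Ω} (hh : h ∈ Z) : m (ce hm hZ f * h) = m (f * h) :=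
  (exists_ce hm hZ f).choose_spec.2.1 h hh
theorem ce_between (f : Bd Ω) {a b : ℝ} (h : ∀ ω, a ≤ f ω ∧ f ω ≤ b) (ω : Ω) : a ≤ ce hm hZ f ω ∧ ce hm hZ f ω ≤ b :=
  (exists_ce hm hZ f).choose_spec.2.2 a b h ω
theorem ce_nonneg (f : Bd Ω) (h : ∀ ω, 0 ≤ f ω) (ω : Ω) : 0 ≤ ce hm hZ f ω := by
  obtain ⟨C, -, hC⟩ := f.bound
  exact (ce_between hm hZ f (b := C) (fun ω => ⟨h ω, (abs_le.mp (hC ω)).2⟩) ω).1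
theorem ce_abs_le (f : Bd Ω) {C : ℝ} (h : ∀ ω, |f ω| ≤ C) (ω : Ω) : |ce hm hZ f ω| ≤ C :=
  abs_le.mpr (ce_between hm hZ f (fun ω => abs_le.mp (h ω)) ω)

/-- null functions -/
def nul (m : Mean Ω) : Ideal (Bd Ω) where
  carrier := {f | ∀ g, m (f * g) = 0}
  add_mem' := by intro a b ha hb g; rw [add_mul, map_add, ha, hb, add_zero]
  zero_mem' := by intro g; simp
  smul_mem' := by intro c f hf g; rw [smul_eq_mul, mul_comm c f, mul_assoc]; exact hf _
theorem mem_nul (f : Bd Ω) : f ∈ nul m ↔ ∀ g, m (f * g) = 0 := Iff.rfl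
theorem nul_of_sq {f : Bd Ω} (h : m (f * f) = 0) : f ∈ nul m := fun g => m.eq_zero_of_sq h g
theorem nul_zero {f : Bd Ω} (h : f ∈ nul m) : m f = 0 := by simpa using h 1
theorem nul_smul {f : Bd Ω} (h : f ∈ nul m) (c : ℝ) : c • f ∈ nul m := by
  intro g; rw [smul_mul_assoc, m.smul', h, mul_zero]

theorem ce_unique {f G : Bd Ω} (hG : G ∈ Z) (h : ∀ h ∈ Z, m (G * h) = m (f * h)) : ce hm hZ f - G ∈ nul m := by
  apply nul_of_sq
  have h1 : ce hm hZ f - G ∈ Z := Z.sub_mem (ce_mem hm hZ f) hG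
  rw [sub_mul, map_sub, ce_mul hm hZ f h1, h _ h1, sub_self]

theorem ce_mean (f : Bd Ω) : m (ce hm hZ f) = m f := by
  have := ce_mul hm hZ f Z.one_mem; simpa using this
end ce

theorem ce_tr (X : Sys) {Z : Subalgebra ℝ (Bd X.Ω)} (hZ : Clo X.m Z) (hT : X.TInv Z) (s : ℝ) (f : Bd X.Ω) :
    ce X.cpl hZ (X.tr s f) - X.tr s (ce X.cpl hZ f) ∈ nul X.m := by
  apply ce_unique X.cpl hZ (hT s _ (ce_mem _ _ _))
  intro h hh
  rw [X.m_tr_mul, ce_mul X.cpl hZ f (hT _ _ hh), X.m_tr_mul]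

/-- positivity for bilinear forms -/
theorem bil_pos {Ω : Type} (L : Bd Ω →ₗ[ℝ] Bd Ω →ₗ[ℝ] ℝ) (hL : ∀ a b : Bd Ω, (∀ x, 0 ≤ a x) → (∀ x, 0 ≤ b x) → 0 ≤ L a b)
    {ι : Type} [Fintype ι] (A B : ι → Bd Ω) (h : ∀ x y, 0 ≤ ∑ k, A k x * B k y) : 0 ≤ ∑ k, L (A k) (B k) := by
  -- bound
  have hbd : ∀ (a b : Bd Ω) (C D : ℝ), (∀ x, |a x| ≤ C) → (∀ x, |b x| ≤ D) → |L a b| ≤ C * D * L 1 1 := by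
    intro a b C D ha hb
    have p1 := hL (algebraMap ℝ _ C - a) (algebraMap ℝ _ D + b) (fun x => by have := abs_le.mp (ha x); simp; linarith) (fun x => by have := abs_le.mp (hb x); simp; linarith)
    have p2 := hL (algebraMap ℝ _ C + a) (algebraMap ℝ _ D - b) (fun x => by have := abs_le.mp (ha x); simp; linarith) (fun x => by have := abs_le.mp (hb x); simp; linarith)
    have p3 := hL (algebraMap ℝ _ C + a) (algebraMap ℝ _ D + b) (fun x => by have := abs_le.mp (ha x); simp; linarith) (fun x => by have := abs_le.mp (hb x); simp; linarith)
    have p4 := hL (algebraMap ℝ _ C - a) (algebraMap ℝ _ D - b) (fun x => by have := abs_le.mp (ha x); simp; linarith) (fun x => by have := abs_le.mp (hb x); simp; linarith)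
    simp only [Algebra.algebraMap_eq_smul_one, map_add, map_sub, LinearMap.add_apply, LinearMap.sub_apply, map_smul, LinearMap.smul_apply, smul_eq_mul] at p1 p2 p3 p4
    rw [abs_le]; constructor <;> linarith
  have hAb : ∃ C, 0 < C ∧ ∀ k x, |A k x| ≤ C := by
    choose C hC0 hC using fun k => (A k).bound
    refine ⟨∑ k, C k + 1, by have := Finset.sum_nonneg (s := Finset.univ) (fun k _ => (hC0 k).le); linarith, fun k x => (hC k x).trans ?_⟩
    have := Finset.single_le_sum (f := C) (fun k _ => (hC0 k).le) (Finset.mem_univ k)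
    linarith
  obtain ⟨C, hC0, hC⟩ := hAb
  have hBb : ∃ D, 0 < D ∧ ∀ k x, |B k x| ≤ D := by
    choose C hC0 hC using fun k => (B k).bound
    refine ⟨∑ k, C k + 1, by have := Finset.sum_nonneg (s := Finset.univ) (fun k _ => (hC0 k).le); linarith, fun k x => (hC k x).trans ?_⟩
    have := Finset.single_le_sum (f := C) (fun k _ => (hC0 k).le) (Finset.mem_univ k)
    linarith
  obtain ⟨D, hD0, hD⟩ := hBb
  have hL1 : 0 ≤ L 1 1 := hL 1 1 (fun x => zero_le_one) (fun x => zero_le_one)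
  have key : ∀ ε > 0, -(Fintype.card ι * (C * ε * L 1 1)) ≤ ∑ k, L (A k) (B k) := by
    intro ε hε
    classical
    let g : Ω → (ι → ℤ) := fun x k => ⌊B k x / ε⌋
    have hfin : (Set.range g).Finite := by
      refine (Set.Finite.pi (fun k : ι => Set.finite_Icc (⌊-D / ε⌋) (⌊D / ε⌋))).subset ?_
      rintro _ ⟨x, rfl⟩
      intro k _
      have := abs_le.mp (hD k x)
      exact ⟨Int.floor_le_floor (by gcongr; linarith), Int.floor_le_floor (by gcongr; linarith)⟩
    haveI : Fintype (Set.range g) := hfin.fintype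
    have hx : ∀ q : Set.range g, ∃ x, g x = q.1 := fun q => q.2
    choose pt hpt using hx
    let Q : Set.range g → Bd Ω := fun q => Bd.mk' (fun x => if g x = q.1 then 1 else 0) 1 (fun x => by split_ifs <;> simp)
    let B' : ι → Bd Ω := fun k => ∑ q, (B k (pt q)) • Q q
    have hB' : ∀ k x, |(B k - B' k) x| ≤ ε := by
      intro k x
      have e : B' k x = B k (pt ⟨g x, x, rfl⟩) := by
        simp only [B', Bd.sum_apply, Bd.smul_apply, Q, Bd.mk'_apply]
        rw [Finset.sum_eq_single ⟨g x, x, rfl⟩]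
        · simp
        · intro q _ hq
          rw [if_neg, mul_zero]
          intro h; exact hq (Subtype.ext h.symm)
        · simp
      have h1 : ⌊B k (pt ⟨g x, x, rfl⟩) / ε⌋ = ⌊B k x / ε⌋ := congrFun (hpt ⟨g x, x, rfl⟩) k
      have h2 := Int.abs_sub_lt_one_of_floor_eq_floor h1
      rw [Bd.sub_apply, e, abs_sub_comm]
      rw [← sub_div, abs_div, abs_of_pos hε, div_lt_one hε] at h2
      exact h2.le
    have h1 : 0 ≤ ∑ k, L (A k) (B' k) := by
      have : ∑ k, L (A k) (B' k) = ∑ q, L (∑ k, (B k (pt q)) • A k) (Q q) := by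
        simp only [B', map_sum, LinearMap.sum_apply, map_smul, LinearMap.smul_apply]
        rw [Finset.sum_comm]
      rw [this]
      refine Finset.sum_nonneg fun q _ => hL _ _ (fun x => ?_) (fun x => ?_)
      · simp only [Bd.sum_apply, Bd.smul_apply]
        have := h x (pt q)
        simpa [mul_comm] using this
      · simp only [Q, Bd.mk'_apply]; split_ifs <;> simp
    have h2 : |∑ k, L (A k) (B k - B' k)| ≤ Fintype.card ι * (C * ε * L 1 1) := by
      refine (Finset.abs_sum_le_sum_abs _ _).trans ?_
      have := Finset.sum_le_sum (s := Finset.univ) fun k _ => hbd (A k) (B k - B' k) C ε (hC k) (hB' k)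
      simpa using this
    have h3 : ∑ k, L (A k) (B k - B' k) = ∑ k, L (A k) (B k) - ∑ k, L (A k) (B' k) := by
      simp [Finset.sum_sub_distrib]
    rw [h3] at h2
    linarith [(abs_le.mp h2).1]
  have lim : Tendsto (fun n : ℕ => -(Fintype.card ι * (C * (1 / ((n : ℝ) + 1)) * L 1 1))) atTop (𝓝 (-(Fintype.card ι * (C * 0 * L 1 1)))) :=
    (((tendsto_one_div_add_atTop_nhds_zero_nat.const_mul C).mul_const _).const_mul _).neg
  have := le_of_tendsto' lim (fun n => key _ (by positivity))
  simpa using this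

end Sz

/-! Part 5 -/

namespace Sz
open Topology

/-- relative almost periodicity -/
def IsAP (X : Sys) (Z : Subalgebra ℝ (Bd X.Ω)) (D : Bd X.Ω) : Prop :=
  ∀ ε > 0, ∃ (ι : Type) (_ : Fintype ι) (g : ι → Bd X.Ω) (κ : Bd X.Ω), κ ∈ Z ∧ (∀ ω, 0 ≤ κ ω) ∧ X.m κ ≤ ε ∧
    ∀ s, ∃ c : ι → Bd X.Ω, (∀ i, c i ∈ Z ∧ ∀ ω, |c i ω| ≤ 1) ∧ ∀ χ ∈ Z, (∀ ω, 0 ≤ χ ω) →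
      X.m (χ * ((X.tr s D - ∑ i, c i * g i) * (X.tr s D - ∑ i, c i * g i))) ≤ X.m (χ * κ)

def AP (X : Sys) (Z : Subalgebra ℝ (Bd X.Ω)) : Subalgebra ℝ (Bd X.Ω) where
  carrier := {D | IsAP X Z D}
  algebraMap_mem' := by
    intro r ε hε
    refine ⟨Unit, inferInstance, fun _ => algebraMap ℝ _ r, 0, Z.zero_mem, fun ω => le_rfl, by simpa using hε.le,
      fun s => ⟨fun _ => 1, fun _ => ⟨Z.one_mem, fun ω => by simp⟩, fun χ _ _ => ?_⟩⟩
    have : X.tr s (algebraMap ℝ _ r) - ∑ i : Unit, (1 : Bd X.Ω) * algebraMap ℝ _ r = 0 := by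
      ext ω; simp
    rw [this]; simp
  add_mem' := by
    intro D D' hD hD' ε hε
    obtain ⟨ι, i1, g, κ, hκ, hκ0, hκm, h⟩ := hD (ε / 4) (by positivity)
    obtain ⟨ι', i1', g', κ', hκ', hκ0', hκm', h'⟩ := hD' (ε / 4) (by positivity)
    refine ⟨ι ⊕ ι', inferInstance, Sum.elim g g', (2 : ℝ) • κ + (2 : ℝ) • κ', Z.add_mem (Z.smul_mem hκ _) (Z.smul_mem hκ' _),
      fun ω => by have := hκ0 ω; have := hκ0' ω; simp; linarith, by rw [map_add, X.m.smul', X.m.smul']; linarith, fun s => ?_⟩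
    obtain ⟨c, hc, hcχ⟩ := h s
    obtain ⟨c', hc', hcχ'⟩ := h' s
    refine ⟨Sum.elim c c', ?_, fun χ hχ hχ0 => ?_⟩
    · rintro (i | i)
      · exact hc i
      · exact hc' i
    · have e1 := hcχ χ hχ hχ0
      have e2 := hcχ' χ hχ hχ0
      have : X.m (χ * ((2 : ℝ) • κ + (2 : ℝ) • κ')) = 2 * X.m (χ * κ) + 2 * X.m (χ * κ') := by
        rw [mul_add, map_add, mul_smul_comm, mul_smul_comm, X.m.smul', X.m.smul']
      rw [this]
      refine le_trans ?_ (add_le_add (mul_le_mul_of_nonneg_left e1 two_pos.le) (mul_le_mul_of_nonneg_left e2 two_pos.le))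
      rw [← X.m.smul', ← X.m.smul', ← map_add]
      refine X.m.mono fun ω => ?_
      simp only [Fintype.sum_sum_type, Sum.elim_inl, Sum.elim_inr, map_add, Bd.mul_apply, Bd.add_apply, Bd.sub_apply, Bd.smul_apply]
      set P := (∑ i, c i * g i) ω
      set P' := (∑ i, c' i * g' i) ω
      set d := (X.tr s D) ω
      set d' := (X.tr s D') ω
      nlinarith [mul_nonneg (hχ0 ω) (sq_nonneg ((d - P) - (d' - P')))]
  mul_mem' := by
    intro D D' hD hD' ε hε
    obtain ⟨C, hC0, hC⟩ := D'.bound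
    obtain ⟨ι, i1, g, κ, hκ, hκ0, hκm, h⟩ := hD (ε / (4 * C ^ 2)) (by positivity)
    choose B0 hB00 hB0 using fun i => (g i).bound
    set B := ∑ i, B0 i + 1 with hB
    have hBpos : 0 < B := by
      have := Finset.sum_nonneg (s := Finset.univ) (fun i _ => (hB00 i).le); linarith
    obtain ⟨ι', i1', g', κ', hκ', hκ0', hκm', h'⟩ := hD' (ε / (4 * B ^ 2)) (by positivity)
    refine ⟨ι × ι', inferInstance, fun p => g p.1 * g' p.2, (2 * C ^ 2 : ℝ) • κ + (2 * B ^ 2 : ℝ) • κ', Z.add_mem (Z.smul_mem hκ _) (Z.smul_mem hκ' _),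
      fun ω => by
        have := hκ0 ω; have := hκ0' ω
        simp only [Bd.add_apply, Bd.smul_apply]; positivity, ?_, fun s => ?_⟩
    · rw [map_add, X.m.smul', X.m.smul']
      have h1' := mul_le_mul_of_nonneg_left hκm (show 0 ≤ 2 * C ^ 2 by positivity)
      have h2' := mul_le_mul_of_nonneg_left hκm' (show 0 ≤ 2 * B ^ 2 by positivity)
      have e1 : 2 * C ^ 2 * (ε / (4 * C ^ 2)) = ε / 2 := by field_simp; norm_num
      have e2 : 2 * B ^ 2 * (ε / (4 * B ^ 2)) = ε / 2 := by field_simp; norm_num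
      linarith
    obtain ⟨c, hc, hcχ⟩ := h s
    obtain ⟨c', hc', hcχ'⟩ := h' s
    refine ⟨fun p => c p.1 * c' p.2, ?_, fun χ hχ hχ0 => ?_⟩
    · rintro ⟨i, j⟩
      refine ⟨Z.mul_mem (hc i).1 (hc' j).1, fun ω => ?_⟩
      simp only [Bd.mul_apply, abs_mul]
      exact mul_le_one₀ ((hc i).2 ω) (abs_nonneg _) ((hc' j).2 ω)
    · have e1 := hcχ χ hχ hχ0
      have e2 := hcχ' χ hχ hχ0
      have : X.m (χ * ((2 * C ^ 2 : ℝ) • κ + (2 * B ^ 2 : ℝ) • κ')) = 2 * C ^ 2 * X.m (χ * κ) + 2 * B ^ 2 * X.m (χ * κ') := by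
        rw [mul_add, map_add, mul_smul_comm, mul_smul_comm, X.m.smul', X.m.smul']
      rw [this]
      refine le_trans ?_ (add_le_add (mul_le_mul_of_nonneg_left e1 (by positivity)) (mul_le_mul_of_nonneg_left e2 (by positivity)))
      rw [← X.m.smul', ← X.m.smul', ← map_add]
      refine X.m.mono fun ω => ?_
      have hsum : ∑ p : ι × ι', c p.1 * c' p.2 * (g p.1 * g' p.2) = (∑ i, c i * g i) * (∑ i, c' i * g' i) := by
        rw [Fintype.sum_prod_type, Finset.sum_mul_sum]
        refine Finset.sum_congr rfl fun i _ => Finset.sum_congr rfl fun j _ => by ring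
      have hPb : |(∑ i, c i * g i) ω| ≤ B := by
        rw [Bd.sum_apply]
        refine (Finset.abs_sum_le_sum_abs _ _).trans ?_
        rw [hB]
        refine le_trans (Finset.sum_le_sum fun i _ => ?_) (le_add_of_nonneg_right zero_le_one)
        rw [Bd.mul_apply, abs_mul]
        exact (mul_le_of_le_one_left (abs_nonneg _) ((hc i).2 ω)).trans (hB0 i ω)
      have hDb : |(X.tr s D') ω| ≤ C := hC _
      rw [hsum]
      simp only [map_mul, Bd.mul_apply, Bd.add_apply, Bd.sub_apply, Bd.smul_apply]
      set P := (∑ i, c i * g i) ω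
      set P' := (∑ i, c' i * g' i) ω
      set d := (X.tr s D) ω
      set d' := (X.tr s D') ω
      have f1 : d' ^ 2 ≤ C ^ 2 := sq_le_sq' (abs_le.mp hDb).1 (abs_le.mp hDb).2
      have f2 : P ^ 2 ≤ B ^ 2 := sq_le_sq' (abs_le.mp hPb).1 (abs_le.mp hPb).2
      have f3 : (d * d' - P * P') * (d * d' - P * P') ≤ 2 * C ^ 2 * ((d - P) * (d - P)) + 2 * B ^ 2 * ((d' - P') * (d' - P')) := by
        have a1 := mul_le_mul_of_nonneg_right f1 (sq_nonneg (d - P))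
        have a2 := mul_le_mul_of_nonneg_right f2 (sq_nonneg (d' - P'))
        have a3 := sq_nonneg ((d - P) * d' - P * (d' - P'))
        nlinarith
      have := mul_le_mul_of_nonneg_left f3 (hχ0 ω)
      linarith

theorem tinv_AP (X : Sys) (Z : Subalgebra ℝ (Bd X.Ω)) : X.TInv (AP X Z) := by
  intro t D hD ε hε
  obtain ⟨ι, i1, g, κ, hκ, hκ0, hκm, h⟩ := hD ε hε
  refine ⟨ι, i1, g, κ, hκ, hκ0, hκm, fun s => ?_⟩
  rw [X.tr_tr]; exact h (s + t)

/-- the tower of characteristic algebras -/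
def ZZ (X : Sys) : ℕ → Subalgebra ℝ (Bd X.Ω)
  | 0 => cl X.m ⊥
  | d + 1 => cl X.m (AP X (ZZ X d))

theorem clo_ZZ (X : Sys) (d : ℕ) : Clo X.m (ZZ X d) := by
  cases d <;> exact clo_cl _ _
theorem tinv_ZZ (X : Sys) (d : ℕ) : X.TInv (ZZ X d) := by
  cases d
  · apply tinv_cl
    intro s f hf
    rw [Algebra.mem_bot] at hf ⊢
    obtain ⟨c, rfl⟩ := hf
    exact ⟨c, by simp⟩
  · exact tinv_cl X (tinv_AP X _)

section dual
variable (X : Sys) {Z : Subalgebra ℝ (Bd X.Ω)} (hZ : Clo X.m Z) (f : Bd X.Ω)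

local notation "E(" a ")" => ce X.cpl hZ a

/-- bilinear form of the relative square -/
noncomputable def bil (χ : Bd X.Ω) (hχ : χ ∈ Z) : Bd X.Ω →ₗ[ℝ] Bd X.Ω →ₗ[ℝ] ℝ :=
  have e : ∀ a b, X.m (χ * (E(a) * E(b))) = X.m (a * (χ * E(b))) := fun a b => by
    rw [← ce_mul X.cpl hZ a (Z.mul_mem hχ (ce_mem _ _ b))]; congr 1; ring
  have e' : ∀ a b, X.m (χ * (E(a) * E(b))) = X.m (b * (χ * E(a))) := fun a b => by
    rw [← ce_mul X.cpl hZ b (Z.mul_mem hχ (ce_mem _ _ a))]; congr 1; ring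
  LinearMap.mk₂ ℝ (fun a b => X.m (χ * (E(a) * E(b))))
    (fun a a' b => by simp only [e, add_mul, map_add])
    (fun c a b => by simp only [e, smul_mul_assoc, map_smul])
    (fun a b b' => by simp only [e', add_mul, map_add])
    (fun c a b => by simp only [e', smul_mul_assoc, map_smul])

theorem bil_apply (χ : Bd X.Ω) (hχ : χ ∈ Z) (a b : Bd X.Ω) : bil X hZ χ hχ a b = X.m (χ * (E(a) * E(b))) := rfl

theorem bil_psd (χ : Bd X.Ω) (hχ : χ ∈ Z) (hχ0 : ∀ ω, 0 ≤ χ ω) {ι : Type} [Fintype ι] (w : ι → ℝ) (a b : ι → Bd X.Ω) :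
    0 ≤ ∑ i, ∑ j, w i * w j * bil X hZ χ hχ (a i * a j) (b i * b j) := by
  have := bil_pos (bil X hZ χ hχ) (fun a b ha hb => X.m.nonneg fun ω =>
      mul_nonneg (hχ0 ω) (mul_nonneg (ce_nonneg _ _ _ ha ω) (ce_nonneg _ _ _ hb ω)))
    (ι := ι × ι) (fun p => (w p.1 * w p.2) • (a p.1 * a p.2)) (fun p => b p.1 * b p.2) (by
      intro x y
      have : ∑ k : ι × ι, ((w k.1 * w k.2) • (a k.1 * a k.2)) x * (b k.1 * b k.2) y = (∑ i, w i * a i x * b i y) * (∑ i, w i * a i x * b i y) := by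
        rw [Fintype.sum_prod_type, Finset.sum_mul_sum]
        refine Finset.sum_congr rfl fun i _ => Finset.sum_congr rfl fun j _ => by simp; ring
      rw [this]; exact mul_self_nonneg _)
  rw [Fintype.sum_prod_type] at this
  simpa using this

theorem bil_cs (χ : Bd X.Ω) (hχ : χ ∈ Z) (hχ0 : ∀ ω, 0 ≤ χ ω) {ι : Type} [Fintype ι] (w : ι → ℝ) (a b : ι → Bd X.Ω) (u v : Bd X.Ω) :
    (∑ i, w i * bil X hZ χ hχ (a i * u) (b i * v)) ^ 2 ≤
      (∑ i, ∑ j, w i * w j * bil X hZ χ hχ (a i * a j) (b i * b j)) * bil X hZ χ hχ (u * u) (v * v) := by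
  set Q := ∑ i, ∑ j, w i * w j * bil X hZ χ hχ (a i * a j) (b i * b j)
  set R := ∑ i, w i * bil X hZ χ hχ (a i * u) (b i * v)
  set S := bil X hZ χ hχ (u * u) (v * v)
  have h : ∀ t : ℝ, 0 ≤ S * (t * t) + (2 * R) * t + Q := by
    intro t
    have := bil_psd X hZ χ hχ hχ0 (ι := Option ι) (fun o => o.elim t w) (fun o => o.elim u a) (fun o => o.elim v b)
    simp only [Fintype.sum_option, Option.elim_none, Option.elim_some, Finset.sum_add_distrib] at this
    have e1 : ∑ i, t * w i * bil X hZ χ hχ (u * a i) (v * b i) = t * R := by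
      rw [Finset.mul_sum]; refine Finset.sum_congr rfl fun i _ => by rw [mul_comm u, mul_comm v]; ring
    have e2 : ∑ i, w i * t * bil X hZ χ hχ (a i * u) (b i * v) = t * R := by
      rw [Finset.mul_sum]; refine Finset.sum_congr rfl fun i _ => by ring
    rw [e1, e2] at this
    change 0 ≤ t * t * S + t * R + (t * R + Q) at this
    linarith
  have := discrim_le_zero h
  unfold discrim at this
  nlinarith

end dual

end Sz

/-! Part 6 -/

namespace Sz
open Topology

theorem sq_of_nul {Ω : Type} {m : Mean Ω} {a b : Bd Ω} (h : a - b ∈ nul m) : m (a * a) = m (b * b) := by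
  have := h (a + b)
  rw [show (a - b) * (a + b) = a * a - b * b by ring, map_sub] at this
  linarith

section dual
variable (X : Sys) {Z : Subalgebra ℝ (Bd X.Ω)} (hZ : Clo X.m Z) (f : Bd X.Ω)

noncomputable def eSq (s t : ℝ) : Bd X.Ω :=
  ce X.cpl hZ (X.tr s f * X.tr t f) * ce X.cpl hZ (X.tr s f * X.tr t f)

noncomputable def kap : (ℝ →₀ ℝ) →ₗ[ℝ] (ℝ →₀ ℝ) →ₗ[ℝ] Bd X.Ω :=
  Finsupp.linearCombination ℝ (fun s => Finsupp.linearCombination ℝ (fun t => eSq X hZ f s t))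

noncomputable def SS (v : Bd X.Ω) : (ℝ →₀ ℝ) →ₗ[ℝ] Bd X.Ω :=
  Finsupp.linearCombination ℝ (fun s => X.tr s f * ce X.cpl hZ (X.tr s f * v))

theorem kap_eq (w w' : ℝ →₀ ℝ) : kap X hZ f w w' = ∑ s : w.support, ∑ t : w'.support, (w s * w' t) • eSq X hZ f s t := by
  simp only [kap, Finsupp.linearCombination_apply, Finsupp.sum, LinearMap.sum_apply, LinearMap.smul_apply, Finset.smul_sum, smul_smul]
  rw [← Finset.sum_coe_sort w.support]
  refine Finset.sum_congr rfl fun s _ => ?_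
  rw [← Finset.sum_coe_sort w'.support]

theorem SS_eq (v : Bd X.Ω) (w : ℝ →₀ ℝ) : SS X hZ f v w = ∑ s : w.support, w s • (X.tr s f * ce X.cpl hZ (X.tr s f * v)) := by
  simp only [SS, Finsupp.linearCombination_apply, Finsupp.sum]
  rw [← Finset.sum_coe_sort w.support]

theorem kap_mem (w w' : ℝ →₀ ℝ) : kap X hZ f w w' ∈ Z := by
  rw [kap_eq]
  exact Z.sum_mem fun s _ => Z.sum_mem fun t _ => Z.smul_mem (Z.mul_mem (ce_mem _ _ _) (ce_mem _ _ _)) _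

theorem kap_comm (w w' : ℝ →₀ ℝ) : kap X hZ f w w' = kap X hZ f w' w := by
  rw [kap_eq, kap_eq, Finset.sum_comm]
  refine Finset.sum_congr rfl fun s _ => Finset.sum_congr rfl fun t _ => ?_
  rw [mul_comm]; simp only [eSq]; rw [mul_comm (X.tr _ f) (X.tr _ f)]

theorem kap_bil (χ : Bd X.Ω) (hχ : χ ∈ Z) (w : ℝ →₀ ℝ) : X.m (χ * kap X hZ f w w) =
    ∑ s : w.support, ∑ t : w.support, w s * w t * bil X hZ χ hχ (X.tr s f * X.tr t f) (X.tr s f * X.tr t f) := by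
  rw [kap_eq]
  simp only [Finset.mul_sum, map_sum, mul_smul_comm, Mean.smul', bil_apply, eSq]

theorem kap_nonneg (χ : Bd X.Ω) (hχ : χ ∈ Z) (hχ0 : ∀ ω, 0 ≤ χ ω) (w : ℝ →₀ ℝ) : 0 ≤ X.m (χ * kap X hZ f w w) := by
  rw [kap_bil X hZ f χ hχ]
  exact bil_psd X hZ χ hχ hχ0 (fun s : w.support => w s) (fun s => X.tr s f) (fun s => X.tr s f)

theorem SS_sq (χ : Bd X.Ω) (hχ : χ ∈ Z) (hχ0 : ∀ ω, 0 ≤ χ ω) (w : ℝ →₀ ℝ) (v : Bd X.Ω) (hv : ∀ ω, |v ω| ≤ 1) :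
    X.m (χ * (SS X hZ f v w * SS X hZ f v w)) ≤ X.m (χ * kap X hZ f w w) := by
  set u := SS X hZ f v w with hu
  have h1 := bil_cs X hZ χ hχ hχ0 (fun s : w.support => w s) (fun s => X.tr s f) (fun s => X.tr s f) u v
  rw [← kap_bil X hZ f χ hχ] at h1
  have h2 : ∑ s : w.support, w s * bil X hZ χ hχ (X.tr s f * u) (X.tr s f * v) = X.m (χ * (u * u)) := by
    have : u * u = ∑ s : w.support, w s • ((X.tr s f * u) * ce X.cpl hZ (X.tr s f * v)) := by
      have hu' : u = ∑ s : w.support, w s • (X.tr s f * ce X.cpl hZ (X.tr s f * v)) := SS_eq X hZ f v w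
      calc u * u = (∑ s : w.support, w s • (X.tr s f * ce X.cpl hZ (X.tr s f * v))) * u := by rw [← hu']
        _ = _ := Finset.sum_mul _ _ _
        _ = _ := ?_
      refine Finset.sum_congr rfl fun s _ => ?_
      rw [smul_mul_assoc]; congr 1; ring
    rw [this, Finset.mul_sum, map_sum]
    refine Finset.sum_congr rfl fun s _ => ?_
    rw [mul_smul_comm, Mean.smul', bil_apply]
    congr 1
    rw [show χ * (X.tr s f * u * ce X.cpl hZ (X.tr s f * v)) = (X.tr s f * u) * (χ * ce X.cpl hZ (X.tr s f * v)) by ring,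
      ← ce_mul X.cpl hZ (X.tr s f * u) (Z.mul_mem hχ (ce_mem _ _ _))]
    congr 1; ring
  have h3 : bil X hZ χ hχ (u * u) (v * v) ≤ X.m (χ * (u * u)) := by
    rw [bil_apply, mul_comm χ (u * u), ← ce_mul X.cpl hZ (u * u) hχ]
    refine X.m.mono fun ω => ?_
    have a1 := hχ0 ω
    have a2 := ce_nonneg X.cpl hZ (u * u) (fun ω => mul_self_nonneg _) ω
    have a3 := ce_between X.cpl hZ (v * v) (a := 0) (b := 1) (fun ω => ⟨mul_self_nonneg _, by
      have := abs_le.mp (hv ω); simp only [Bd.mul_apply]; nlinarith⟩) ω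
    simp only [Bd.mul_apply]
    rw [← mul_assoc, mul_comm (χ ω)]
    exact mul_le_of_le_one_right (mul_nonneg a2 a1) a3.2
  have h4 := kap_nonneg X hZ f χ hχ hχ0 w
  rw [h2] at h1
  have h5 : 0 ≤ X.m (χ * (u * u)) := X.m.nonneg fun ω => mul_nonneg (hχ0 ω) (mul_self_nonneg _)
  rcases h5.eq_or_lt with h6 | h6
  · rw [← h6]; exact h4
  · have := h1.trans (mul_le_mul_of_nonneg_left h3 h4)
    rw [sq] at this
    exact le_of_mul_le_mul_right this h6

def KK : Set (ℝ →₀ ℝ) := {w | (∀ s, 0 ≤ w s) ∧ Finsupp.linearCombination ℝ (fun _ => (1 : ℝ)) w = 1}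

theorem KK_sum {w : ℝ →₀ ℝ} (hw : w ∈ KK) : ∑ s : w.support, w s = 1 := by
  have := hw.2
  simp only [Finsupp.linearCombination_apply, Finsupp.sum, smul_eq_mul, mul_one] at this
  rw [← this, ← Finset.sum_coe_sort w.support]

theorem KK_single (h : ℝ) : Finsupp.single h (1 : ℝ) ∈ KK := by
  refine ⟨fun s => ?_, by simp⟩
  rw [Finsupp.single_apply]; split_ifs <;> simp

theorem KK_conv {w w' : ℝ →₀ ℝ} (hw : w ∈ KK) (hw' : w' ∈ KK) {t : ℝ} (h0 : 0 ≤ t) (h1 : t ≤ 1) : (1 - t) • w + t • w' ∈ KK := by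
  refine ⟨fun s => ?_, by simp only [map_add, map_smul, hw.2, hw'.2]; simp⟩
  have := hw.1 s; have := hw'.1 s
  simp only [Finsupp.add_apply, Finsupp.smul_apply, smul_eq_mul]
  have : 0 ≤ 1 - t := by linarith
  positivity

theorem KK_shift {w : ℝ →₀ ℝ} (hw : w ∈ KK) (s : ℝ) : Finsupp.mapDomain (fun x => x + s) w ∈ KK := by
  refine ⟨fun t => ?_, ?_⟩
  · have hinj : Function.Injective (fun x : ℝ => x + s) := add_left_injective s
    have : Finsupp.mapDomain (fun x => x + s) w t = w (t - s) := by
      have := Finsupp.mapDomain_apply hinj w (t - s)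
      simpa using this
    rw [this]; exact hw.1 _
  · rw [Finsupp.linearCombination_mapDomain]; exact hw.2


theorem prod_le (hf : ∀ ω, |f ω| ≤ 1) (s t : ℝ) (ω : X.Ω) : |(X.tr s f * X.tr t f) ω| ≤ 1 := by
  rw [Bd.mul_apply, abs_mul]; exact mul_le_one₀ (hf _) (abs_nonneg _) (hf _)

theorem eSq_le (hf : ∀ ω, |f ω| ≤ 1) (s t : ℝ) (ω : X.Ω) : |eSq X hZ f s t ω| ≤ 1 := by
  have := ce_abs_le X.cpl hZ _ (prod_le X f hf s t) ω
  rw [eSq, Bd.mul_apply, abs_mul]; exact mul_le_one₀ this (abs_nonneg _) this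

theorem kap_le (hf : ∀ ω, |f ω| ≤ 1) {w w' : ℝ →₀ ℝ} (hw : w ∈ KK) (hw' : w' ∈ KK) (ω : X.Ω) : |kap X hZ f w w' ω| ≤ 1 := by
  rw [kap_eq]
  simp only [Bd.sum_apply, Bd.smul_apply]
  refine (Finset.abs_sum_le_sum_abs _ _).trans ?_
  calc _ ≤ ∑ s : w.support, ∑ t : w'.support, w s * w' t := by
        refine Finset.sum_le_sum fun s _ => (Finset.abs_sum_le_sum_abs _ _).trans (Finset.sum_le_sum fun t _ => ?_)
        rw [abs_mul, abs_of_nonneg (mul_nonneg (hw.1 s) (hw'.1 t))]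
        exact mul_le_of_le_one_right (mul_nonneg (hw.1 s) (hw'.1 t)) (eSq_le X hZ f hf _ _ ω)
    _ = 1 := by simp only [← Finset.mul_sum, KK_sum hw', mul_one, KK_sum hw]

theorem SS_le (hf : ∀ ω, |f ω| ≤ 1) {w : ℝ →₀ ℝ} (hw : w ∈ KK) (v : Bd X.Ω) (hv : ∀ ω, |v ω| ≤ 1) (ω : X.Ω) : |SS X hZ f v w ω| ≤ 1 := by
  rw [SS_eq]
  simp only [Bd.sum_apply, Bd.smul_apply]
  refine (Finset.abs_sum_le_sum_abs _ _).trans ?_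
  rw [← KK_sum hw]
  refine Finset.sum_le_sum fun s _ => ?_
  rw [abs_mul, abs_of_nonneg (hw.1 s), Bd.mul_apply, abs_mul]
  refine mul_le_of_le_one_right (hw.1 s) (mul_le_one₀ (hf _) (abs_nonneg _) (ce_abs_le X.cpl hZ _ (fun ω => ?_) ω))
  rw [Bd.mul_apply, abs_mul]; exact mul_le_one₀ (hf _) (abs_nonneg _) (hv _)


theorem eSq_tr (hT : X.TInv Z) (a s t : ℝ) : X.m (eSq X hZ f (s + a) (t + a)) = X.m (eSq X hZ f s t) := by
  have h := ce_tr X hZ hT a (X.tr s f * X.tr t f)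
  rw [map_mul, X.tr_tr, X.tr_tr, add_comm a s, add_comm a t] at h
  have := sq_of_nul h
  rw [← map_mul, X.m_tr] at this
  exact this

theorem kap_tr (hT : X.TInv Z) (a : ℝ) (w w' : ℝ →₀ ℝ) :
    X.m (kap X hZ f (Finsupp.mapDomain (fun x => x + a) w) (Finsupp.mapDomain (fun x => x + a) w')) = X.m (kap X hZ f w w') := by
  simp only [kap]
  induction w using Finsupp.induction_linear with
  | zero => simp
  | add u v hu hv => simp only [Finsupp.mapDomain_add, map_add, LinearMap.add_apply, hu, hv]
  | single s x =>
    induction w' using Finsupp.induction_linear with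
    | zero => simp
    | add u v hu hv => simp only [Finsupp.mapDomain_add, map_add, LinearMap.add_apply, hu, hv]
    | single t y =>
      simp only [Finsupp.mapDomain_single, Finsupp.linearCombination_single, LinearMap.smul_apply, Mean.smul', eSq_tr X hZ f hT]

theorem SS_tr (hT : X.TInv Z) (a : ℝ) (w : ℝ →₀ ℝ) :
    SS X hZ f (X.tr a f) (Finsupp.mapDomain (fun x => x + a) w) - X.tr a (SS X hZ f f w) ∈ nul X.m := by
  simp only [SS]
  induction w using Finsupp.induction_linear with
  | zero => simp
  | add u v hu hv =>
    have := (nul X.m).add_mem hu hv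
    simp only [Finsupp.mapDomain_add, map_add]
    convert this using 1; ring
  | single s x =>
    have h := ce_tr X hZ hT a (X.tr s f * f)
    rw [map_mul, X.tr_tr, add_comm a s] at h
    have h2 := nul_smul ((nul X.m).mul_mem_left (X.tr (s + a) f) h) x
    simp only [Finsupp.mapDomain_single, Finsupp.linearCombination_single, map_smul, map_mul, X.tr_tr, add_comm a s]
    convert h2 using 1
    rw [mul_sub, smul_sub]

end dual
end Sz

/-! Part 7 -/

namespace Sz
open Topology

section vari
variable {V : Type} [AddCommGroup V] [Module ℝ V] (B : V →ₗ[ℝ] V →ₗ[ℝ] ℝ)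
theorem vari_near (hs : ∀ u v, B u v = B v u) {K : Set V} (hK : ∀ u ∈ K, ∀ v ∈ K, ∀ t : ℝ, 0 ≤ t → t ≤ 1 → (1 - t) • u + t • v ∈ K) {ν a b : ℝ}
    (hν : ∀ u ∈ K, ν ≤ B u u) {u v : V} (hu : u ∈ K) (hv : v ∈ K) (ha : B u u ≤ ν + a) (hb : B v v ≤ ν + b) :
    B (u - v) (u - v) ≤ 2 * (a + b) := by
  have := hν _ (hK u hu v hv (1/2) (by norm_num) (by norm_num))
  simp only [map_add, map_sub, map_smul, LinearMap.add_apply, LinearMap.sub_apply, LinearMap.smul_apply, smul_eq_mul, hs v u] at *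
  linarith
theorem vari_grad (hs : ∀ u v, B u v = B v u) {K : Set V} (hK : ∀ u ∈ K, ∀ v ∈ K, ∀ t : ℝ, 0 ≤ t → t ≤ 1 → (1 - t) • u + t • v ∈ K) {ν : ℝ}
    (hν : ∀ u ∈ K, ν ≤ B u u) {u v : V} (hu : u ∈ K) (hv : v ∈ K) (hv1 : B v v ≤ 1) (t : ℝ) (h0 : 0 ≤ t) (h1 : t ≤ 1) :
    ν ≤ (1 - t) ^ 2 * B u u + 2 * t * (1 - t) * B u v + t ^ 2 := by
  have := hν _ (hK u hu v hv t h0 h1)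
  simp only [map_add, map_sub, map_smul, LinearMap.add_apply, LinearMap.sub_apply, LinearMap.smul_apply, smul_eq_mul, hs v u] at *
  nlinarith [mul_le_mul_of_nonneg_left hv1 (sq_nonneg t)]
theorem vari_cs (hs : ∀ u v, B u v = B v u) (hp : ∀ u, 0 ≤ B u u) (u v : V) : (B u v) ^ 2 ≤ B u u * B v v := by
  have h := discrim_le_zero (a := B v v) (b := 2 * B u v) (c := B u u) (fun x => by
    have := hp (u + x • v)
    simp only [map_add, map_sub, map_smul, LinearMap.add_apply, LinearMap.sub_apply, LinearMap.smul_apply, smul_eq_mul, hs v u] at *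
    linarith)
  rw [discrim] at h
  linarith
end vari

section dual
variable (X : Sys) {Z : Subalgebra ℝ (Bd X.Ω)} (hZ : Clo X.m Z) (f : Bd X.Ω)

noncomputable def bb : (ℝ →₀ ℝ) →ₗ[ℝ] (ℝ →₀ ℝ) →ₗ[ℝ] ℝ := (kap X hZ f).compr₂ X.m.lin
theorem bb_apply (w w' : ℝ →₀ ℝ) : bb X hZ f w w' = X.m (kap X hZ f w w') := rfl
theorem bb_comm (w w' : ℝ →₀ ℝ) : bb X hZ f w w' = bb X hZ f w' w := by rw [bb_apply, kap_comm, bb_apply]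
theorem bb_nonneg (w : ℝ →₀ ℝ) : 0 ≤ bb X hZ f w w := by
  have := kap_nonneg X hZ f 1 Z.one_mem (fun ω => by simp) w
  rwa [one_mul] at this

theorem bb_lower (hT : X.TInv Z) (hf : ∀ ω, |f ω| ≤ 1) (c : Bd ℝ)
    (hc : ∀ h, c h = X.m (ce X.cpl hZ (f * X.tr h f) * ce X.cpl hZ (f * X.tr h f))) (hθ : 0 < EE c) {w : ℝ →₀ ℝ} (hw : w ∈ KK) :
    (EE c) ^ 2 ≤ bb X hZ f w w := by
  have h1 : ∀ h, bb X hZ f w (Finsupp.single h 1) = ∑ s : w.support, w s * c (h - s) := by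
    intro h
    rw [bb_apply, kap]
    simp only [Finsupp.linearCombination_apply, Finsupp.sum, LinearMap.sum_apply, LinearMap.smul_apply]
    rw [map_sum, ← Finset.sum_coe_sort w.support]
    refine Finset.sum_congr rfl fun s _ => ?_
    rw [Mean.smul']
    congr 1
    have e := eSq_tr X hZ f hT s 0 (h - s)
    rw [zero_add, sub_add_cancel] at e
    rw [hc, Finset.sum_eq_single h]
    · rw [Finsupp.single_eq_same, one_smul, e, eSq, X.tr_zero]
    · intro b hb hbh; rw [Finsupp.single_eq_of_ne hbh, zero_smul]
    · intro hh; simp at hh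
  have h2 : ∀ h, |bb X hZ f w (Finsupp.single h 1)| ≤ Real.sqrt (bb X hZ f w w) := by
    intro h
    refine Real.abs_le_sqrt ?_
    refine (vari_cs _ (bb_comm X hZ f) (bb_nonneg X hZ f) _ _).trans ?_
    refine mul_le_of_le_one_right (bb_nonneg X hZ f w) ?_
    rw [bb_apply]
    exact X.m.le_const fun ω => (abs_le.mp (kap_le X hZ f hf (KK_single h) (KK_single h) ω)).2
  set F : Bd ℝ := ∑ s : w.support, w s • Bd.comp (fun x => x + (-(s:ℝ))) c with hF
  have h3 : EE F = EE c := by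
    rw [hF, map_sum]
    simp only [Mean.smul', EE_add]
    rw [← Finset.sum_mul, KK_sum hw, one_mul]
  have h4 : EE F ≤ Real.sqrt (bb X hZ f w w) := by
    refine EE.le_const fun h => ?_
    have := h1 h
    have e : F h = bb X hZ f w (Finsupp.single h 1) := by
      rw [this, hF]; simp [sub_eq_add_neg]
    rw [e]; exact (abs_le.mp (h2 h)).2
  rw [h3] at h4
  calc (EE c) ^ 2 ≤ Real.sqrt (bb X hZ f w w) ^ 2 := by gcongr
    _ = _ := Real.sq_sqrt (bb_nonneg X hZ f w)

theorem bb_shift (hT : X.TInv Z) (a : ℝ) (w : ℝ →₀ ℝ) : bb X hZ f (Finsupp.mapDomain (fun x => x + a) w) (Finsupp.mapDomain (fun x => x + a) w) = bb X hZ f w w :=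
  kap_tr X hZ f hT a w w

theorem SS_d2 (w w' : ℝ →₀ ℝ) (v : Bd X.Ω) (hv : ∀ ω, |v ω| ≤ 1) :
    X.m.d2 (SS X hZ f v w) (SS X hZ f v w') ≤ bb X hZ f (w - w') (w - w') := by
  have := SS_sq X hZ f 1 Z.one_mem (fun ω => by simp) (w - w') v hv
  rw [one_mul, one_mul, map_sub] at this
  exact this

theorem d2_nul {Ω : Type} {m : Mean Ω} {a b c : Bd Ω} (h : a - b ∈ nul m) : m.d2 a c = m.d2 b c := by
  unfold Mean.d2
  refine sq_of_nul ?_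
  rwa [sub_sub_sub_cancel_right]

theorem d2_zero_nul {Ω : Type} {m : Mean Ω} {a b : Bd Ω} (h : m.d2 a b = 0) : a - b ∈ nul m := nul_of_sq h

end dual
end Sz

/-! Part 8 -/

namespace Sz
open Topology

theorem Mean.mul_bound {Ω : Type} (m : Mean Ω) (x h : Bd Ω) {C : ℝ} (hC : ∀ ω, |h ω| ≤ C) : |m (x * h)| ≤ C * m x.abs := by
  refine (m.abs_le_abs _).trans ?_
  rw [← m.smul']
  refine m.mono fun ω => ?_
  show |(x * h) ω| ≤ C * |x ω|
  rw [Bd.mul_apply, abs_mul, mul_comm]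
  exact mul_le_mul_of_nonneg_right (hC ω) (abs_nonneg _)

theorem Mean.d2_bound {Ω : Type} (m : Mean Ω) (x y h : Bd Ω) {C : ℝ} (hC0 : 0 ≤ C) (hC : ∀ ω, |h ω| ≤ C) :
    |m (x * h) - m (y * h)| ≤ C * Real.sqrt (m.d2 x y) := by
  rw [← map_sub, ← sub_mul]
  exact (m.mul_bound _ h hC).trans (mul_le_mul_of_nonneg_left (m.abs_sub_le x y) hC0)

theorem tendsto_mul_d2 {Ω : Type} (m : Mean Ω) {F : ℕ → Bd Ω} {G : Bd Ω} (h : Tendsto (fun n => m.d2 (F n) G) atTop (𝓝 0)) (g : Bd Ω) :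
    Tendsto (fun n => m (F n * g)) atTop (𝓝 (m (G * g))) := by
  obtain ⟨C, hC0, hC⟩ := g.bound
  rw [tendsto_iff_dist_tendsto_zero]
  have h2 : Tendsto (fun n => C * Real.sqrt (m.d2 (F n) G)) atTop (𝓝 0) := by
    have := (h.sqrt).const_mul C; simpa using this
  exact squeeze_zero (fun _ => dist_nonneg) (fun n => m.d2_bound _ _ g hC0.le hC) h2

theorem tendsto_sq_d2 {Ω : Type} (m : Mean Ω) {F : ℕ → Bd Ω} {G : Bd Ω} (h : Tendsto (fun n => m.d2 (F n) G) atTop (𝓝 0)) {C : ℝ}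
    (hF : ∀ n ω, |F n ω| ≤ C) (χ H : Bd Ω) :
    Tendsto (fun n => m (χ * ((F n - H) * (F n - H)))) atTop (𝓝 (m (χ * ((G - H) * (G - H))))) := by
  obtain ⟨A1, hA0, hA⟩ := χ.bound
  obtain ⟨A2, hA20, hA2⟩ := (G - (2:ℝ) • H).bound
  rw [tendsto_iff_dist_tendsto_zero]
  have h2 : Tendsto (fun n => (A1 * (|C| + A2)) * Real.sqrt (m.d2 (F n) G)) atTop (𝓝 0) := by
    have := (h.sqrt).const_mul (A1 * (|C| + A2)); simpa using this
  refine squeeze_zero (fun _ => dist_nonneg) (fun n => ?_) h2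
  have := m.d2_bound (F n) G (χ * (F n + (G - (2:ℝ) • H))) (C := A1 * (|C| + A2)) (by positivity) (fun ω => by
    rw [Bd.mul_apply, Bd.add_apply, abs_mul]
    refine mul_le_mul (hA ω) ((abs_add_le _ _).trans (add_le_add ((hF n ω).trans (le_abs_self C)) (hA2 ω))) (abs_nonneg _) hA0.le)
  rw [Real.dist_eq]
  convert this using 2
  rw [← map_sub, ← map_sub]
  congr 1
  have e : (2:ℝ) • H = H + H := two_smul ℝ H
  rw [e]; ring

section dual
variable (X : Sys) {Z : Subalgebra ℝ (Bd X.Ω)} (hZ : Clo X.m Z) (f : Bd X.Ω)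

theorem kap_diff_le (hf : ∀ ω, |f ω| ≤ 1) {w w' : ℝ →₀ ℝ} (hw : w ∈ KK) (hw' : w' ∈ KK) (ω : X.Ω) :
    |kap X hZ f (w - w') (w - w') ω| ≤ 4 := by
  simp only [map_sub, LinearMap.sub_apply, Bd.sub_apply]
  have h1 := abs_le.mp (kap_le X hZ f hf hw hw ω)
  have h2 := abs_le.mp (kap_le X hZ f hf hw hw' ω)
  have h3 := abs_le.mp (kap_le X hZ f hf hw' hw ω)
  have h4 := abs_le.mp (kap_le X hZ f hf hw' hw' ω)
  rw [abs_le]; constructor <;> linarith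

/-- relative weak limits of the kernels -/
theorem exists_kappa (hZ : Clo X.m Z) (κ : ℕ → Bd X.Ω) (hκ0 : ∀ k, ∀ χ ∈ Z, (∀ ω, 0 ≤ χ ω) → 0 ≤ X.m (χ * κ k)) (hκb : ∀ k ω, |κ k ω| ≤ 4)
    {ε : ℝ} (hε : ∀ᶠ k in atTop, X.m (κ k) ≤ ε) :
    ∃ κ' ∈ Z, (∀ ω, 0 ≤ κ' ω) ∧ X.m κ' ≤ ε ∧ ∀ χ ∈ Z, (∀ ω, 0 ≤ χ ω) → ∀ a : ℕ → ℝ, ∀ b, Tendsto a atTop (𝓝 b) →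
      (∀ k, a k ≤ X.m (χ * κ k)) → b ≤ X.m (χ * κ') := by
  have hU : ((hyperfilter ℕ : Ultrafilter ℕ) : Filter ℕ) ≤ atTop := Nat.hyperfilter_le_atTop
  set U := hyperfilter ℕ
  let κh : Bd (ℕ × X.Ω) := Bd.mk' (fun p => κ p.1 p.2) 4 (fun p => hκb _ _)
  let ψ : Bd X.Ω →ₗ[ℝ] ℝ := (ultraMean U).lin ∘ₗ X.m.part ∘ₗ LinearMap.mulRight ℝ κh ∘ₗ (Bd.comp (Prod.snd : ℕ × X.Ω → X.Ω)).toLinearMap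
  have hψ : ∀ g, Tendsto (fun k => X.m (g * κ k)) (U : Filter ℕ) (𝓝 (ψ g)) := fun g =>
    ultraMean_tendsto U (X.m.part (Bd.comp (Prod.snd : ℕ × X.Ω → X.Ω) g * κh))
  obtain ⟨G, hG, hGb, hGψ⟩ := lemR X.cpl hZ ψ (C := 4) (by norm_num) (fun g _ => le_of_tendsto (hψ g).abs
    (Eventually.of_forall fun k => X.m.mul_bound g (κ k) (hκb k)))
  have hpos : ∀ χ ∈ Z, (∀ ω, 0 ≤ χ ω) → 0 ≤ X.m (χ * G) := fun χ hχ h0 => by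
    rw [mul_comm, hGψ χ hχ]; exact ge_of_tendsto' (hψ χ) fun k => hκ0 k χ hχ h0
  have c1 : Continuous (fun x : ℝ => max x 0) := by fun_prop
  have c2 : Continuous (fun x : ℝ => max (-x) 0) := by fun_prop
  set P := Bd.post _ c1 G with hP
  set N := Bd.post _ c2 G with hN
  have hPZ : P ∈ Z := hZ.post hG c1
  have hNZ : N ∈ Z := hZ.post hG c2
  have hN0 : X.m (N * N) = 0 := by
    have h1 := hpos N hNZ (fun ω => le_max_right _ _)
    have e : N * G = -(N * N) := by
      ext ω; simp only [Bd.mul_apply, Bd.neg_apply, hN, Bd.post_apply]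
      rcases le_total (G ω) 0 with h | h
      · rw [max_eq_left (by linarith)]; ring
      · rw [max_eq_right (by linarith)]; ring
    rw [e, map_neg] at h1
    exact le_antisymm (by linarith) (X.m.sq_nonneg' N)
  have hN1 : X.m N = 0 := nul_zero (nul_of_sq hN0)
  have hPN : P = G + N := by
    ext ω; simp only [Bd.add_apply, hP, hN, Bd.post_apply]
    rcases le_total (G ω) 0 with h | h
    · rw [max_eq_right h, max_eq_left (by linarith)]; ring
    · rw [max_eq_left h, max_eq_right (by linarith)]; ring
  refine ⟨P, hPZ, fun ω => le_max_right _ _, ?_, fun χ hχ h0 a b hab hak => ?_⟩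
  · rw [hPN, map_add, hN1, add_zero, ← mul_one G, hGψ 1 Z.one_mem]
    refine le_of_tendsto (hψ 1) (hU ?_)
    filter_upwards [hε] with k hk
    rwa [one_mul]
  · rw [hPN, mul_add, map_add]
    have h1 : X.m (χ * N) = 0 := by rw [mul_comm]; exact X.m.eq_zero_of_sq hN0 χ
    rw [h1, add_zero, mul_comm, hGψ χ hχ]
    exact le_of_tendsto_of_tendsto' (hab.mono_left hU) (hψ χ) hak

theorem dual (hT : X.TInv Z) (hf : ∀ ω, |f ω| ≤ 1) (c : Bd ℝ)
    (hc : ∀ h, c h = X.m (ce X.cpl hZ (f * X.tr h f) * ce X.cpl hZ (f * X.tr h f))) (hθ : 0 < EE c) :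
    ∃ D ∈ AP X Z, X.m (f * D) ≠ 0 := by
  set B := bb X hZ f with hB
  have hK : ∀ u ∈ KK, ∀ v ∈ KK, ∀ t : ℝ, 0 ≤ t → t ≤ 1 → (1 - t) • u + t • v ∈ KK := fun u hu v hv t h0 h1 => KK_conv hu hv h0 h1
  set ν := sInf ((fun w => B w w) '' KK) with hνd
  have hbdd : BddBelow ((fun w => B w w) '' KK) := ⟨0, by rintro _ ⟨w, _, rfl⟩; exact bb_nonneg X hZ f w⟩
  have hne : ((fun w => B w w) '' KK).Nonempty := ⟨_, ⟨_, KK_single 0, rfl⟩⟩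
  have hν : ∀ u ∈ KK, ν ≤ B u u := fun u hu => csInf_le hbdd ⟨u, hu, rfl⟩
  have hν0 : 0 < ν := lt_of_lt_of_le (by positivity : 0 < (EE c) ^ 2)
    (le_csInf hne (by rintro _ ⟨w, hw, rfl⟩; exact bb_lower X hZ f hT hf c hc hθ hw))
  have hν1 : ν ≤ 1 := (hν _ (KK_single 0)).trans
    (X.m.le_const fun ω => (abs_le.mp (kap_le X hZ f hf (KK_single 0) (KK_single 0) ω)).2)
  have hex : ∀ n : ℕ, ∃ w ∈ KK, B w w ≤ ν + 1 / ((n : ℝ) + 1) := by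
    intro n
    obtain ⟨_, ⟨w, hw, rfl⟩, h⟩ := exists_lt_of_csInf_lt hne (lt_add_of_pos_right ν (show 0 < 1 / ((n : ℝ) + 1) by positivity))
    exact ⟨w, hw, h.le⟩
  choose w hw hwν using hex
  have hnear : ∀ n k, B (w n - w k) (w n - w k) ≤ 2 * (1 / ((n : ℝ) + 1) + 1 / ((k : ℝ) + 1)) := fun n k =>
    vari_near B (bb_comm X hZ f) hK hν (hw n) (hw k) (hwν n) (hwν k)
  have hlim : Tendsto (fun n : ℕ => 1 / ((n : ℝ) + 1)) atTop (𝓝 0) := tendsto_one_div_add_atTop_nhds_zero_nat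
  have hSle : ∀ n ω, |SS X hZ f f (w n) ω| ≤ 1 := fun n ω => SS_le X hZ f hf (hw n) f hf ω
  obtain ⟨D, hDb, hD⟩ := X.cpl (fun n => SS X hZ f f (w n)) 1 hSle (by
    intro ε hε
    obtain ⟨N, hN⟩ := eventually_atTop.mp (hlim.eventually_lt_const (show 0 < ε / 4 by positivity))
    refine ⟨N, fun n hn k hk => (SS_d2 X hZ f _ _ f hf).trans ((hnear n k).trans ?_)⟩
    have := hN n hn; have := hN k hk; linarith)
  refine ⟨D, ?_, ?_⟩
  · intro ε hε
    obtain ⟨n, hn⟩ := (hlim.eventually_lt_const (show 0 < ε / 4 by positivity)).exists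
    obtain ⟨κ, hκZ, hκ0, hκm, hκ⟩ := exists_kappa X hZ (fun k => kap X hZ f (w k - w n) (w k - w n))
      (fun k χ hχ h0 => kap_nonneg X hZ f χ hχ h0 _) (fun k ω => kap_diff_le X hZ f hf (hw k) (hw n) ω) (ε := ε) (by
        filter_upwards [hlim.eventually_lt_const (show 0 < ε / 4 by positivity)] with k hk
        have := hnear k n
        rw [hB, bb_apply] at this
        linarith)
    refine ⟨(w n).support, inferInstance, fun σ => w n σ • X.tr σ f, κ, hκZ, hκ0, hκm, fun s => ?_⟩
    have hfs : ∀ ω, |X.tr s f ω| ≤ 1 := fun ω => hf _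
    refine ⟨fun σ => ce X.cpl hZ (X.tr σ f * X.tr s f), fun σ => ⟨ce_mem _ _ _, ce_abs_le _ _ _ (prod_le X f hf _ _)⟩, fun χ hχ h0 => ?_⟩
    have e1 : ∑ σ : (w n).support, ce X.cpl hZ (X.tr σ f * X.tr s f) * (w n σ • X.tr σ f) = SS X hZ f (X.tr s f) (w n) := by
      rw [SS_eq]
      refine Finset.sum_congr rfl fun σ _ => ?_
      rw [mul_smul_comm, mul_comm]
    rw [e1]
    have hconv : Tendsto (fun k => X.m.d2 (SS X hZ f (X.tr s f) (w k)) (X.tr s D)) atTop (𝓝 0) := by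
      have hb : Tendsto (fun k : ℕ => 2 * (2 * (1 / ((k : ℝ) + 1) + 1 / ((k : ℝ) + 1))) + 2 * X.m.d2 (SS X hZ f f (w k)) D) atTop (𝓝 0) := by
        have := (((hlim.add hlim).const_mul 2).const_mul 2).add (hD.const_mul 2)
        simpa using this
      refine squeeze_zero (fun k => X.m.d2_nonneg _ _) (fun k => ?_) hb
      refine (X.m.d2_tri _ (X.tr s (SS X hZ f f (w k))) _).trans ?_
      rw [X.d2_tr]
      gcongr
      rw [X.m.d2_comm, ← d2_nul (SS_tr X hZ f hT s (w k)), X.m.d2_comm]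
      refine (SS_d2 X hZ f _ _ _ hfs).trans ?_
      exact vari_near B (bb_comm X hZ f) hK hν (hw k) (KK_shift (hw k) s) (hwν k) ((bb_shift X hZ f hT s (w k)).trans_le (hwν k))
    refine hκ χ hχ h0 _ _ (tendsto_sq_d2 X.m hconv (fun k ω => SS_le X hZ f hf (hw k) _ hfs ω) χ (SS X hZ f (X.tr s f) (w n))) fun k => ?_
    rw [← map_sub]
    exact SS_sq X hZ f χ hχ h0 _ _ hfs
  · have hb : ∀ n, X.m (SS X hZ f f (w n) * f) = B (w n) (Finsupp.single 0 1) := by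
      intro n
      rw [SS_eq, hB, bb_apply, kap_comm, kap]
      simp only [Finsupp.linearCombination_single, one_smul]
      simp only [Finsupp.linearCombination_apply, Finsupp.sum]
      rw [Finset.sum_mul, map_sum, map_sum, ← Finset.sum_coe_sort (w n).support]
      refine Finset.sum_congr rfl fun s _ => ?_
      rw [smul_mul_assoc, Mean.smul', Mean.smul', eSq, X.tr_zero]
      congr 1
      rw [mul_comm f, ce_mul X.cpl hZ _ (ce_mem X.cpl hZ _)]
      congr 1; ring
    have hlimb : Tendsto (fun n => B (w n) (Finsupp.single 0 1)) atTop (𝓝 (X.m (D * f))) := by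
      have := tendsto_mul_d2 X.m hD f
      simpa only [hb] using this
    have hq : Tendsto (fun n => B (w n) (w n)) atTop (𝓝 ν) := by
      refine tendsto_of_tendsto_of_tendsto_of_le_of_le tendsto_const_nhds (h := fun n : ℕ => ν + 1 / ((n : ℝ) + 1)) ?_ (fun n => hν _ (hw n)) hwν
      simpa using hlim.const_add ν
    have hv1 : B (Finsupp.single 0 1) (Finsupp.single 0 1) ≤ 1 :=
      (X.m.le_const fun ω => (abs_le.mp (kap_le X hZ f hf (KK_single 0) (KK_single 0) ω)).2)
    have h1 : ν ≤ (1 - ν / 2) ^ 2 * ν + 2 * (ν / 2) * (1 - ν / 2) * X.m (D * f) + (ν / 2) ^ 2 :=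
      ge_of_tendsto' (((hq.const_mul _).add (hlimb.const_mul _)).add tendsto_const_nhds)
        fun n => vari_grad B (bb_comm X hZ f) hK hν (hw n) (KK_single 0) hv1 (ν / 2) (by linarith) (by linarith)
    intro h0
    rw [mul_comm D f, h0] at h1
    nlinarith [mul_pos hν0 hν0]
end dual
end Sz

/-! Part 9 -/

namespace Sz
open Topology

theorem ce_smul {Ω : Type} {m : Mean Ω} (hm : L2C m) {Z : Subalgebra ℝ (Bd Ω)} (hZ : Clo m Z) (c : ℝ) (f : Bd Ω) :
    ce hm hZ (c • f) - c • ce hm hZ f ∈ nul m :=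
  ce_unique hm hZ (Z.smul_mem (ce_mem hm hZ f) c) fun h hh => by
    rw [smul_mul_assoc, smul_mul_assoc, m.smul', m.smul', ce_mul hm hZ f hh]

section
variable (X : Sys)

theorem prod_act {P : Type} (n : Mean P) (x : P → ℝ) (F : Bd (P × X.Ω)) :
    n.prod X.m (Bd.comp (fun p => (p.1, X.T (x p.1) p.2)) F) = n.prod X.m F := by
  rw [Mean.prod_apply, Mean.prod_apply]
  congr 1; ext p
  exact X.m_tr (x p) (Bd.comp (fun ω => (p, ω)) F)

theorem act_act {P : Type} (x y : P → ℝ) (f : Bd X.Ω) :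
    Bd.comp (fun p : P × X.Ω => (p.1, X.T (x p.1) p.2)) (X.act y f) = X.act (fun p => y p + x p) f := by
  ext p; simp [X.T_add]

theorem act_congr {P : Type} {x y : P → ℝ} (h : ∀ p, x p = y p) (f : Bd X.Ω) : X.act x f = X.act y f := by
  rw [show x = y from funext h]

theorem prod_EE_shift {Ω : Type} (m : Mean Ω) (h : ℝ) (F : Bd (ℝ × Ω)) :
    EE.prod m (Bd.comp (fun p => (p.1 + h, p.2)) F) = EE.prod m F :=
  EE_add h (m.part F)

noncomputable def gam {Z : Subalgebra ℝ (Bd X.Ω)} (hZ : Clo X.m Z) (f : Bd X.Ω) : Bd ℝ :=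
  Bd.mk' (fun h => X.m (eSq X hZ f 0 h)) ((f.bound.choose * f.bound.choose) * (f.bound.choose * f.bound.choose)) (fun h => by
    obtain ⟨h1, h2⟩ := f.bound.choose_spec
    set C := f.bound.choose
    refine X.m.abs_le fun ω => ?_
    have h3 : ∀ ω, |ce X.cpl hZ (X.tr 0 f * X.tr h f) ω| ≤ C * C := ce_abs_le X.cpl hZ _ (fun ω => by
      rw [Bd.mul_apply, abs_mul]; exact mul_le_mul (h2 _) (h2 _) (abs_nonneg _) h1.le)
    rw [eSq, Bd.mul_apply, abs_mul]
    exact mul_le_mul (h3 _) (h3 _) (abs_nonneg _) (by positivity))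

theorem gam_apply {Z : Subalgebra ℝ (Bd X.Ω)} (hZ : Clo X.m Z) (f : Bd X.Ω) (h : ℝ) :
    gam X hZ f h = X.m (ce X.cpl hZ (f * X.tr h f) * ce X.cpl hZ (f * X.tr h f)) := by
  show X.m (eSq X hZ f 0 h) = _
  rw [eSq, X.tr_zero]

theorem gam_neg {Z : Subalgebra ℝ (Bd X.Ω)} (hZ : Clo X.m Z) (hT : X.TInv Z) (f : Bd X.Ω) (h : ℝ) : gam X hZ f (-h) = gam X hZ f h := by
  show X.m (eSq X hZ f 0 (-h)) = X.m (eSq X hZ f 0 h)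
  rw [← eSq_tr X hZ f hT h 0 (-h), zero_add, neg_add_cancel, eSq, eSq, mul_comm (X.tr h f)]

theorem gam_zero (n : ℕ) (f : Bd X.Ω) (hf : ∀ z ∈ ZZ X (n + 1), X.m (f * z) = 0) : EE (gam X (clo_ZZ X n) f) = 0 := by
  obtain ⟨C, hC0, hC⟩ := f.bound
  have h0 : EE (gam X (clo_ZZ X n) (C⁻¹ • f)) = 0 := by
    by_contra hne
    have hpos : 0 ≤ EE (gam X (clo_ZZ X n) (C⁻¹ • f)) := EE.nonneg fun h => by
      rw [gam_apply]; exact X.m.sq_nonneg' _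
    obtain ⟨D, hD, h⟩ := dual X (clo_ZZ X n) (C⁻¹ • f) (tinv_ZZ X n) (fun ω => by
      rw [Bd.smul_apply, abs_mul, abs_of_pos (inv_pos.mpr hC0), inv_mul_le_iff₀ hC0, mul_one]; exact hC ω)
      _ (gam_apply X _ _) (lt_of_le_of_ne hpos (Ne.symm hne))
    apply h
    rw [smul_mul_assoc, X.m.smul', hf D (le_cl _ _ hD), mul_zero]
  have h1 : gam X (clo_ZZ X n) (C⁻¹ • f) = (C⁻¹ * C⁻¹ * (C⁻¹ * C⁻¹)) • gam X (clo_ZZ X n) f := by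
    ext h
    rw [Bd.smul_apply, gam_apply, gam_apply, map_smul, smul_mul_smul_comm]
    rw [sq_of_nul (ce_smul X.cpl (clo_ZZ X n) _ _), smul_mul_smul_comm, X.m.smul']
  rw [h1, EE.smul'] at h0
  exact (mul_eq_zero.mp h0).resolve_left (by positivity)

theorem gam_dil {Z : Subalgebra ℝ (Bd X.Ω)} (hZ : Clo X.m Z) (hT : X.TInv Z) (f : Bd X.Ω) (b : ℤ) (hb : b ≠ 0) :
    EE (Bd.comp (fun h : ℝ => (b : ℝ) * h) (gam X hZ f)) = EE (gam X hZ f) := by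
  rw [← EE_mul b.natAbs (Int.natAbs_pos.mpr hb) (gam X hZ f)]
  congr 1
  ext h
  simp only [Bd.comp_apply]
  rw [Nat.cast_natAbs]
  rcases le_total 0 b with h0 | h0
  · rw [abs_of_nonneg h0]
  · rw [abs_of_nonpos h0]; push_cast; rw [neg_mul, gam_neg X hZ hT]

theorem prod_bound {Ω ι : Type} (A : Finset ι) (F : ι → Bd Ω) : ∃ C, 0 < C ∧ ∀ G : ι → Bd Ω, (∀ a ∈ A, ∃ φ : Ω → Ω, ∃ ψ : Ω → Ω, ∀ ω, G a ω = F a (φ ω) * F a (ψ ω)) →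
    ∀ ω, |(∏ a ∈ A, G a) ω| ≤ C := by
  choose C hC0 hC using fun a => (F a).bound
  refine ⟨∏ a ∈ A, (C a * C a), Finset.prod_pos fun a _ => mul_pos (hC0 a) (hC0 a), fun G hG ω => ?_⟩
  rw [Bd.prod_apply, Finset.abs_prod]
  refine Finset.prod_le_prod (fun _ _ => abs_nonneg _) fun a ha => ?_
  obtain ⟨φ, ψ, h⟩ := hG a ha
  rw [h, abs_mul]
  exact mul_le_mul (hC a _) (hC a _) (abs_nonneg _) (hC0 a).le

open Classical in
theorem nullN {ι : Type} : ∀ (n : ℕ) (A : Finset ι) (k : ι → ℤ) (_ : Set.InjOn k A) (_ : A.card = n + 1) (j : ι) (_ : j ∈ A) (f : ι → Bd X.Ω)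
    (_ : ∀ z ∈ ZZ X n, X.m (f j * z) = 0), EE.prod X.m (∏ a ∈ A, X.act (fun r : ℝ => (k a : ℝ) * r) (f a)) = 0 := by
  intro n
  induction n with
  | zero =>
    intro A k hk hA j hj f hf
    obtain ⟨j', rfl⟩ := Finset.card_eq_one.mp hA
    obtain rfl := Finset.mem_singleton.mp hj
    rw [Finset.prod_singleton, Mean.prod_apply]
    have : X.m.part (X.act (fun r : ℝ => (k j : ℝ) * r) (f j)) = 0 := by
      ext r
      rw [Mean.part_apply, X.comp_act, X.m_tr]
      have := hf 1 (ZZ X 0).one_mem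
      rw [mul_one] at this; rw [this]; rfl
    rw [this, map_zero]
  | succ n ih =>
    intro A k hk hA j hj f hf
    obtain ⟨i, hi, hij⟩ : ∃ i ∈ A, i ≠ j := Finset.exists_mem_ne (by omega) j
    set M := EE.prod X.m with hM
    set A' := A.erase i with hA'
    have hjA' : j ∈ A' := Finset.mem_erase.mpr ⟨hij.symm, hj⟩
    have hcard : A'.card = n + 1 := by rw [hA', Finset.card_erase_of_mem hi, hA]; rfl
    set k' : ι → ℤ := fun a => k a - k i with hk'
    have hinj : Set.InjOn k' A' := fun a ha b hb hab => hk (Finset.mem_of_mem_erase ha) (Finset.mem_of_mem_erase hb) (by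
      simp only [hk'] at hab; omega)
    set Q := M (∏ a ∈ A, X.act (fun r : ℝ => (k a : ℝ) * r) (f a)) with hQ
    set V : ℝ → Bd (ℝ × X.Ω) := fun h => ∏ a ∈ A', X.act (fun r : ℝ => (k' a : ℝ) * (r + h)) (f a) with hV
    set p : Bd (ℝ × X.Ω) := X.act (fun _ => 0) (f i) with hp
    have hpV : ∀ h, M (p * V h) = Q := by
      intro h
      have h1 : p * V h = Bd.comp (fun q : ℝ × X.Ω => (q.1 + h, q.2)) (p * V 0) := by
        rw [map_mul, hV]; simp only [map_prod, add_zero]; rfl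
      rw [h1, hM, prod_EE_shift, hQ, ← prod_act X EE (fun r => -(k i : ℝ) * r) (∏ a ∈ A, _), map_prod,
        ← Finset.mul_prod_erase A _ hi]
      congr 2
      · rw [act_act]; refine act_congr X (fun r => by ring) _
      · rw [hV]
        refine Finset.prod_congr rfl fun a _ => ?_
        rw [act_act]; refine act_congr X (fun r => by simp only [hk']; push_cast; ring) _
    set g : ℝ → ι → Bd X.Ω := fun h a => f a * X.tr ((k' a : ℝ) * h) (f a) with hg
    set W : ℝ → Bd (ℝ × X.Ω) := fun h => ∏ a ∈ A', X.act (fun r : ℝ => (k' a : ℝ) * r) (g h a) with hW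
    have hVV : ∀ h h', M (V h * V h') = M (W (h' - h)) := by
      intro h h'
      rw [hM, ← prod_EE_shift X.m (-h)]
      congr 1
      rw [hV, hW]
      simp only [← Finset.prod_mul_distrib, map_prod]
      refine Finset.prod_congr rfl fun a _ => ?_
      ext ⟨r, ω⟩
      simp only [hg, Bd.comp_apply, Bd.mul_apply, Sys.act_apply, Sys.tr_apply, ← X.T_add]
      congr 3 <;> ring_nf
    obtain ⟨CV, hCV0, hCV⟩ := (V 0).bound
    have hMW : ∀ h, |M (W h)| ≤ CV * CV := by
      intro h
      have := hVV 0 h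
      rw [sub_zero] at this; rw [← this]
      refine M.abs_le fun q => ?_
      rw [Bd.mul_apply, abs_mul]
      have h1 : V h q = V 0 (q.1 + h, q.2) := by simp only [hV, Bd.prod_apply, Sys.act_apply, add_zero]
      rw [h1]
      exact mul_le_mul (hCV _) (hCV _) (abs_nonneg _) hCV0.le
    let c : Bd ℝ := Bd.mk' (fun h => M (W h)) _ hMW
    have hl1 := hl EE EE_add (fun h => gns M (V h)) c (fun s s' => by rw [gns_inner]; exact hVV s s') (gns M p) Q
      (fun s => by rw [gns_inner]; exact hpV s)
    -- bound of c
    obtain ⟨C, hC0, hC⟩ := prod_bound (A'.erase j) f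
    have hcb : ∀ h, c h * c h ≤ C ^ 2 * gam X (clo_ZZ X n) (f j) ((k' j : ℝ) * h) := by
      intro h
      set e := ce X.cpl (clo_ZZ X n) (g h j) with he
      have h1 : M (∏ a ∈ A', X.act (fun r : ℝ => (k' a : ℝ) * r) (Function.update (g h) j (g h j - e) a)) = 0 := by
        refine ih A' k' hinj hcard j hjA' _ fun z hz => ?_
        rw [Function.update_self, sub_mul, map_sub, he, ce_mul X.cpl (clo_ZZ X n) _ hz, sub_self]
      set R := ∏ a ∈ A'.erase j, X.act (fun r : ℝ => (k' a : ℝ) * r) (g h a) with hR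
      have h2 : W h = X.act (fun r : ℝ => (k' j : ℝ) * r) (g h j) * R := (Finset.mul_prod_erase A' _ hjA').symm
      have h3 : ∏ a ∈ A', X.act (fun r : ℝ => (k' a : ℝ) * r) (Function.update (g h) j (g h j - e) a) =
          X.act (fun r : ℝ => (k' j : ℝ) * r) (g h j - e) * R := by
        rw [← Finset.mul_prod_erase A' _ hjA', Function.update_self]
        congr 1
        refine Finset.prod_congr rfl fun a ha => ?_
        rw [Function.update_of_ne (Finset.ne_of_mem_erase ha)]
      have h4 : c h = M (X.act (fun r : ℝ => (k' j : ℝ) * r) e * R) := by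
        rw [h3, map_sub, sub_mul, map_sub, ← h2] at h1
        exact sub_eq_zero.mp h1
      have hRb : ∀ q, |R q| ≤ C := fun q => by
        have := hC (fun a => X.tr ((k' a : ℝ) * q.1) (g h a)) (fun a _ => ⟨_, _, fun ω => rfl⟩) q.2
        rw [hR, Bd.prod_apply]; rw [Bd.prod_apply] at this; exact this
      have h5 := M.cs (X.act (fun r : ℝ => (k' j : ℝ) * r) e) R
      rw [← h4] at h5
      have h6 : M (R * R) ≤ C ^ 2 := M.le_const fun q => by
        rw [Bd.mul_apply, ← sq]; exact sq_le_sq' (abs_le.mp (hRb q)).1 (abs_le.mp (hRb q)).2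
      have h7 : M (X.act (fun r : ℝ => (k' j : ℝ) * r) e * X.act (fun r : ℝ => (k' j : ℝ) * r) e) = gam X (clo_ZZ X n) (f j) ((k' j : ℝ) * h) := by
        rw [gam_apply, ← map_mul, hM, Mean.prod_apply]
        have : X.m.part (X.act (fun r : ℝ => (k' j : ℝ) * r) (e * e)) = algebraMap ℝ _ (X.m (e * e)) := by
          ext r; rw [Mean.part_apply, X.comp_act, X.m_tr]; rfl
        rw [this, Mean.const]
      rw [h7, sq, mul_comm (gam X _ _ _)] at h5
      refine h5.trans ?_
      rw [← h7] at *
      calc _ ≤ _ := le_of_eq (mul_comm _ _)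
        _ ≤ _ := mul_le_mul_of_nonneg_left h6 (M.sq_nonneg' _)
        _ = _ := mul_comm _ _
    have hk0 : k' j ≠ 0 := fun h => hij (hk hi hj (by simp only [hk'] at h; omega))
    have h8 : EE (c * c) ≤ 0 := by
      have := EE.mono (f := c * c) (g := C ^ 2 • Bd.comp (fun h : ℝ => ((k' j : ℤ) : ℝ) * h) (gam X (clo_ZZ X n) (f j))) hcb
      rw [EE.smul', gam_dil X _ (tinv_ZZ X n) _ _ hk0, gam_zero X n (f j) hf, mul_zero] at this
      exact this
    have h9 : EE c = 0 := by
      have := EE.sq_le c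
      exact pow_eq_zero_iff two_ne_zero |>.mp (le_antisymm (this.trans h8) (sq_nonneg _))
    rw [h9, mul_zero] at hl1
    exact pow_eq_zero_iff two_ne_zero |>.mp (le_antisymm hl1 (sq_nonneg _))
end
end Sz

/-! Part 10 -/

namespace Sz
open Topology

theorem bern (q : ℕ) {h x : ℝ} (hh : 0 ≤ h) (hx : 0 ≤ x) : x ^ (q + 1) + (q + 1) * x ^ q * (h - x) ≤ h ^ (q + 1) := by
  induction q with
  | zero => simp
  | succ q ih =>
    have h1 := mul_le_mul_of_nonneg_left ih hh
    have h2 : 0 ≤ ((q : ℝ) + 1) * x ^ q * ((h - x) * (h - x)) := by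
      have := mul_self_nonneg (h - x); positivity
    push_cast
    have e1 : h * h ^ (q + 1) = h ^ (q + 1 + 1) := by ring
    have e2 : h * (x ^ (q + 1) + (↑q + 1) * x ^ q * (h - x)) - ((q : ℝ) + 1) * x ^ q * ((h - x) * (h - x)) =
      x ^ (q + 1 + 1) + (↑q + 1 + 1) * x ^ (q + 1) * (h - x) := by ring
    linarith

theorem prod_pow_le (n : ℕ) (x : ℕ → ℝ) (h0 : ∀ j, 0 ≤ x j) (h1 : ∀ j, x j ≤ 1) :
    x 0 ^ n - ∑ j ∈ Finset.range n, |x j - x 0| ≤ ∏ j ∈ Finset.range n, x j := by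
  induction n with
  | zero => simp
  | succ n ih =>
    rw [Finset.sum_range_succ, Finset.prod_range_succ, pow_succ]
    have hp : ∏ j ∈ Finset.range n, x j ≤ 1 := Finset.prod_le_one (fun j _ => h0 j) (fun j _ => h1 j)
    have hp0 : 0 ≤ ∏ j ∈ Finset.range n, x j := Finset.prod_nonneg (fun j _ => h0 j)
    set P := ∏ j ∈ Finset.range n, x j
    set S := ∑ j ∈ Finset.range n, |x j - x 0|
    have hS : 0 ≤ S := Finset.sum_nonneg fun _ _ => abs_nonneg _
    have a1 : P * x 0 - |x n - x 0| ≤ P * x n := by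
      have := neg_abs_le (x n - x 0)
      nlinarith [abs_nonneg (x n - x 0)]
    have a2 := mul_le_mul_of_nonneg_right ih (h0 0)
    nlinarith [h0 0, h1 0]

theorem vdW (ℓ : ℕ) (K : Type) [Finite K] : ∃ W : ℕ, ∀ Γ : ℕ → K, ∃ a b, 0 < b ∧ b ≤ W ∧ a + ℓ * b ≤ W ∧ ∀ j ≤ ℓ, Γ (a + j * b) = Γ a := by
  classical
  obtain ⟨ι, _, hι⟩ := Combinatorics.Line.exists_mono_in_high_dimension (Fin (ℓ + 1)) K
  refine ⟨(ℓ + 1) * Fintype.card ι, fun Γ => ?_⟩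
  specialize hι (fun v => Γ (∑ i, (v i : ℕ)))
  obtain ⟨l, c, hl⟩ := hι
  set s : Finset ι := Finset.univ.filter (fun i => l.idxFun i = none) with hs
  have hsum : ∀ x : Fin (ℓ + 1), ∑ i, (l x i : ℕ) = (∑ i, (l 0 i : ℕ)) + x * s.card := by
    intro x
    have e : ∀ i, (l x i : ℕ) = (l 0 i : ℕ) + x * (if l.idxFun i = none then 1 else 0) := by
      intro i
      simp only [Combinatorics.Line.apply_def]
      cases h : l.idxFun i <;> simp
    rw [Finset.sum_congr rfl (fun i _ => e i), Finset.sum_add_distrib, ← Finset.mul_sum, hs, Finset.card_filter]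
  have hsc : s.card ≤ Fintype.card ι := Finset.card_le_univ s
  refine ⟨∑ i, (l 0 i : ℕ), s.card, ?_, ?_, ?_, ?_⟩
  · rw [Finset.card_pos]
    obtain ⟨i, hi⟩ := l.proper
    exact ⟨i, by simp [hs, hi]⟩
  · nlinarith
  · have := hsum (Fin.last ℓ)
    rw [Fin.val_last] at this
    rw [← this]
    calc ∑ i, (l (Fin.last ℓ) i : ℕ) ≤ ∑ i : ι, (ℓ + 1) := Finset.sum_le_sum fun i _ => by omega
      _ = _ := by simp [mul_comm]
  · intro j hj
    have h1 := hl ⟨j, by omega⟩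
    have h2 := hl 0
    simp only at h1 h2
    rw [hsum] at h1
    rw [h2, ← h1]

section
variable (X : Sys)
noncomputable def Av (ℓ : ℕ) (f : Bd X.Ω) : Bd ℝ := X.m.part (∏ j ∈ Finset.range (ℓ + 1), X.act (fun r : ℝ => (j : ℝ) * r) f)
theorem Av_apply (ℓ : ℕ) (f : Bd X.Ω) (r : ℝ) : Av X ℓ f r = X.m (∏ j ∈ Finset.range (ℓ + 1), X.tr (j * r) f) := by
  rw [Av, Mean.part_apply, map_prod]; rfl

theorem Av_smul (ℓ : ℕ) (f : Bd X.Ω) (c : ℝ) : EE (Av X ℓ (c • f)) = c ^ (ℓ + 1) * EE (Av X ℓ f) := by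
  rw [← EE.smul']
  congr 1; ext r
  rw [Bd.smul_apply, Av_apply, Av_apply, ← X.m.smul']
  congr 1
  simp only [map_smul]
  rw [Finset.prod_smul]; simp

/-- the key inequality over a cell -/
theorem core_ineq {Z : Subalgebra ℝ (Bd X.Ω)} (hZ : Clo X.m Z) (hT : X.TInv Z) (f D : Bd X.Ω) (hf0 : ∀ ω, 0 ≤ f ω) (hf1 : ∀ ω, f ω ≤ 1)
    {ι : Type} [Fintype ι] (g : ι → Bd X.Ω) {B : ℝ} (hB0 : 0 ≤ B) (hB : ∀ i ω, |g i ω| ≤ B) (κ : Bd X.Ω) (ℓ : ℕ) (s : ℕ → ℝ) (c : ℕ → ι → Bd X.Ω)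
    (χ : Bd X.Ω) (hχ : χ ∈ Z) (hχ0 : ∀ ω, 0 ≤ χ ω)
    (hκ : ∀ j, X.m (χ * ((X.tr (s j) D - ∑ i, c j i * g i) * (X.tr (s j) D - ∑ i, c j i * g i))) ≤ X.m (χ * κ))
    {a ε δ : ℝ} (ha : 0 ≤ a) (hε : 0 < ε) (hδ : 0 ≤ δ)
    (h1 : ∀ ω, χ ω ≠ 0 → a ≤ X.tr (s 0) (ce X.cpl hZ f) ω)
    (h2 : ∀ j ≤ ℓ, ∀ ω, χ ω ≠ 0 → X.tr (s j) (ce X.cpl hZ ((f - D) * (f - D))) ω ≤ ε ^ 2)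
    (h3 : ∀ ω, χ ω ≠ 0 → κ ω ≤ ε ^ 2)
    (h4 : ∀ j ≤ ℓ, ∀ i ω, χ ω ≠ 0 → |c j i ω - c 0 i ω| ≤ δ) :
    (a ^ (ℓ + 1) - (ℓ + 1) * (4 * ε + Fintype.card ι * (δ * B))) * X.m χ ≤ X.m (χ * ∏ j ∈ Finset.range (ℓ + 1), X.tr (s j) f) := by
  have hcezz : ∀ (t : ℝ) (u y : Bd X.Ω), y ∈ Z → X.m (y * X.tr t u) = X.m (y * X.tr t (ce X.cpl hZ u)) := by
    intro t u y hy
    rw [mul_comm, X.m_tr_mul, ← ce_mul X.cpl hZ u (hT (-t) y hy), ← X.m_tr_mul, mul_comm]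
  -- quadratic bounds
  have hχc : ∀ (y : Bd X.Ω) (C : ℝ), (∀ ω, χ ω ≠ 0 → y ω ≤ C) → X.m (χ * y) ≤ C * X.m χ := by
    intro y C hy
    rw [← X.m.smul']
    refine X.m.mono fun ω => ?_
    rw [Bd.mul_apply, Bd.smul_apply, mul_comm C]
    by_cases h : χ ω = 0
    · rw [h]; simp
    · exact mul_le_mul_of_nonneg_left (hy ω h) (hχ0 ω)
  have hχc' : ∀ (y : Bd X.Ω) (C : ℝ), (∀ ω, χ ω ≠ 0 → C ≤ y ω) → C * X.m χ ≤ X.m (χ * y) := by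
    intro y C hy
    rw [← X.m.smul']
    refine X.m.mono fun ω => ?_
    rw [Bd.mul_apply, Bd.smul_apply, mul_comm C]
    by_cases h : χ ω = 0
    · rw [h]; simp
    · exact mul_le_mul_of_nonneg_left (hy ω h) (hχ0 ω)
  have hu : ∀ j ≤ ℓ, X.m (χ * ((X.tr (s j) f - X.tr (s j) D) * (X.tr (s j) f - X.tr (s j) D))) ≤ ε ^ 2 * X.m χ := by
    intro j hj
    rw [← map_sub, ← map_mul, hcezz _ _ _ hχ]
    exact hχc _ _ (h2 j hj)
  have hv : ∀ j, X.m (χ * ((X.tr (s j) D - ∑ i, c j i * g i) * (X.tr (s j) D - ∑ i, c j i * g i))) ≤ ε ^ 2 * X.m χ := fun j =>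
    (hκ j).trans (hχc _ _ h3)
  have habs : ∀ (y : Bd X.Ω), X.m (χ * (y * y)) ≤ ε ^ 2 * X.m χ → X.m (χ * y.abs) ≤ ε * X.m χ := by
    intro y hy
    have : X.m (χ * y.abs) ≤ (ε / 2) * X.m χ + (1 / (2 * ε)) * X.m (χ * (y * y)) := by
      rw [← X.m.smul', ← X.m.smul', ← map_add]
      refine X.m.mono fun ω => ?_
      simp only [Bd.mul_apply, Bd.add_apply, Bd.smul_apply]
      show χ ω * |y ω| ≤ _
      have : |y ω| ≤ ε / 2 + 1 / (2 * ε) * (y ω * y ω) := by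
        have e : ε / 2 + 1 / (2 * ε) * (y ω * y ω) - |y ω| = 1 / (2 * ε) * (|y ω| - ε) ^ 2 := by
          field_simp; rw [← sq_abs (y ω)]; ring
        have : 0 ≤ 1 / (2 * ε) * (|y ω| - ε) ^ 2 := by positivity
        linarith
      have := mul_le_mul_of_nonneg_left this (hχ0 ω)
      linarith
    have e : (1 / (2 * ε)) * (ε ^ 2 * X.m χ) = ε / 2 * X.m χ := by field_simp
    have := mul_le_mul_of_nonneg_left hy (show 0 ≤ 1 / (2 * ε) by positivity)
    linarith
  have hdiff : ∀ j ≤ ℓ, X.m (χ * (X.tr (s j) f - X.tr (s 0) f).abs) ≤ (4 * ε + Fintype.card ι * (δ * B)) * X.m χ := by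
    intro j hj
    have b1 := habs _ (hu j hj)
    have b2 := habs _ (hu 0 (Nat.zero_le _))
    have b3 := habs _ (hv j)
    have b4 := habs _ (hv 0)
    have : X.m (χ * (X.tr (s j) f - X.tr (s 0) f).abs) ≤ X.m (χ * (X.tr (s j) f - X.tr (s j) D).abs) + X.m (χ * (X.tr (s 0) f - X.tr (s 0) D).abs)
        + X.m (χ * (X.tr (s j) D - ∑ i, c j i * g i).abs) + X.m (χ * (X.tr (s 0) D - ∑ i, c 0 i * g i).abs) + (Fintype.card ι * (δ * B)) * X.m χ := by
      rw [← X.m.smul', ← map_add, ← map_add, ← map_add, ← map_add]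
      refine X.m.mono fun ω => ?_
      simp only [Bd.mul_apply, Bd.add_apply, Bd.smul_apply]
      by_cases h : χ ω = 0
      · rw [h]; simp
      · rw [mul_comm _ (χ ω), ← mul_add, ← mul_add, ← mul_add, ← mul_add]
        refine mul_le_mul_of_nonneg_left ?_ (hχ0 ω)
        show |(X.tr (s j) f) ω - (X.tr (s 0) f) ω| ≤ |(X.tr (s j) f) ω - (X.tr (s j) D) ω| + |(X.tr (s 0) f) ω - (X.tr (s 0) D) ω| + |(X.tr (s j) D) ω - (∑ i, c j i * g i) ω| + |(X.tr (s 0) D) ω - (∑ i, c 0 i * g i) ω| + _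
        have hy : |(∑ i, c j i * g i) ω - (∑ i, c 0 i * g i) ω| ≤ Fintype.card ι * (δ * B) := by
          rw [Bd.sum_apply, Bd.sum_apply, ← Finset.sum_sub_distrib]
          refine (Finset.abs_sum_le_sum_abs _ _).trans ?_
          calc _ ≤ ∑ i : ι, δ * B := Finset.sum_le_sum fun i _ => by
                rw [Bd.mul_apply, Bd.mul_apply, ← sub_mul, abs_mul]
                exact mul_le_mul (h4 j hj i ω h) (hB i ω) (abs_nonneg _) hδ
            _ = _ := by simp
        rw [abs_le] at hy
        have q1 := abs_le.mp (le_refl |(X.tr (s j) f) ω - (X.tr (s j) D) ω|)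
        have q2 := abs_le.mp (le_refl |(X.tr (s 0) f) ω - (X.tr (s 0) D) ω|)
        have q3 := abs_le.mp (le_refl |(X.tr (s j) D) ω - (∑ i, c j i * g i) ω|)
        have q4 := abs_le.mp (le_refl |(X.tr (s 0) D) ω - (∑ i, c 0 i * g i) ω|)
        rw [abs_le]; constructor <;> linarith
    linarith
  -- main term
  set x := X.tr (s 0) (ce X.cpl hZ f) with hx
  have hxZ : x ∈ Z := hT _ _ (ce_mem _ _ _)
  have hx0 : ∀ ω, 0 ≤ x ω := fun ω => ce_nonneg X.cpl hZ f hf0 _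
  have hmain : a ^ (ℓ + 1) * X.m χ ≤ X.m (χ * (X.tr (s 0) f) ^ (ℓ + 1)) := by
    have q1 : X.m (χ * x ^ (ℓ + 1) + ((ℓ : ℝ) + 1) • (χ * x ^ ℓ * (X.tr (s 0) f - x))) ≤ X.m (χ * (X.tr (s 0) f) ^ (ℓ + 1)) := by
      refine X.m.mono fun ω => ?_
      simp only [Bd.mul_apply, Bd.add_apply, Bd.smul_apply, Bd.pow_apply, Bd.sub_apply]
      have := mul_le_mul_of_nonneg_left (bern ℓ (show 0 ≤ (X.tr (s 0) f) ω from hf0 _) (hx0 ω)) (hχ0 ω)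
      have h' : ((ℓ : ℝ) + 1) * (χ ω * x ω ^ ℓ * ((X.tr (s 0) f) ω - x ω)) = χ ω * (((ℓ : ℝ) + 1) * x ω ^ ℓ * ((X.tr (s 0) f) ω - x ω)) := by ring
      rw [h', ← mul_add]
      exact this
    have q2 : X.m (χ * x ^ ℓ * (X.tr (s 0) f - x)) = 0 := by
      rw [mul_sub, map_sub, hcezz _ _ _ (Z.mul_mem hχ (Z.pow_mem hxZ ℓ)), sub_self]
    rw [map_add, X.m.smul', q2, mul_zero, add_zero] at q1
    refine le_trans (hχc' _ _ fun ω hω => ?_) q1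
    rw [Bd.pow_apply]
    exact pow_le_pow_left₀ ha (h1 ω hω) _
  have hsum : X.m (χ * (X.tr (s 0) f) ^ (ℓ + 1)) - ∑ j ∈ Finset.range (ℓ + 1), X.m (χ * (X.tr (s j) f - X.tr (s 0) f).abs) ≤
      X.m (χ * ∏ j ∈ Finset.range (ℓ + 1), X.tr (s j) f) := by
    rw [← map_sum, ← map_sub, ← Finset.mul_sum, ← mul_sub]
    refine X.m.mono fun ω => ?_
    rw [Bd.mul_apply, Bd.mul_apply]
    refine mul_le_mul_of_nonneg_left ?_ (hχ0 ω)
    rw [Bd.sub_apply, Bd.sum_apply, Bd.prod_apply, Bd.pow_apply]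
    exact prod_pow_le (ℓ + 1) (fun j => X.tr (s j) f ω) (fun j => hf0 _) (fun j => hf1 _)
  have hS : ∑ j ∈ Finset.range (ℓ + 1), X.m (χ * (X.tr (s j) f - X.tr (s 0) f).abs) ≤ (ℓ + 1) * ((4 * ε + Fintype.card ι * (δ * B)) * X.m χ) := by
    calc _ ≤ ∑ j ∈ Finset.range (ℓ + 1), ((4 * ε + Fintype.card ι * (δ * B)) * X.m χ) :=
          Finset.sum_le_sum fun j hj => hdiff j (by simpa [Nat.lt_succ_iff] using hj)
      _ = _ := by simp
  linarith
end
end Sz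

/-! Part 11 -/

namespace Sz
open Topology

noncomputable def hat (N : ℕ) (a : Fin (2 * N + 1)) (x : ℝ) : ℝ := max 0 (1 - |N * x - ((a : ℕ) - (N : ℝ))|)
theorem hat_cont (N : ℕ) (a : Fin (2 * N + 1)) : Continuous (hat N a) := by unfold hat; fun_prop
theorem hat_nonneg (N : ℕ) (a : Fin (2 * N + 1)) (x : ℝ) : 0 ≤ hat N a x := le_max_left _ _
theorem hat_le (N : ℕ) (a : Fin (2 * N + 1)) (x : ℝ) : hat N a x ≤ 1 :=
  max_le zero_le_one (by have := abs_nonneg (N * x - ((a : ℕ) - (N : ℝ))); linarith)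
theorem hat_supp (N : ℕ) (a : Fin (2 * N + 1)) (x : ℝ) (h : hat N a x ≠ 0) : |N * x - ((a : ℕ) - (N : ℝ))| ≤ 1 := by
  by_contra h'
  exact h (max_eq_left (by linarith))
theorem hat_big (N : ℕ) (x : ℝ) (hx : |x| ≤ 1) : ∃ a, 1 / 2 ≤ hat N a x := by
  have hN : (0:ℝ) ≤ N := Nat.cast_nonneg N
  have h1 : |(N : ℝ) * x| ≤ N := by
    rw [abs_mul, abs_of_nonneg hN]; exact mul_le_of_le_one_right hN hx
  obtain ⟨h2, h3⟩ := abs_le.mp h1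
  have h4 := abs_sub_round ((N : ℝ) * x)
  have h5 : -(N : ℤ) ≤ round ((N : ℝ) * x) := by
    have := abs_le.mp h4
    have : (-(N:ℤ) : ℝ) - 1 < (round ((N : ℝ) * x) : ℝ) := by push_cast; linarith
    have : -(N:ℤ) - 1 < round ((N : ℝ) * x) := by exact_mod_cast this
    omega
  have h6 : round ((N : ℝ) * x) ≤ N := by
    have := abs_le.mp h4
    have : (round ((N : ℝ) * x) : ℝ) < N + 1 := by linarith
    have : round ((N : ℝ) * x) < N + 1 := by exact_mod_cast this
    omega
  refine ⟨⟨(round ((N : ℝ) * x) + N).toNat, by omega⟩, le_max_of_le_right ?_⟩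
  have e : (((round ((N : ℝ) * x) + N).toNat : ℕ) : ℝ) = round ((N : ℝ) * x) + N := by
    have : (((round ((N : ℝ) * x) + N).toNat : ℕ) : ℤ) = round ((N : ℝ) * x) + N := Int.toNat_of_nonneg (by omega)
    exact_mod_cast this
  simp only [e]
  rw [add_sub_cancel_right]
  linarith

section
variable (X : Sys)

theorem Av_nonneg (ℓ : ℕ) (f : Bd X.Ω) (hf : ∀ ω, 0 ≤ f ω) (r : ℝ) : 0 ≤ Av X ℓ f r := by
  rw [Av_apply]
  refine X.m.nonneg fun ω => ?_
  rw [Bd.prod_apply]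
  exact Finset.prod_nonneg fun j _ => hf _

/-- shift of the base point in a progression -/
theorem Av_shift (ℓ : ℕ) (f : Bd X.Ω) (a b : ℕ) (r : ℝ) :
    X.m (∏ j ∈ Finset.range (ℓ + 1), X.tr (((a + j * b : ℕ) : ℝ) * r) f) = Av X ℓ f ((b : ℝ) * r) := by
  rw [Av_apply, ← X.m_tr ((a : ℝ) * r) (∏ j ∈ Finset.range (ℓ + 1), X.tr ((j : ℝ) * ((b : ℝ) * r)) f), map_prod (X.tr ((a : ℝ) * r))]
  congr 1
  refine Finset.prod_congr rfl fun j _ => ?_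
  rw [X.tr_tr]
  congr 2
  push_cast; ring

theorem rec_zero (f : Bd X.Ω) (hf : f ∈ ZZ X 0) (hpos : 0 < X.m f) (ℓ : ℕ) : 0 < EE (Av X ℓ f) := by
  set α := X.m f with hα
  have h1 : f - algebraMap ℝ _ α ∈ nul X.m := by
    refine nul_of_sq (le_antisymm (le_of_forall_pos_le_add fun ε hε => ?_) (X.m.sq_nonneg' _))
    obtain ⟨g, hg, h⟩ := hf ε hε
    obtain ⟨c, rfl⟩ := Algebra.mem_bot.mp hg
    rw [zero_add]
    refine le_trans ?_ h
    have e : ∀ c : ℝ, (f - algebraMap ℝ _ c) * (f - algebraMap ℝ _ c) = f * f - (2 * c) • f + algebraMap ℝ _ (c * c) := by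
      intro c; ext ω; simp; ring
    unfold Mean.d2
    rw [e, e, map_add, map_add, map_sub, map_sub, X.m.smul', X.m.smul', X.m.const, X.m.const, ← hα]
    nlinarith [sq_nonneg (α - c)]
  have h2 : ∀ s, Ideal.Quotient.mk (nul X.m) (X.tr s f) = Ideal.Quotient.mk (nul X.m) (algebraMap ℝ _ α) := by
    intro s
    rw [Ideal.Quotient.eq]
    have e : X.tr s f - algebraMap ℝ _ α = X.tr s (f - algebraMap ℝ _ α) := by rw [map_sub]; congr 1
    rw [e]
    refine nul_of_sq ?_
    rw [← map_mul, X.m_tr]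
    exact h1 _
  have h3 : Av X ℓ f = algebraMap ℝ _ (α ^ (ℓ + 1)) := by
    ext r
    rw [Av_apply]
    have h4 : (∏ j ∈ Finset.range (ℓ + 1), X.tr (j * r) f) - algebraMap ℝ _ (α ^ (ℓ + 1)) ∈ nul X.m := by
      rw [← Ideal.Quotient.eq, map_prod, Finset.prod_congr rfl (fun j _ => h2 _), Finset.prod_const, Finset.card_range, ← map_pow, ← map_pow]
    have := nul_zero h4
    rw [map_sub, X.m.const, sub_eq_zero] at this
    rw [this]; rfl
  rw [h3, EE.const]; positivity

theorem rec_step1 (d : ℕ) (ih : ∀ f ∈ ZZ X d, (∀ ω, 0 ≤ f ω) → 0 < X.m f → ∀ ℓ, 0 < EE (Av X ℓ f))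
    (f : Bd X.Ω) (hf : f ∈ ZZ X (d + 1)) (hf0 : ∀ ω, 0 ≤ f ω) (hf1 : ∀ ω, f ω ≤ 1) (hpos : 0 < X.m f) (ℓ : ℕ) : 0 < EE (Av X ℓ f) := by
  set α := X.m f with hα
  set Z := ZZ X d with hZd
  have hZ : Clo X.m Z := clo_ZZ X d
  have hT : X.TInv Z := tinv_ZZ X d
  set a := α / 2 with ha
  have ha0 : 0 < a := by positivity
  set ε := a ^ (ℓ + 1) / (16 * (ℓ + 1)) with hε
  have hε0 : 0 < ε := by positivity
  obtain ⟨D, hD, hfD⟩ := hf (ε ^ 2 * α / 8) (by positivity)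
  obtain ⟨ι, _, g, κ, hκZ, hκ0, hκm, hAP⟩ := hD (ε ^ 2 * α / 8) (by positivity)
  choose c hcZ hc using hAP
  choose B0 hB00 hB0 using fun i => (g i).bound
  set B := ∑ i, B0 i with hB
  have hBn : 0 ≤ B := Finset.sum_nonneg fun i _ => (hB00 i).le
  have hgB : ∀ i ω, |g i ω| ≤ B := fun i ω => (hB0 i ω).trans (Finset.single_le_sum (f := B0) (fun i _ => (hB00 i).le) (Finset.mem_univ i))
  obtain ⟨N, hN⟩ := exists_nat_gt (8 * (ℓ + 1) * (Fintype.card ι * B) / a ^ (ℓ + 1))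
  have hNpos : (0 : ℝ) < N := lt_of_le_of_lt (by positivity) hN
  obtain ⟨W, hW⟩ := vdW ℓ (ι → Fin (2 * N + 1))
  -- beta
  set e := ce X.cpl hZ ((f - D) * (f - D)) with he
  have heZ : e ∈ Z := ce_mem _ _ _
  have he0 : ∀ ω, 0 ≤ e ω := ce_nonneg _ _ _ fun ω => mul_self_nonneg _
  have c1 : Continuous (fun x : ℝ => max 0 (x - a)) := by fun_prop
  have c2 : Continuous (fun x : ℝ => max 0 (1 - x / ε ^ 2)) := by fun_prop
  set β := Bd.post _ c1 (ce X.cpl hZ f) * Bd.post _ c2 κ * Bd.post _ c2 e with hβ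
  have hβZ : β ∈ Z := Z.mul_mem (Z.mul_mem (hZ.post (ce_mem _ _ _) c1) (hZ.post hκZ c2)) (hZ.post heZ c2)
  have hβap : ∀ ω, β ω = max 0 (ce X.cpl hZ f ω - a) * max 0 (1 - κ ω / ε ^ 2) * max 0 (1 - e ω / ε ^ 2) := fun ω => rfl
  have hcef : ∀ ω, 0 ≤ ce X.cpl hZ f ω ∧ ce X.cpl hZ f ω ≤ 1 := ce_between X.cpl hZ f (fun ω => ⟨hf0 ω, hf1 ω⟩)
  have hβ0 : ∀ ω, 0 ≤ β ω := fun ω => by rw [hβap]; positivity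
  have hy : ∀ y : ℝ, 0 ≤ y → max 0 (1 - y / ε ^ 2) ≤ 1 := fun y hy => max_le zero_le_one (by have : 0 ≤ y / ε ^ 2 := by positivity
                                                                                             linarith)
  have hx : ∀ ω, max 0 (ce X.cpl hZ f ω - a) ≤ 1 := fun ω => max_le zero_le_one (by have := hcef ω; linarith)
  have hβ1 : ∀ ω, β ω ≤ 1 := fun ω => by
    rw [hβap]
    exact mul_le_one₀ (mul_le_one₀ (hx ω) (le_max_left _ _) (hy _ (hκ0 ω))) (le_max_left _ _) (hy _ (he0 ω))
  have hβm : 0 < X.m β := by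
    have h1 : X.m (ce X.cpl hZ f - algebraMap ℝ _ a - (ε ^ 2)⁻¹ • κ - (ε ^ 2)⁻¹ • e) ≤ X.m β := by
      refine X.m.mono fun ω => ?_
      rw [hβap]
      simp only [Bd.sub_apply, Bd.smul_apply, Bd.algebraMap_apply']
      have q1 := hx ω
      have q2 := hy _ (hκ0 ω)
      have q3 := hy _ (he0 ω)
      have p1 : ce X.cpl hZ f ω - a ≤ max 0 (ce X.cpl hZ f ω - a) := le_max_right _ _
      have p2 : 1 - κ ω / ε ^ 2 ≤ max 0 (1 - κ ω / ε ^ 2) := le_max_right _ _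
      have p3 : 1 - e ω / ε ^ 2 ≤ max 0 (1 - e ω / ε ^ 2) := le_max_right _ _
      have r1 : 0 ≤ max 0 (ce X.cpl hZ f ω - a) := le_max_left _ _
      have r2 : 0 ≤ max 0 (1 - κ ω / ε ^ 2) := le_max_left _ _
      have r3 : 0 ≤ max 0 (1 - e ω / ε ^ 2) := le_max_left _ _
      rw [inv_mul_eq_div, inv_mul_eq_div]
      set x := max 0 (ce X.cpl hZ f ω - a)
      set u := max 0 (1 - κ ω / ε ^ 2)
      set v := max 0 (1 - e ω / ε ^ 2)
      have : x - (1 - u) - (1 - v) ≤ x * u * v := by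
        have t1 : x - (1 - u) ≤ x * u := by nlinarith
        have t2 : x * u - (1 - v) ≤ x * u * v := by nlinarith [mul_le_one₀ q1 r2 q2]
        linarith
      linarith
    rw [map_sub, map_sub, map_sub, X.m.const, X.m.smul', X.m.smul', ce_mean, he, ce_mean, ← hα] at h1
    have h2 : (ε ^ 2)⁻¹ * X.m κ ≤ α / 8 := by
      rw [inv_mul_le_iff₀ (by positivity)]; linarith
    have h3 : (ε ^ 2)⁻¹ * X.m ((f - D) * (f - D)) ≤ α / 8 := by
      rw [inv_mul_le_iff₀ (by positivity)]; unfold Mean.d2 at hfD; linarith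
    have : a = α / 2 := ha
    linarith
  have hβpos := ih β hβZ hβ0 hβm W
  -- cells
  let br : ℝ → Bd X.Ω := fun r => ∏ i ∈ Finset.range (W + 1), X.tr ((i : ℝ) * r) β
  let th : ℝ → (Fin (W + 1) → ι → Fin (2 * N + 1)) → Bd X.Ω := fun r Γ =>
    ∏ i : Fin (W + 1), ∏ k : ι, Bd.post _ (hat_cont N (Γ i k)) (c (((i : ℕ) : ℝ) * r) k)
  set c₁ := a ^ (ℓ + 1) / 2 with hc₁
  have hc₁0 : 0 < c₁ := by positivity
  have hbr0 : ∀ r ω, 0 ≤ br r ω := fun r ω => by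
    rw [Bd.prod_apply]; exact Finset.prod_nonneg fun i _ => hβ0 _
  have hbr1 : ∀ r ω, br r ω ≤ 1 := fun r ω => by
    rw [Bd.prod_apply]; exact Finset.prod_le_one (fun i _ => hβ0 _) (fun i _ => hβ1 _)
  have hthap : ∀ r Γ ω, th r Γ ω = ∏ i : Fin (W + 1), ∏ k : ι, hat N (Γ i k) (c (((i : ℕ) : ℝ) * r) k ω) := fun r Γ ω => by
    simp only [th, Bd.prod_apply, Bd.post_apply]
  have hth0 : ∀ r Γ ω, 0 ≤ th r Γ ω := fun r Γ ω => by
    rw [hthap]; exact Finset.prod_nonneg fun i _ => Finset.prod_nonneg fun k _ => hat_nonneg _ _ _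
  have hth1 : ∀ r Γ ω, th r Γ ω ≤ 1 := fun r Γ ω => by
    rw [hthap]
    exact Finset.prod_le_one (fun i _ => Finset.prod_nonneg fun k _ => hat_nonneg _ _ _)
      (fun i _ => Finset.prod_le_one (fun k _ => hat_nonneg _ _ _) (fun k _ => hat_le _ _ _))
  have hAvn := Av_nonneg X ℓ f hf0
  -- each cell
  have hcell : ∀ r Γ, c₁ * X.m (br r * th r Γ) ≤ ∑ b ∈ Finset.range W, Av X ℓ f (((b + 1 : ℕ) : ℝ) * r) := by
    intro r Γ
    obtain ⟨p, b, hb0, hbW, hpb, hmono⟩ := hW (fun n => Γ (Fin.ofNat (W + 1) n))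
    set χ := br r * th r Γ with hχ
    have hχZ : χ ∈ Z := Z.mul_mem (Z.prod_mem fun i _ => hT _ _ hβZ)
      (Z.prod_mem fun i _ => Z.prod_mem fun k _ => hZ.post (hcZ _ _).1 _)
    have hχ0 : ∀ ω, 0 ≤ χ ω := fun ω => mul_nonneg (hbr0 r ω) (hth0 r Γ ω)
    have hχ1 : ∀ ω, χ ω ≤ 1 := fun ω => mul_le_one₀ (hbr1 r ω) (hth0 r Γ ω) (hth1 r Γ ω)
    have hsβ : ∀ ω, χ ω ≠ 0 → ∀ i ≤ W, β (X.T ((i : ℝ) * r) ω) ≠ 0 := by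
      intro ω hω i hi h0
      apply hω
      have : br r ω = 0 := by
        rw [Bd.prod_apply]; exact Finset.prod_eq_zero (Finset.mem_range.mpr (Nat.lt_succ_of_le hi)) h0
      rw [hχ, Bd.mul_apply, this, zero_mul]
    have hsh : ∀ ω, χ ω ≠ 0 → ∀ i ≤ W, ∀ k, hat N (Γ (Fin.ofNat (W + 1) i) k) (c ((i : ℝ) * r) k ω) ≠ 0 := by
      intro ω hω i hi k h0
      apply hω
      have : th r Γ ω = 0 := by
        rw [hthap]
        refine Finset.prod_eq_zero (Finset.mem_univ (Fin.ofNat (W + 1) i)) (Finset.prod_eq_zero (Finset.mem_univ k) ?_)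
        have : ((Fin.ofNat (W + 1) i : Fin (W + 1)) : ℕ) = i := by simp [Nat.mod_eq_of_lt (Nat.lt_succ_of_le hi)]
        rw [this]; exact h0
      rw [hχ, Bd.mul_apply, this, mul_zero]
    have hβs : ∀ ω, β ω ≠ 0 → a ≤ ce X.cpl hZ f ω ∧ κ ω ≤ ε ^ 2 ∧ e ω ≤ ε ^ 2 := by
      intro ω h
      rw [hβap] at h
      refine ⟨?_, ?_, ?_⟩
      · by_contra h'; apply h; rw [max_eq_left (by linarith), zero_mul, zero_mul]
      · by_contra h'; apply h
        rw [max_eq_left (b := 1 - κ ω / ε ^ 2), mul_zero, zero_mul]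
        rw [sub_nonpos, le_div_iff₀ (by positivity)]; linarith
      · by_contra h'; apply h
        rw [max_eq_left (b := 1 - e ω / ε ^ 2), mul_zero]
        rw [sub_nonpos, le_div_iff₀ (by positivity)]; linarith
    have hle : ∀ j ≤ ℓ, p + j * b ≤ W := fun j hj => le_trans (by gcongr) hpb
    have hcore := core_ineq X hZ hT f D hf0 hf1 g hBn hgB κ ℓ (fun j => ((p + j * b : ℕ) : ℝ) * r) (fun j => c (((p + j * b : ℕ) : ℝ) * r))
      χ hχZ hχ0 (fun j => hc _ χ hχZ hχ0) ha0.le hε0 (δ := 2 / N) (by positivity)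
      (fun ω hω => (hβs _ (hsβ ω hω _ (hle 0 (Nat.zero_le _)))).1)
      (fun j hj ω hω => (hβs _ (hsβ ω hω _ (hle j hj))).2.2)
      (fun ω hω => by
        have := (hβs _ (hsβ ω hω 0 (Nat.zero_le _))).2.1
        rwa [Nat.cast_zero, zero_mul, X.T_zero] at this)
      (fun j hj k ω hω => by
        have q1 := abs_le.mp (hat_supp _ _ _ (hsh ω hω _ (hle j hj) k))
        have q2 := abs_le.mp (hat_supp _ _ _ (hsh ω hω _ (hle 0 (Nat.zero_le _)) k))
        have q3 := congrFun (hmono j hj) k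
        have q4 := congrFun (hmono 0 (Nat.zero_le _)) k

        rw [q3] at q1; rw [q4] at q2
        rw [le_div_iff₀ hNpos, ← abs_of_pos hNpos, ← abs_mul, abs_le]
        constructor <;> nlinarith)
    have hmχ : 0 ≤ X.m χ := X.m.nonneg hχ0
    have hconst : c₁ ≤ a ^ (ℓ + 1) - (ℓ + 1) * (4 * ε + Fintype.card ι * (2 / N * B)) := by
      have t1 : ((ℓ : ℝ) + 1) * (4 * ε) = a ^ (ℓ + 1) / 4 := by rw [hε]; field_simp; norm_num
      have t2 : ((ℓ : ℝ) + 1) * (Fintype.card ι * (2 / N * B)) ≤ a ^ (ℓ + 1) / 4 := by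
        rw [div_lt_iff₀ (by positivity)] at hN
        have e : ((ℓ : ℝ) + 1) * (Fintype.card ι * (2 / N * B)) = (8 * (ℓ + 1) * (Fintype.card ι * B)) / (4 * N) := by field_simp; ring
        rw [e, div_le_iff₀ (by positivity)]
        linarith
      rw [hc₁]; linarith
    have t3 : X.m (χ * ∏ j ∈ Finset.range (ℓ + 1), X.tr (((p + j * b : ℕ) : ℝ) * r) f) ≤ Av X ℓ f ((b : ℝ) * r) := by
      rw [← Av_shift X ℓ f p b r]
      refine X.m.mono fun ω => ?_
      rw [Bd.mul_apply]
      refine mul_le_of_le_one_left ?_ (hχ1 ω)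
      rw [Bd.prod_apply]; exact Finset.prod_nonneg fun j _ => hf0 _
    have t4 : Av X ℓ f ((b : ℝ) * r) ≤ ∑ b ∈ Finset.range W, Av X ℓ f (((b + 1 : ℕ) : ℝ) * r) := by
      have := Finset.single_le_sum (f := fun b : ℕ => Av X ℓ f (((b + 1 : ℕ) : ℝ) * r)) (fun i _ => hAvn _) (Finset.mem_range.mpr (show b - 1 < W by omega))
      rwa [Nat.sub_add_cancel hb0] at this
    exact (mul_le_mul_of_nonneg_right hconst hmχ).trans (hcore.trans (t3.trans t4))
  -- sum over cells
  classical
  set c₂ : ℝ := ∏ i : Fin (W + 1), ∏ k : ι, (1 / 2 : ℝ) with hc₂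
  have hc₂0 : 0 < c₂ := Finset.prod_pos fun i _ => Finset.prod_pos fun k _ => by norm_num
  set nΓ := Fintype.card (Fin (W + 1) → ι → Fin (2 * N + 1)) with hnΓ
  have hsum : ∀ r, c₂ * X.m (br r) ≤ ∑ Γ, X.m (br r * th r Γ) := by
    intro r
    rw [← map_sum, ← X.m.smul']
    refine X.m.mono fun ω => ?_
    rw [Bd.sum_apply, Bd.smul_apply]
    have hc' : ∀ (i : Fin (W + 1)) (k : ι), ∃ a, 1 / 2 ≤ hat N a (c (((i : ℕ) : ℝ) * r) k ω) := fun i k => hat_big N _ ((hcZ _ k).2 ω)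
    choose Γ hΓ using hc'
    refine le_trans ?_ (Finset.single_le_sum (f := fun Γ => (br r * th r Γ) ω) (fun Γ _ => mul_nonneg (hbr0 r ω) (hth0 r Γ ω)) (Finset.mem_univ Γ))
    show _ ≤ br r ω * th r Γ ω
    rw [mul_comm]
    refine mul_le_mul_of_nonneg_left ?_ (hbr0 r ω)
    rw [hthap]
    exact Finset.prod_le_prod (fun i _ => Finset.prod_nonneg fun k _ => by norm_num)
      (fun i _ => Finset.prod_le_prod (fun k _ => by norm_num) (fun k _ => hΓ i k))
  have hfin : ∀ r, c₁ * (c₂ * Av X W β r) ≤ nΓ * ∑ b ∈ Finset.range W, Av X ℓ f (((b + 1 : ℕ) : ℝ) * r) := by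
    intro r
    rw [Av_apply]
    calc c₁ * (c₂ * X.m (br r)) ≤ c₁ * ∑ Γ, X.m (br r * th r Γ) := mul_le_mul_of_nonneg_left (hsum r) hc₁0.le
      _ = ∑ Γ, c₁ * X.m (br r * th r Γ) := Finset.mul_sum _ _ _
      _ ≤ ∑ Γ : Fin (W + 1) → ι → Fin (2 * N + 1), ∑ b ∈ Finset.range W, Av X ℓ f (((b + 1 : ℕ) : ℝ) * r) := Finset.sum_le_sum fun Γ _ => hcell r Γ
      _ = _ := by rw [Finset.sum_const, Finset.card_univ, nsmul_eq_mul]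
  have hE := EE.mono (f := c₁ • (c₂ • Av X W β)) (g := (nΓ : ℝ) • ∑ b ∈ Finset.range W, Bd.comp (fun r => ((b + 1 : ℕ) : ℝ) * r) (Av X ℓ f)) (fun r => by
    rw [Bd.smul_apply, Bd.smul_apply, Bd.smul_apply, Bd.sum_apply]
    exact hfin r)
  rw [EE.smul', EE.smul', EE.smul', map_sum, Finset.sum_congr rfl (fun b _ => EE_mul _ (by positivity) _), Finset.sum_const, Finset.card_range, nsmul_eq_mul] at hE
  have h1 : 0 < c₁ * (c₂ * EE (Av X W β)) := by positivity
  by_contra h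
  push Not at h
  have : (nΓ : ℝ) * (W * EE (Av X ℓ f)) ≤ 0 :=
    mul_nonpos_of_nonneg_of_nonpos (Nat.cast_nonneg _) (mul_nonpos_of_nonneg_of_nonpos (Nat.cast_nonneg _) h)
  linarith

theorem rec_all (d : ℕ) : ∀ f ∈ ZZ X d, (∀ ω, 0 ≤ f ω) → 0 < X.m f → ∀ ℓ, 0 < EE (Av X ℓ f) := by
  induction d with
  | zero => intro f hf _ hp ℓ; exact rec_zero X f hf hp ℓ
  | succ d ih =>
    intro f hf hf0 hp ℓ
    obtain ⟨C, hC, hfC⟩ := f.bound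
    have h := rec_step1 X d ih (C⁻¹ • f) (Subalgebra.smul_mem _ hf _) (fun ω => by
      rw [Bd.smul_apply]; exact mul_nonneg (by positivity) (hf0 ω)) (fun ω => by
      rw [Bd.smul_apply, inv_mul_le_iff₀ hC, mul_one]; exact (abs_le.mp (hfC ω)).2)
      (by rw [X.m.smul']; positivity) ℓ
    rw [Av_smul] at h
    exact (pos_iff_pos_of_mul_pos h).mp (by positivity)

/-- Theorem B -/
theorem thmB (ℓ : ℕ) (f : Bd X.Ω) (hf0 : ∀ ω, 0 ≤ f ω) (hp : 0 < X.m f) : 0 < EE (Av X ℓ f) := by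
  set e := ce X.cpl (clo_ZZ X ℓ) f with he
  have h1 : 0 < EE (Av X ℓ e) := rec_all X ℓ e (ce_mem _ _ _) (ce_nonneg _ _ _ hf0) (by rw [he, ce_mean]; exact hp) ℓ
  have key : ∀ S ⊆ Finset.range (ℓ + 1), EE.prod X.m (∏ a ∈ Finset.range (ℓ + 1), X.act (fun r => ((a : ℤ) : ℝ) * r) (if a ∈ S then f else e))
      = EE.prod X.m (∏ a ∈ Finset.range (ℓ + 1), X.act (fun r => ((a : ℤ) : ℝ) * r) e) := by
    intro S
    induction S using Finset.induction_on with
    | empty => intro _; simp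
    | insert j S hj ih =>
      intro hS
      rw [← ih ((Finset.subset_insert _ _).trans hS), ← sub_eq_zero, ← map_sub]
      have hjr : j ∈ Finset.range (ℓ + 1) := hS (Finset.mem_insert_self _ _)
      have := nullN X ℓ (Finset.range (ℓ + 1)) (fun a => (a : ℤ)) (fun a _ b _ h => Int.ofNat_inj.mp h) (Finset.card_range _) j hjr
        (fun a => if a = j then f - e else if a ∈ S then f else e) (fun z hz => by
          rw [if_pos rfl, sub_mul, map_sub, he, ce_mul _ _ _ hz, sub_self])
      rw [← this]
      congr 1
      rw [← Finset.mul_prod_erase _ _ hjr, ← Finset.mul_prod_erase _ _ hjr, ← Finset.mul_prod_erase _ _ hjr]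
      have e1 : ∀ a ∈ (Finset.range (ℓ + 1)).erase j, X.act (fun r => ((a : ℤ) : ℝ) * r) (if a ∈ insert j S then f else e) = X.act (fun r => ((a : ℤ) : ℝ) * r) (if a ∈ S then f else e) := by
        intro a ha
        have : a ≠ j := Finset.ne_of_mem_erase ha
        simp [this]
      have e2 : ∀ a ∈ (Finset.range (ℓ + 1)).erase j, X.act (fun r => ((a : ℤ) : ℝ) * r) (if a = j then f - e else if a ∈ S then f else e) = X.act (fun r => ((a : ℤ) : ℝ) * r) (if a ∈ S then f else e) := by
        intro a ha
        have : a ≠ j := Finset.ne_of_mem_erase ha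
        simp [this]
      rw [Finset.prod_congr rfl e1, Finset.prod_congr rfl e2]
      simp only [Finset.mem_insert_self, if_true, if_neg hj]
      rw [← sub_mul]
      congr 1
  have hk := key _ (Finset.Subset.refl _)
  have : ∀ a ∈ Finset.range (ℓ + 1), X.act (fun r => ((a : ℤ) : ℝ) * r) (if a ∈ Finset.range (ℓ + 1) then f else e) = X.act (fun r => ((a : ℤ) : ℝ) * r) f := by
    intro a ha; rw [if_pos ha]
  rw [Finset.prod_congr rfl this] at hk
  have hh : ∀ g, EE.prod X.m (∏ a ∈ Finset.range (ℓ + 1), X.act (fun r => ((a : ℤ) : ℝ) * r) g) = EE (Av X ℓ g) := by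
    intro g
    rw [Mean.prod_apply]; unfold Av; simp only [Int.cast_natCast]
  rw [hh, hh] at hk
  rw [hk]; exact h1
end
end Sz

/-! Part 12 -/

namespace Sz
open Topology

section pet
open Classical in
/-- classes of finite sets used in the PET induction -/
structure PC {V : Type} [AddCommGroup V] (S : V →+ V) (Zi : AddSubgroup V) (G : Finset V → Prop) (w : Finset V → Prop) : Prop where
  sub : ∀ U U', U ⊆ U' → w U' → w U
  st : ∀ W, w W → ∀ h h' : ℕ, w (W.image (S^[h]) ∪ W.image (S^[h']))
  tr : ∀ W, w W → ∀ u ∈ Zi, w (W.image (· + u))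
  g : ∀ W, w W → G W

variable {V : Type} [AddCommGroup V] (S : V →+ V) (Z : ℕ → AddSubgroup V) (G : Finset V → Prop)

open Classical in
theorem pet (k : ℕ) (hZ0 : ∀ v, v ∈ Z 0) (hZk : ∀ v ∈ Z k, v = 0) (hSZ : ∀ i, ∀ v ∈ Z i, S v - v ∈ Z (i + 1))
    (hZa : ∀ i, Z (i + 1) ≤ Z i)
    (hsub : ∀ U U', U ⊆ U' → G U' → G U) (htr : ∀ (U : Finset V) (u : V), G (U.image (· + u)) → G U) (hbase : G {0})
    (hstep : ∀ W : Finset V, 0 ∉ W → ∀ m' ∈ W, G (insert 0 (W.erase m')) →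
      (∀ h h' : ℕ, G (W.image (S^[h]) ∪ W.image (S^[h']))) → G (insert 0 W)) : ∀ U, G U := by
  have hit : ∀ i, ∀ v ∈ Z i, ∀ h : ℕ, S^[h] v - v ∈ Z (i + 1) := by
    intro i v hv h
    induction h with
    | zero => simp
    | succ h ih =>
      rw [Function.iterate_succ_apply']
      have h1 : S^[h] v ∈ Z i := by
        have := (Z i).add_mem (hZa i ih) hv
        simpa using this
      have := (Z (i+1)).add_mem (hSZ i _ h1) ih
      simpa using this
  have key : ∀ n i, i + n = k → ∀ w, PC S (Z i) G w → ∀ U : Finset V, (∀ u ∈ U, u ∈ Z i) → ∀ W, w W → G (U ∪ W) := by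
    intro n
    induction n with
    | zero =>
      intro i hi w hw U hU W hW
      have hik : i = k := by omega
      subst hik
      have : ∀ n : ℕ, ∀ W : Finset V, W.card = n → 0 ∉ W → w W → G (insert 0 W) := by
        intro n
        induction n with
        | zero => intro W hc _ _; rw [Finset.card_eq_zero.mp hc]; exact hbase
        | succ n ih =>
          intro W hc h0 hW
          obtain ⟨m', hm'⟩ : W.Nonempty := by rw [← Finset.card_pos]; omega
          refine hstep W h0 m' hm' (ih _ (by rw [Finset.card_erase_of_mem hm', hc]; rfl) (fun h => h0 (Finset.mem_of_mem_erase h)) (hw.sub _ _ (Finset.erase_subset _ _) hW)) ?_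
          intro h h'
          exact hw.g _ (hw.st W hW h h')
      refine hsub _ (insert 0 (W.erase 0)) ?_ (this _ _ rfl (Finset.notMem_erase _ _) (hw.sub _ _ (Finset.erase_subset _ _) hW))
      intro x hx
      rcases Finset.mem_union.mp hx with h | h
      · rw [hZk x (hU x h)]; exact Finset.mem_insert_self _ _
      · by_cases h0 : x = 0
        · rw [h0]; exact Finset.mem_insert_self _ _
        · exact Finset.mem_insert_of_mem (Finset.mem_erase.mpr ⟨h0, h⟩)
    | succ n ih =>
      intro i hi w hw
      have ih' := ih (i + 1) (by omega)
      let π : V → V ⧸ Z (i + 1) := fun v => (v : V ⧸ Z (i + 1))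
      have hπ : ∀ x y, π x = π y ↔ -x + y ∈ Z (i + 1) := fun x y => QuotientAddGroup.eq
      have main : ∀ g : ℕ, ∀ U : Finset V, (∀ u ∈ U, u ∈ Z i) → (U.image π).card ≤ g → ∀ W, w W → G (U ∪ W) := by
        intro g
        induction g with
        | zero =>
          intro U _ hc W hW
          have : U = ∅ := by
            rw [← Finset.image_eq_empty (f := π), ← Finset.card_eq_zero]; omega
          rw [this, Finset.empty_union]; exact hw.g _ hW
        | succ g ihg =>
          intro U hU hc W hW
          by_cases hUe : U = ∅
          · rw [hUe, Finset.empty_union]; exact hw.g _ hW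
          obtain ⟨u, hu⟩ := Finset.nonempty_iff_ne_empty.mpr hUe
          let w' : Finset V → Prop := fun W' => ∃ U₁ W₁ : Finset V, (∀ u ∈ U₁, u ∈ Z i) ∧ (U₁.image π).card ≤ g ∧ w W₁ ∧ W' ⊆ U₁ ∪ W₁
          have hw' : PC S (Z (i + 1)) G w' := by
            constructor
            · rintro A B hAB ⟨U₁, W₁, h1, h2, h3, h4⟩
              exact ⟨U₁, W₁, h1, h2, h3, hAB.trans h4⟩
            · rintro A ⟨U₁, W₁, h1, h2, h3, h4⟩ h h'
              refine ⟨U₁.image (S^[h]) ∪ U₁.image (S^[h']), _, ?_, ?_, hw.st W₁ h3 h h', ?_⟩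
              · have : ∀ h : ℕ, ∀ u ∈ U₁, S^[h] u ∈ Z i := fun h u hu => by
                  have := (Z i).add_mem (hZa i (hit i u (h1 u hu) h)) (h1 u hu)
                  simpa using this
                intro x hx
                rcases Finset.mem_union.mp hx with hx | hx <;>
                · obtain ⟨y, hy, rfl⟩ := Finset.mem_image.mp hx
                  exact this _ y hy
              · refine le_trans (Finset.card_le_card ?_) h2
                have : ∀ h : ℕ, ∀ u ∈ U₁, π (S^[h] u) = π u := fun h u hu => by
                  rw [eq_comm, hπ, neg_add_eq_sub]; exact hit i u (h1 u hu) h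
                intro z hz
                obtain ⟨x, hx, rfl⟩ := Finset.mem_image.mp hz
                rcases Finset.mem_union.mp hx with hx | hx <;>
                · obtain ⟨y, hy, rfl⟩ := Finset.mem_image.mp hx
                  rw [this _ y hy]; exact Finset.mem_image_of_mem _ hy
              · intro x hx
                rcases Finset.mem_union.mp hx with hx | hx <;>
                · obtain ⟨y, hy, rfl⟩ := Finset.mem_image.mp hx
                  rcases Finset.mem_union.mp (h4 hy) with hy | hy
                  · simp only [Finset.mem_union]
                    have := fun h : ℕ => Finset.mem_image_of_mem (S^[h]) hy
                    grind
                  · simp only [Finset.mem_union]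
                    have := fun h : ℕ => Finset.mem_image_of_mem (S^[h]) hy
                    grind
            · rintro A ⟨U₁, W₁, h1, h2, h3, h4⟩ u hu
              refine ⟨U₁.image (· + u), _, ?_, ?_, hw.tr W₁ h3 u (hZa i hu), ?_⟩
              · intro x hx
                obtain ⟨y, hy, rfl⟩ := Finset.mem_image.mp hx
                exact (Z i).add_mem (h1 y hy) (hZa i hu)
              · refine le_trans (Finset.card_le_card ?_) h2
                intro z hz
                obtain ⟨x, hx, rfl⟩ := Finset.mem_image.mp hz
                obtain ⟨y, hy, rfl⟩ := Finset.mem_image.mp hx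
                have : π (y + u) = π y := by rw [eq_comm, hπ]; simpa using hu
                rw [this]; exact Finset.mem_image_of_mem _ hy
              · rw [← Finset.image_union]; exact Finset.image_subset_image h4
            · rintro A ⟨U₁, W₁, h1, h2, h3, h4⟩
              exact hsub _ _ h4 (ihg U₁ h1 h2 W₁ h3)
          apply htr _ (-u)
          let U2 := U.filter (fun x => π x = π u)
          let U1 := U.filter (fun x => π x ≠ π u)
          have huZ := hU u hu
          have hG := ih' w' hw' (U2.image (· + -u)) (by
            intro x hx
            obtain ⟨y, hy, rfl⟩ := Finset.mem_image.mp hx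
            have := (hπ _ _).mp (Finset.mem_filter.mp hy).2.symm
            simpa [add_comm] using this) ((U1.image (· + -u)) ∪ W.image (· + -u)) (by
            refine ⟨_, _, ?_, ?_, hw.tr W hW _ ((Z i).neg_mem huZ), Finset.Subset.refl _⟩
            · intro x hx
              obtain ⟨y, hy, rfl⟩ := Finset.mem_image.mp hx
              exact (Z i).add_mem (hU y (Finset.mem_filter.mp hy).1) ((Z i).neg_mem huZ)
            · have e : (U1.image (· + -u)).image π = (U1.image π).image (· + π (-u)) := by
                rw [Finset.image_image, Finset.image_image]; rfl
              rw [e]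
              refine Finset.card_image_le.trans ?_
              have : U1.image π ⊆ (U.image π).erase (π u) := by
                intro z hz
                obtain ⟨x, hx, rfl⟩ := Finset.mem_image.mp hz
                have := Finset.mem_filter.mp hx
                exact Finset.mem_erase.mpr ⟨this.2, Finset.mem_image_of_mem _ this.1⟩
              have h1 := Finset.card_le_card this
              rw [Finset.card_erase_of_mem (Finset.mem_image_of_mem _ hu)] at h1
              omega)
          refine hsub _ _ ?_ hG
          intro x hx
          obtain ⟨y, hy, rfl⟩ := Finset.mem_image.mp hx
          rcases Finset.mem_union.mp hy with hy | hy
          · by_cases h : π y = π u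
            · exact Finset.mem_union_left _ (Finset.mem_image_of_mem _ (Finset.mem_filter.mpr ⟨hy, h⟩))
            · exact Finset.mem_union_right _ (Finset.mem_union_left _ (Finset.mem_image_of_mem _ (Finset.mem_filter.mpr ⟨hy, h⟩)))
          · exact Finset.mem_union_right _ (Finset.mem_union_right _ (Finset.mem_image_of_mem _ hy))
      intro U hU W hW
      exact main _ U hU le_rfl W hW
  intro U
  have := key k 0 (by omega) (fun W => W = ∅) ⟨by
      rintro A B h rfl; exact Finset.subset_empty.mp h, by rintro A rfl h h'; simp, by rintro A rfl u _; simp, by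
      rintro A rfl; exact hsub _ _ (Finset.empty_subset _) hbase⟩ U (fun u _ => hZ0 u) ∅ rfl
  rwa [Finset.union_empty] at this
end pet

section hilb
variable {H : Type*} [NormedAddCommGroup H] [InnerProductSpace ℝ H] {Q : Type*} [AddCommGroup Q] [Module ℝ Q]

theorem unip (U : Q → H →ₗᵢ[ℝ] H) (K : H →ₗᵢ[ℝ] H) (R : Q →ₗ[ℝ] Q) (hU : ∀ s s' x, U (s + s') x = U s (U s' x))
    (hK : ∀ s x, U s (K x) = K (U (s + R s) x)) (p : H) (hp : K p = p)
    (hc : ∀ s, Tendsto (fun n : ℕ => U (((n : ℝ))⁻¹ • s) p) atTop (𝓝 p)) (j : ℕ) :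
    ∀ s, (R ^ j) s = 0 → U (R s) p = p := by
  have hU0 : ∀ x, U 0 x = x := fun x => (U 0).injective (by rw [← hU, add_zero])
  induction j with
  | zero => intro s hs; rw [show s = 0 from hs, map_zero, hU0]
  | succ j ih =>
    intro s hs
    have h1 : ∀ c : ℝ, U (c • R (R s)) p = p := fun c => by
      rw [← map_smul]
      refine ih (c • R s) ?_
      rw [map_smul, ← Module.End.mul_apply, ← pow_succ, hs, smul_zero]
    have h2 : ∀ (ε : ℝ) (n : ℕ), U (ε • s) p = K^[n] (U (ε • s + (n * ε) • R s) p) := by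
      intro ε n
      induction n with
      | zero => simp
      | succ n ihn =>
        rw [ihn, Function.iterate_succ_apply]
        congr 1
        conv_lhs => rw [← hp]
        rw [hK]
        congr 1
        have e : ε • s + (n * ε) • R s + R (ε • s + (n * ε) • R s) = (ε • s + ((n + 1 : ℕ) * ε) • R s) + (n * ε) • R (R s) := by
          rw [map_add, map_smul, map_smul]; push_cast; module
        rw [e, hU, h1]
    have hKn : ∀ n x y, ‖K^[n] x - K^[n] y‖ = ‖x - y‖ := by
      intro n
      induction n with
      | zero => intro x y; rfl
      | succ n ihn => intro x y; rw [Function.iterate_succ_apply, Function.iterate_succ_apply, ihn, ← map_sub, K.norm_map]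
    have hKp : ∀ n, K^[n] p = p := fun n => Function.iterate_fixed hp n
    have h3 : ∀ n : ℕ, 0 < n → ‖U (R s) p - p‖ ≤ 2 * ‖U (((n : ℝ))⁻¹ • s) p - p‖ := by
      intro n hn
      have e := h2 ((n : ℝ)⁻¹) n
      rw [mul_inv_cancel₀ (by positivity), one_smul] at e
      have e2 : ‖U ((n : ℝ)⁻¹ • s + R s) p - p‖ = ‖U ((n : ℝ)⁻¹ • s) p - p‖ := by
        rw [← hKn n, ← e, hKp]
      have e3 : ‖U (R s) p - p‖ = ‖U ((n : ℝ)⁻¹ • s + R s) p - U ((n : ℝ)⁻¹ • s) p‖ := by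
        rw [hU, ← map_sub, LinearIsometry.norm_map]
      rw [e3]
      have := norm_sub_le_norm_sub_add_norm_sub (U ((n : ℝ)⁻¹ • s + R s) p) p (U ((n : ℝ)⁻¹ • s) p)
      rw [e2, norm_sub_rev p] at this
      linarith
    have h4 : Tendsto (fun n : ℕ => 2 * ‖U (((n : ℝ))⁻¹ • s) p - p‖) atTop (𝓝 0) := by
      have := ((hc s).sub_const p).norm.const_mul 2
      simpa using this
    have h5 : ‖U (R s) p - p‖ ≤ 0 := ge_of_tendsto h4 ((eventually_gt_atTop 0).mono h3)
    exact sub_eq_zero.mp (norm_le_zero_iff.mp h5)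

theorem mean_erg [CompleteSpace H] (K : H →ₗᵢ[ℝ] H) (x : H) : ∃ p, K p = p ∧ inner ℝ p x = inner ℝ p p ∧
    Tendsto (fun n : ℕ => (n : ℝ)⁻¹ • ∑ i ∈ Finset.range n, K^[i] x) atTop (𝓝 p) := by
  let f : H →L[ℝ] H := K.toContinuousLinearMap
  have hf : ‖f‖ ≤ 1 := K.norm_toContinuousLinearMap_le
  have h := f.tendsto_birkhoffAverage_orthogonalProjection hf x
  generalize hy : (f.eqLocus (1 : H →L[ℝ] H)).orthogonalProjectionOnto x = y at h
  have hy2 : f (y : H) = (y : H) := y.2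
  refine ⟨(y : H), hy2, ?_, h⟩
  have h3 := (f.eqLocus (1 : H →L[ℝ] H)).starProjection_inner_eq_zero x y y.2
  rw [Submodule.starProjection_apply, hy, inner_sub_left, sub_eq_zero, real_inner_comm] at h3
  exact h3
end hilb
end Sz

/-! Part 13 -/

namespace Sz
open Topology

/-- functions continuous along the flow -/
def CC (X : Sys) : Subalgebra ℝ (Bd X.Ω) where
  carrier := {f | ∀ ε > 0, ∀ᶠ s in 𝓝 (0:ℝ), X.m.d2 (X.tr s f) f ≤ ε}
  mul_mem' := by
    intro f g hf hg ε hε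
    obtain ⟨C, hC0, hC⟩ := f.bound
    obtain ⟨D, hD0, hD⟩ := g.bound
    filter_upwards [hf (ε / (4 * D ^ 2)) (by positivity), hg (ε / (4 * C ^ 2)) (by positivity)] with s h1 h2
    have a := X.m.d2_tri (X.tr s (f * g)) (f * X.tr s g) (f * g)
    have b := X.m.d2_mul (X.tr s g) g f hC
    have c := X.m.d2_mul (X.tr s f) f (X.tr s g) (C := D) (fun ω => hD _)
    rw [mul_comm _ f, mul_comm _ f] at b
    rw [map_mul] at a ⊢
    have h1' := mul_le_mul_of_nonneg_left h1 (show 0 ≤ D ^ 2 by positivity)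
    have h2' := mul_le_mul_of_nonneg_left h2 (show 0 ≤ C ^ 2 by positivity)
    have e1 : C ^ 2 * (ε / (4 * C ^ 2)) = ε / 4 := by field_simp
    have e2 : D ^ 2 * (ε / (4 * D ^ 2)) = ε / 4 := by field_simp
    linarith
  add_mem' := by
    intro f g hf hg ε hε
    filter_upwards [hf (ε / 4) (by positivity), hg (ε / 4) (by positivity)] with s h1 h2
    have a := X.m.d2_tri (X.tr s (f + g)) (f + X.tr s g) (f + g)
    have b : X.m.d2 (X.tr s (f + g)) (f + X.tr s g) = X.m.d2 (X.tr s f) f := by unfold Mean.d2; rw [map_add]; congr 1; ring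
    have c : X.m.d2 (f + X.tr s g) (f + g) = X.m.d2 (X.tr s g) g := by unfold Mean.d2; congr 1; ring
    linarith
  algebraMap_mem' r := fun ε hε => Eventually.of_forall fun s => by
    rw [AlgHom.commutes]; simp [Mean.d2, hε.le]

theorem clo_CC (X : Sys) : Clo X.m (CC X) := by
  intro f hf ε hε
  obtain ⟨g, hg, h1⟩ := hf (ε / 12) (by positivity)
  filter_upwards [hg (ε / 12) (by positivity)] with s h2
  have a := X.m.d2_tri (X.tr s f) (X.tr s g) f
  have b := X.m.d2_tri (X.tr s g) g f
  rw [X.d2_tr] at a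
  rw [X.m.d2_comm g f] at b
  linarith

theorem tinv_CC (X : Sys) : X.TInv (CC X) := by
  intro r f hf ε hε
  filter_upwards [hf ε hε] with s h
  rw [X.tr_tr, add_comm, ← X.tr_tr, X.d2_tr]; exact h

/-- parameter spaces -/
structure Par where
  Q : Type
  [g : AddCommGroup Q]
  [mod : Module ℝ Q]
  N : Q →ₗ[ℝ] Q
  b : Q
  mQ : Mean Q
  inv : ∀ (s : Q) (f : Bd Q), mQ (Bd.comp (fun d => d + s) f) = mQ f
  invN : ∀ (f : Bd Q), mQ (Bd.comp N f) = mQ f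
  k : ℕ
  nil : (N - 1) ^ k = 0
  surj : ∀ d, ∃ (t : ℝ) (d' : Q), N d' - d' + t • b = d

attribute [instance] Par.g Par.mod

section
variable (Y : Par)

abbrev Par.P : Type := ℝ × Y.Q
abbrev Par.V : Type := Y.Q →ₗ[ℝ] ℝ
def Par.stp (p : Y.P) : Y.P := (p.1, Y.N p.2 + p.1 • Y.b)

noncomputable def Par.mP : Mean Y.P := EE.prod Y.mQ

theorem Par.mP_add (s : Y.P) (f : Bd Y.P) : Y.mP (Bd.comp (fun p => p + s) f) = Y.mP f := by
  unfold Par.mP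
  rw [Mean.prod_apply, Mean.prod_apply, ← EE_add s.1 (Y.mQ.part f)]
  congr 1; ext t
  show Y.mQ _ = Y.mQ _
  exact Y.inv s.2 (Bd.comp (fun d => (t + s.1, d)) f)

theorem Par.mP_stp (f : Bd Y.P) : Y.mP (Bd.comp Y.stp f) = Y.mP f := by
  unfold Par.mP
  rw [Mean.prod_apply, Mean.prod_apply]
  congr 1; ext t
  show Y.mQ _ = Y.mQ _
  rw [← Y.inv (t • Y.b) (Bd.comp (fun d => (t, d)) f), ← Y.invN (Bd.comp (fun d => d + t • Y.b) (Bd.comp (fun d => (t, d)) f))]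
  rfl

/-- the translation vector of the n-th step -/
def Par.bn (n : ℕ) : Y.Q := (Y.stp^[n] (1, 0)).2
theorem Par.stp_it (n : ℕ) (t : ℝ) (d : Y.Q) : Y.stp^[n] (t, d) = (t, Y.N^[n] d + t • Y.bn n) := by
  have key : ∀ (n : ℕ), ∃ c : Y.Q, ∀ (t : ℝ) (d : Y.Q), Y.stp^[n] (t, d) = (t, Y.N^[n] d + t • c) := by
    intro n
    induction n with
    | zero => exact ⟨0, fun t d => by simp⟩
    | succ n ih =>
      obtain ⟨c, hc⟩ := ih
      refine ⟨Y.N c + Y.b, fun t d => ?_⟩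
      rw [Function.iterate_succ_apply', hc, Function.iterate_succ_apply']
      simp only [Par.stp, map_add, map_smul, smul_add, add_assoc]
  obtain ⟨c, hc⟩ := key n
  have h0 : Y.N^[n] 0 = 0 := Function.iterate_fixed (map_zero _) n
  have : Y.bn n = c := by unfold Par.bn; rw [hc, h0]; simp
  rw [hc, this]

noncomputable def Par.S : Y.V →+ Y.V := (Y.N.dualMap : (Y.Q →ₗ[ℝ] ℝ) →ₗ[ℝ] (Y.Q →ₗ[ℝ] ℝ)).toAddMonoidHom
theorem Par.S_apply (v : Y.V) (d : Y.Q) : Y.S v d = v (Y.N d) := rfl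
theorem Par.S_it (n : ℕ) (v : Y.V) (d : Y.Q) : Y.S^[n] v d = v (Y.N^[n] d) := by
  induction n generalizing d with
  | zero => rfl
  | succ n ih => rw [Function.iterate_succ_apply', Par.S_apply, ih, ← Function.iterate_succ_apply]

noncomputable def Par.avg (L : ℕ) (a : ℝ → Y.Q) : Bd Y.P →ₗ[ℝ] Bd ℝ :=
  (L : ℝ)⁻¹ • ∑ n ∈ Finset.range L, (Bd.comp (fun t => Y.stp^[n] (t, a t))).toLinearMap
theorem Par.avg_apply (L : ℕ) (a : ℝ → Y.Q) (Φ : Bd Y.P) (t : ℝ) :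
    Y.avg L a Φ t = (L : ℝ)⁻¹ * ∑ n ∈ Finset.range L, Φ (Y.stp^[n] (t, a t)) := by
  unfold Par.avg
  rw [LinearMap.smul_apply, Bd.smul_apply, LinearMap.sum_apply, Bd.sum_apply]
  rfl

noncomputable def Par.lam : Bd Y.P →ₗ[ℝ] Bd ℝ := Y.mQ.part
theorem Par.lam_apply (Φ : Bd Y.P) (t : ℝ) : Y.lam Φ t = Y.mQ (Bd.comp (fun d => (t, d)) Φ) := rfl
theorem Par.EE_lam (Φ : Bd Y.P) : EE (Y.lam Φ) = Y.mP Φ := rfl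

/-- the comparison property -/
def Good (Φ : Bd Y.P) : Prop := ∀ a : ℕ → ℝ → Y.Q,
  Tendsto (fun L : ℕ => EE (Y.avg L (a L) Φ - Y.lam Φ).abs) atTop (𝓝 0)

theorem Good.add {Φ Ψ : Bd Y.P} (h : Good Y Φ) (h' : Good Y Ψ) : Good Y (Φ + Ψ) := by
  intro a
  have := (h a).add (h' a)
  rw [add_zero] at this
  refine squeeze_zero (fun L => EE.nonneg fun t => abs_nonneg _) (fun L => ?_) this
  rw [← map_add]
  refine EE.mono fun t => ?_
  simp only [map_add, Bd.abs_apply, Bd.add_apply, Bd.sub_apply]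
  refine le_trans (le_of_eq ?_) (abs_add_le _ _)
  congr 1; ring

theorem Good.smul {Φ : Bd Y.P} (c : ℝ) (h : Good Y Φ) : Good Y (c • Φ) := by
  intro a
  have := (h a).const_mul |c|
  rw [mul_zero] at this
  refine this.congr fun L => ?_
  rw [← EE.smul']
  congr 1; ext t
  simp only [map_smul, Bd.abs_apply, Bd.smul_apply, Bd.sub_apply]
  rw [← abs_mul, mul_sub]

theorem Good.zero : Good Y 0 := by
  intro a
  refine tendsto_const_nhds.congr fun L => ?_
  simp only [map_zero, sub_zero]
  rw [show (Bd.abs (0 : Bd ℝ)) = 0 from by ext t; simp, map_zero]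

theorem Good.sum {ι : Type*} (s : Finset ι) (Φ : ι → Bd Y.P) (h : ∀ i ∈ s, Good Y (Φ i)) : Good Y (∑ i ∈ s, Φ i) := by
  classical
  induction s using Finset.induction_on with
  | empty => simpa using Good.zero Y
  | insert i s hi ih =>
    rw [Finset.sum_insert hi]
    exact (h i (Finset.mem_insert_self _ _)).add Y (ih fun j hj => h j (Finset.mem_insert_of_mem hj))

theorem Good.lim {Φ : Bd Y.P} (h : Good Y Φ) (a : ℕ → ℝ → Y.Q) : Tendsto (fun L : ℕ => EE (Y.avg L (a L) Φ)) atTop (𝓝 (Y.mP Φ)) := by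
  rw [tendsto_iff_norm_sub_tendsto_zero]
  refine squeeze_zero (fun L => norm_nonneg _) (fun L => ?_) (h a)
  rw [← Y.EE_lam, ← map_sub]
  exact EE.abs_le_abs _

variable (X : Sys)
/-- the product attached to a family of forms -/
def prA {J : Type} [Fintype J] (v : J → Y.V) (c : J → ℝ) (f : J → Bd X.Ω) : Bd (Y.P × X.Ω) :=
  ∏ j, X.act (fun p : Y.P => v j p.2 + c j * p.1) (f j)
noncomputable def Phi {J : Type} [Fintype J] (v : J → Y.V) (c : J → ℝ) (f : J → Bd X.Ω) : Bd Y.P := X.m.part (prA Y X v c f)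

variable {J : Type} [Fintype J] (v : J → Y.V) (c : J → ℝ) (f : J → Bd X.Ω)
theorem prA_apply (p : Y.P × X.Ω) : prA Y X v c f p = ∏ j, f j (X.T (v j p.1.2 + c j * p.1.1) p.2) := by
  unfold prA; rw [Bd.prod_apply]; rfl
theorem Phi_apply (p : Y.P) : Phi Y X v c f p = X.m (∏ j, X.tr (v j p.2 + c j * p.1) (f j)) := by
  unfold Phi prA
  show X.m (Bd.comp (fun ω => (p, ω)) _) = _
  rw [map_prod]; rfl
theorem prA_le (h : ∀ j ω, |f j ω| ≤ 1) (p : Y.P × X.Ω) : |prA Y X v c f p| ≤ 1 := by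
  rw [prA_apply, Finset.abs_prod]
  exact Finset.prod_le_one (fun j _ => abs_nonneg _) (fun j _ => h j _)

theorem prA_stp (n : ℕ) : Bd.comp (fun q : Y.P × X.Ω => (Y.stp^[n] q.1, q.2)) (prA Y X v c f)
    = prA Y X (fun j => Y.S^[n] (v j)) (fun j => v j (Y.bn n) + c j) f := by
  ext ⟨⟨t, d⟩, ω⟩
  rw [Bd.comp_apply, prA_apply, prA_apply]
  refine Finset.prod_congr rfl fun j _ => ?_
  simp only [Y.stp_it, Y.S_it]
  congr 2
  rw [map_add, map_smul, smul_eq_mul]; ring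

theorem prA_mul {J' : Type} [Fintype J'] (v' : J' → Y.V) (c' : J' → ℝ) (f' : J' → Bd X.Ω) :
    prA Y X v c f * prA Y X v' c' f' = prA Y X (Sum.elim v v') (Sum.elim c c') (Sum.elim f f') := by
  unfold prA; rw [Fintype.prod_sum_type]; rfl

/-- goodness for all families with forms in a finite set -/
def GG (U : Finset Y.V) : Prop := ∀ (X : Sys) (J : Type) [Fintype J] (v : J → Y.V) (c : J → ℝ) (f : J → Bd X.Ω),
  (∀ j, v j ∈ U) → (∀ j, f j ∈ CC X) → (∀ j ω, |f j ω| ≤ 1) → Good Y (Phi Y X v c f)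

theorem GG_sub (U U' : Finset Y.V) (h : U ⊆ U') (hG : GG Y U') : GG Y U :=
  fun X J _ v c f hv hf hf1 => hG X J v c f (fun j => h (hv j)) hf hf1

open Classical in
theorem GG_tr (U : Finset Y.V) (u : Y.V) (hG : GG Y (U.image (· + u))) : GG Y U := by
  intro X J _ v c f hv hf hf1
  have := hG X J (fun j => v j + u) c f (fun j => Finset.mem_image_of_mem _ (hv j)) hf hf1
  have e : Phi Y X (fun j => v j + u) c f = Phi Y X v c f := by
    ext p
    rw [Phi_apply, Phi_apply, ← X.m_tr (u p.2) (∏ j, X.tr (v j p.2 + c j * p.1) (f j)), map_prod (X.tr (u p.2))]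
    congr 1
    refine Finset.prod_congr rfl fun j _ => ?_
    rw [X.tr_tr]
    congr 2
    rw [LinearMap.add_apply]; ring
  rwa [e] at this

theorem GG_base : GG Y {0} := by
  intro X J _ v c f hv hf hf1 a
  have h0 : ∀ t d, Phi Y X v c f (t, d) = Phi Y X v c f (t, 0) := by
    intro t d
    rw [Phi_apply, Phi_apply]
    congr 1
    refine Finset.prod_congr rfl fun j _ => ?_
    rw [Finset.mem_singleton.mp (hv j)]; simp
  refine Tendsto.congr' ?_ tendsto_const_nhds
  filter_upwards [eventually_gt_atTop 0] with L hL
  have : (Y.avg L (a L) (Phi Y X v c f) - Y.lam (Phi Y X v c f)).abs = 0 := by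
    ext t
    rw [Bd.abs_apply, Bd.sub_apply, Y.avg_apply, Y.lam_apply]
    have e1 : Bd.comp (fun d => (t, d)) (Phi Y X v c f) = algebraMap ℝ _ (Phi Y X v c f (t, 0)) := by
      ext d; exact h0 t d
    have e2 : ∀ n ∈ Finset.range L, Phi Y X v c f (Y.stp^[n] (t, a L t)) = Phi Y X v c f (t, 0) := by
      intro n _; rw [Y.stp_it]; exact h0 t _
    rw [e1, Y.mQ.const, Finset.sum_congr rfl e2, Finset.sum_const, Finset.card_range, nsmul_eq_mul]
    have : (L : ℝ) ≠ 0 := by positivity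
    rw [inv_mul_cancel_left₀ this]; simp
  rw [this, map_zero]
end
end Sz

/-! Part 14 -/

namespace Sz
open Topology

theorem prod_fst {P Ω : Type} (n : Mean P) (m : Mean Ω) (φ : P → P) (h : ∀ f, n (Bd.comp φ f) = n f) (F : Bd (P × Ω)) :
    n.prod m (Bd.comp (fun q => (φ q.1, q.2)) F) = n.prod m F := h (m.part F)

theorem prod_part_mono {P Ω : Type} (m : Mean Ω) (F : Bd (P × Ω)) (p : P) : (m.part F p) ^ 2 ≤ m.part (F * F) p := by
  rw [Mean.part_apply, Mean.part_apply, map_mul]; exact m.sq_le _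

theorem d2_act (X : Sys) {P : Type} (n : Mean P) (x : P → ℝ) (g g' : Bd X.Ω) :
    (n.prod X.m).d2 (X.act x g) (X.act x g') = X.m.d2 g g' := by
  unfold Mean.d2
  rw [← map_sub, ← map_mul, Mean.prod_apply]
  have : X.m.part (X.act x ((g - g') * (g - g'))) = algebraMap ℝ _ (X.m ((g - g') * (g - g'))) := by
    ext p; rw [Mean.part_apply, X.comp_act, X.m_tr]; rfl
  rw [this, n.const]

theorem tendsto_prod_d2 {Ω J : Type} (m : Mean Ω) (s : Finset J) (F : ℕ → J → Bd Ω) (G : J → Bd Ω)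
    (hF : ∀ n j ω, |F n j ω| ≤ 1) (hG : ∀ j ω, |G j ω| ≤ 1) (h : ∀ j, Tendsto (fun n => m.d2 (F n j) (G j)) atTop (𝓝 0)) :
    Tendsto (fun n => m.d2 (∏ j ∈ s, F n j) (∏ j ∈ s, G j)) atTop (𝓝 0) := by
  classical
  induction s using Finset.induction_on with
  | empty => simp [Mean.d2]
  | insert i s hi ih =>
    have h3 := ((h i).const_mul 2).add (ih.const_mul 2)
    simp only [mul_zero, add_zero] at h3
    refine squeeze_zero (fun n => m.d2_nonneg _ _) (fun n => ?_) h3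
    rw [Finset.prod_insert hi, Finset.prod_insert hi]
    have a := m.d2_tri (F n i * ∏ j ∈ s, F n j) (G i * ∏ j ∈ s, F n j) (G i * ∏ j ∈ s, G j)
    have hb : ∀ ω, |(∏ j ∈ s, F n j) ω| ≤ 1 := fun ω => by
      rw [Bd.prod_apply, Finset.abs_prod]
      exact Finset.prod_le_one (fun j _ => abs_nonneg _) (fun j _ => hF n j _)
    have b := m.d2_mul (F n i) (G i) (∏ j ∈ s, F n j) hb
    have c := m.d2_mul (∏ j ∈ s, F n j) (∏ j ∈ s, G j) (G i) (hG i)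
    rw [mul_comm _ (G i), mul_comm _ (G i)] at c
    linarith

theorem gns_sub_sq {Ω : Type} (m : Mean Ω) (f g : Bd Ω) : ‖gns m f - gns m g‖ ^ 2 = m.d2 f g := by
  rw [← map_sub, gns_norm_sq]; rfl

theorem gns_tendsto {Ω : Type} (m : Mean Ω) (F : ℕ → Bd Ω) (G : Bd Ω) (h : Tendsto (fun n => m.d2 (F n) G) atTop (𝓝 0)) :
    Tendsto (fun n => gns m (F n)) atTop (𝓝 (gns m G)) := by
  rw [tendsto_iff_norm_sub_tendsto_zero]
  have h2 := (Real.continuous_sqrt.tendsto 0).comp h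
  rw [Real.sqrt_zero] at h2
  refine h2.congr fun n => ?_
  simp only [Function.comp]
  rw [← gns_sub_sq, Real.sqrt_sq (norm_nonneg _)]

section
variable (Y : Par) (X : Sys)

noncomputable def MM : Mean (Y.P × X.Ω) := Y.mP.prod X.m
def sh (s : Y.P) : Bd (Y.P × X.Ω) →ₐ[ℝ] Bd (Y.P × X.Ω) := Bd.comp (fun q => (q.1 + s, q.2))
def kp (n : ℕ) : Bd (Y.P × X.Ω) →ₐ[ℝ] Bd (Y.P × X.Ω) := Bd.comp (fun q => (Y.stp^[n] q.1, q.2))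

theorem MM_sh (s : Y.P) (F : Bd (Y.P × X.Ω)) : MM Y X (sh Y X s F) = MM Y X F :=
  prod_fst Y.mP X.m (fun p => p + s) (Y.mP_add s) F
theorem sh_sh (s s' : Y.P) (F : Bd (Y.P × X.Ω)) : sh Y X s (sh Y X s' F) = sh Y X (s + s') F := by
  ext q; simp [sh, add_assoc]

variable {J : Type} [Fintype J] (v : J → Y.V) (c : J → ℝ) (f : J → Bd X.Ω)
theorem sh_prA (s : Y.P) : sh Y X s (prA Y X v c f) = prA Y X v c (fun j => X.tr (v j s.2 + c j * s.1) (f j)) := by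
  ext q
  unfold sh
  rw [Bd.comp_apply, prA_apply, prA_apply]
  refine Finset.prod_congr rfl fun j _ => ?_
  rw [X.tr_apply, ← X.T_add]
  congr 2
  simp only [Prod.fst_add, Prod.snd_add, map_add]; ring

theorem sh_prA_tendsto (hf : ∀ j, f j ∈ CC X) (hf1 : ∀ j ω, |f j ω| ≤ 1) (s : Y.P) :
    Tendsto (fun n : ℕ => gns (MM Y X) (sh Y X ((n : ℝ)⁻¹ • s) (prA Y X v c f))) atTop (𝓝 (gns (MM Y X) (prA Y X v c f))) := by
  refine gns_tendsto _ _ _ ?_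
  simp only [sh_prA]
  unfold prA
  refine tendsto_prod_d2 _ _ _ _ (fun n j ω => hf1 j _) (fun j ω => hf1 j _) fun j => ?_
  unfold MM
  simp only [d2_act]
  have h0 : Tendsto (fun n : ℕ => v j ((n : ℝ)⁻¹ • s).2 + c j * ((n : ℝ)⁻¹ • s).1) atTop (𝓝 0) := by
    have h1 : Tendsto (fun n : ℕ => (n : ℝ)⁻¹ * (v j s.2 + c j * s.1)) atTop (𝓝 (0 * (v j s.2 + c j * s.1))) :=
      (tendsto_inv_atTop_nhds_zero_nat (𝕜 := ℝ)).mul_const _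
    rw [zero_mul] at h1
    refine h1.congr fun n => ?_
    rw [Prod.smul_snd, Prod.smul_fst, map_smul, smul_eq_mul, smul_eq_mul]; ring
  rw [Metric.tendsto_atTop]
  intro ε hε
  obtain ⟨N, hN⟩ := eventually_atTop.mp (h0.eventually (hf j (ε / 2) (by positivity)))
  refine ⟨N, fun n hn => ?_⟩
  rw [Real.dist_eq, sub_zero, abs_of_nonneg (X.m.d2_nonneg _ _)]
  have := hN n hn
  linarith

/-- correlation of A with its shifts in the parameter direction -/
noncomputable def cor (A : Bd (Y.P × X.Ω)) : Bd Y.Q :=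
  (MM Y X).part (Bd.comp (fun z : Y.Q × (Y.P × X.Ω) => z.2) A * Bd.comp (fun z : Y.Q × (Y.P × X.Ω) => (z.2.1 + (0, z.1), z.2.2)) A)
theorem cor_apply (A : Bd (Y.P × X.Ω)) (s : Y.Q) : cor Y X A s = MM Y X (A * sh Y X (0, s) A) := by
  unfold cor
  rw [Mean.part_apply, map_mul]; rfl

theorem cor_inner (A : Bd (Y.P × X.Ω)) (s s' : Y.Q) :
    inner ℝ (gns (MM Y X) (sh Y X (0, s) A)) (gns (MM Y X) (sh Y X (0, s') A)) = cor Y X A (s' - s) := by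
  rw [gns_inner, cor_apply, ← MM_sh Y X (0, s) (A * sh Y X (0, s' - s) A), map_mul (sh Y X (0, s)), sh_sh]
  simp

theorem lamb0 (A B : Bd (Y.P × X.Ω)) (hB : ∀ s, sh Y X (0, s) B = B) :
    MM Y X (B * A) ^ 2 ≤ MM Y X (B * B) * Y.mQ (cor Y X A) := by
  have := hl Y.mQ Y.inv (fun s => gns (MM Y X) (sh Y X (0, s) A)) (cor Y X A) (cor_inner Y X A) (gns (MM Y X) B) (MM Y X (B * A))
    (fun s => by
      rw [gns_inner, ← MM_sh Y X (0, s) (B * A), map_mul (sh Y X (0, s)), hB])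
  rwa [gns_inner] at this

theorem cor_nonneg (A : Bd (Y.P × X.Ω)) : 0 ≤ Y.mQ (cor Y X A) := by
  have := lamb0 Y X A 1 (fun s => map_one _)
  simp only [one_mul, Mean.one] at this
  exact (sq_nonneg _).trans this

theorem lamb (A B : Bd (Y.P × X.Ω)) (hB : ∀ s, sh Y X (0, s) B = B) (hB1 : ∀ q, |B q| ≤ 1) :
    MM Y X (B * A) ^ 2 ≤ Y.mQ (cor Y X A) := by
  refine (lamb0 Y X A B hB).trans (mul_le_of_le_one_left (cor_nonneg Y X A) ((MM Y X).le_const fun q => ?_))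
  have := hB1 q
  rw [Bd.mul_apply]
  nlinarith [abs_le.mp this]

noncomputable def aH (H : ℕ) : Bd (Y.P × X.Ω) →ₗ[ℝ] Bd (Y.P × X.Ω) := (H : ℝ)⁻¹ • ∑ h ∈ Finset.range H, (kp Y X h).toLinearMap
theorem aH_eq (H : ℕ) (A : Bd (Y.P × X.Ω)) : aH Y X H A = (H : ℝ)⁻¹ • ∑ h ∈ Finset.range H, kp Y X h A := by
  unfold aH; rw [LinearMap.smul_apply, LinearMap.sum_apply]; rfl

theorem Par.stp_add (p s : Y.P) : Y.stp (p + s) = Y.stp p + Y.stp s := by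
  ext <;> simp [Par.stp, add_smul]; abel

/-- the nilpotent part of the step -/
noncomputable def Par.R : Y.P →ₗ[ℝ] Y.P :=
  LinearMap.prod 0 ((Y.N - 1) ∘ₗ LinearMap.snd ℝ ℝ Y.Q + (LinearMap.toSpanSingleton ℝ Y.Q Y.b) ∘ₗ LinearMap.fst ℝ ℝ Y.Q)
theorem Par.R_apply (s : Y.P) : Y.R s = (0, Y.N s.2 - s.2 + s.1 • Y.b) := by
  simp [Par.R, LinearMap.prod_apply]
theorem Par.stp_R (s : Y.P) : Y.stp s = s + Y.R s := by
  rw [Y.R_apply]; ext <;> simp [Par.stp]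
  abel
theorem Par.R_pow (j : ℕ) (d : Y.Q) : (Y.R ^ j) (0, d) = (0, ((Y.N - 1) ^ j) d) := by
  induction j generalizing d with
  | zero => simp
  | succ j ih =>
    rw [pow_succ, Module.End.mul_apply, Y.R_apply, pow_succ, Module.End.mul_apply]
    simp only [zero_smul, add_zero]
    rw [ih]; rfl
theorem Par.R_nil (s : Y.P) : (Y.R ^ (Y.k + 1)) s = 0 := by
  rw [pow_succ, Module.End.mul_apply, Y.R_apply, Y.R_pow, Y.nil]; rfl

theorem erg (hf : ∀ j, f j ∈ CC X) (hf1 : ∀ j ω, |f j ω| ≤ 1) : ∃ r ≤ Y.mQ (cor Y X (prA Y X v c f)),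
    Tendsto (fun H : ℕ => MM Y X (aH Y X H (prA Y X v c f) * aH Y X H (prA Y X v c f))) atTop (𝓝 r) := by
  set A := prA Y X v c f with hA
  set M := MM Y X with hM
  obtain ⟨K, hK⟩ := exists_koop M (fun q => (Y.stp q.1, q.2)) (prod_fst Y.mP X.m Y.stp Y.mP_stp)
  choose U hU using fun s : Y.P => exists_koop M (fun q => (q.1 + s, q.2)) (prod_fst Y.mP X.m (fun p => p + s) (Y.mP_add s))
  obtain ⟨p, hp1, hp2, hp3⟩ := mean_erg K (gns M A)
  have hKi : ∀ i, K^[i] (gns M A) = gns M (kp Y X i A) := by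
    intro i
    induction i with
    | zero => rfl
    | succ i ih =>
      rw [Function.iterate_succ_apply', ih, hK]; congr 1
  have hAH : ∀ H : ℕ, (H:ℝ)⁻¹ • ∑ i ∈ Finset.range H, K^[i] (gns M A) = gns M (aH Y X H A) := by
    intro H
    rw [aH_eq, map_smul, map_sum]
    simp only [hKi]
  simp only [hAH] at hp3
  have hUU : ∀ s s' x, U (s + s') x = U s (U s' x) := by
    intro s s'
    refine congrFun ((gns_dense M).equalizer (U (s + s')).continuous ((U s).continuous.comp (U s').continuous) ?_)
    funext g
    simp only [Function.comp, hU]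
    congr 1
    ext q; simp [add_assoc]
  have hUK : ∀ s x, U s (K x) = K (U (s + Y.R s) x) := by
    intro s
    refine congrFun ((gns_dense M).equalizer ((U s).continuous.comp K.continuous) (K.continuous.comp (U (s + Y.R s)).continuous) ?_)
    funext g
    simp only [Function.comp, hU, hK]
    congr 1
    ext q; simp only [Bd.comp_apply, Y.stp_add, Y.stp_R s]
  have hc0 : ∀ s (H : ℕ), Tendsto (fun n : ℕ => U ((n : ℝ)⁻¹ • s) (gns M (aH Y X H A))) atTop (𝓝 (gns M (aH Y X H A))) := by
    intro s H
    rw [aH_eq, map_smul, map_sum]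
    simp only [map_smul, map_sum, hU]
    refine Tendsto.const_smul (tendsto_finset_sum _ fun h _ => ?_) _
    unfold kp
    rw [hA, prA_stp]
    exact sh_prA_tendsto Y X _ _ f hf hf1 s
  have hc : ∀ s, Tendsto (fun n : ℕ => U ((n : ℝ)⁻¹ • s) p) atTop (𝓝 p) := by
    intro s
    rw [Metric.tendsto_atTop]
    intro ε hε
    obtain ⟨H, hH⟩ := ((Metric.tendsto_atTop.mp hp3) (ε / 3) (by positivity))
    have hH := hH H le_rfl
    obtain ⟨n0, hn0⟩ := (Metric.tendsto_atTop.mp (hc0 s H)) (ε / 3) (by positivity)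
    refine ⟨n0, fun n hn => ?_⟩
    have a := hn0 n hn
    have b := (U ((n : ℝ)⁻¹ • s)).dist_map p (gns M (aH Y X H A))
    rw [dist_comm p] at b
    have c1 := dist_triangle (U ((n : ℝ)⁻¹ • s) p) (U ((n : ℝ)⁻¹ • s) (gns M (aH Y X H A))) p
    have c2 := dist_triangle (U ((n : ℝ)⁻¹ • s) (gns M (aH Y X H A))) (gns M (aH Y X H A)) p
    linarith
  have hfix : ∀ d : Y.Q, U (0, d) p = p := by
    intro d
    obtain ⟨t, d', h⟩ := Y.surj d
    have := unip U K Y.R hUU hUK p hp1 hc (Y.k + 1) (t, d') (Y.R_nil _)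
    rwa [Y.R_apply, h] at this
  have key := hl Y.mQ Y.inv (fun s => gns M (sh Y X (0, s) A)) (cor Y X A) (cor_inner Y X A) p (inner ℝ p p)
    (fun s => by
      have : gns M (sh Y X (0, s) A) = U (0, s) (gns M A) := (hU _ _).symm
      rw [this]
      conv_lhs => rw [← hfix s]
      rw [LinearIsometry.inner_map_map, hp2])
  refine ⟨inner ℝ p p, ?_, ?_⟩
  · rcases (real_inner_self_nonneg (x := p)).eq_or_lt with h | h
    · rw [← h]; exact cor_nonneg Y X A
    · rw [sq] at key; exact le_of_mul_le_mul_left key h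
  · have := (hp3.inner hp3 : Tendsto _ _ (𝓝 (inner ℝ p p)))
    simpa only [gns_inner] using this

end
end Sz

/-! Part 15 -/

namespace Sz
open Topology

theorem shift_sum (φ : ℕ → ℝ) (hφ : ∀ n, |φ n| ≤ 1) (L h : ℕ) :
    |∑ n ∈ Finset.range L, φ n - ∑ n ∈ Finset.range L, φ (n + h)| ≤ 2 * h := by
  have e1 := Finset.sum_range_add φ L h
  have e2 := Finset.sum_range_add φ h L
  have e3 : ∑ n ∈ Finset.range L, φ n - ∑ n ∈ Finset.range L, φ (n + h) =
      ∑ n ∈ Finset.range h, φ n - ∑ n ∈ Finset.range h, φ (L + n) := by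
    rw [Finset.sum_congr rfl (fun n _ => by rw [add_comm n h] : ∀ n ∈ Finset.range L, φ (n + h) = φ (h + n))]
    rw [add_comm h L] at e2
    linarith
  have b : ∀ ψ : ℕ → ℝ, (∀ n, |ψ n| ≤ 1) → |∑ n ∈ Finset.range h, ψ n| ≤ h := fun ψ hψ =>
    (Finset.abs_sum_le_sum_abs _ _).trans ((Finset.sum_le_sum fun n _ => hψ n).trans (by simp))
  rw [e3]
  have := abs_sub (∑ n ∈ Finset.range h, φ n) (∑ n ∈ Finset.range h, φ (L + n))
  have := b _ hφ
  have := b _ (fun n => hφ (L + n))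
  linarith

section
variable (Y : Par) (X : Sys)
variable {J : Type} [Fintype J] (v : J → Y.V) (c : J → ℝ) (f : J → Bd X.Ω)

theorem avg_sq (L : ℕ) (a : ℝ → Y.Q) (Φ : Bd Y.P) (t : ℝ) : (Y.avg L a Φ t) ^ 2 ≤ Y.avg L a (Φ * Φ) t := by
  rw [Y.avg_apply, Y.avg_apply]
  rcases L.eq_zero_or_pos with rfl | hL
  · simp
  have hL' : (0:ℝ) < L := by exact_mod_cast hL
  have := sq_sum_le_card_mul_sum_sq (s := Finset.range L) (f := fun n => Φ (Y.stp^[n] (t, a t)))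
  rw [Finset.card_range] at this
  rw [mul_pow]
  calc _ ≤ ((L:ℝ)⁻¹) ^ 2 * (L * ∑ n ∈ Finset.range L, Φ (Y.stp^[n] (t, a t)) ^ 2) := by gcongr
    _ = _ := by
      simp only [← sq, Bd.pow_apply]
      field_simp

theorem avg_mono (L : ℕ) (a : ℝ → Y.Q) {Φ Ψ : Bd Y.P} (h : ∀ p, Φ p ≤ Ψ p) (t : ℝ) : Y.avg L a Φ t ≤ Y.avg L a Ψ t := by
  rw [Y.avg_apply, Y.avg_apply]
  gcongr with n hn
  exact h _

theorem avg_le (L : ℕ) (a : ℝ → Y.Q) {Φ : Bd Y.P} {C : ℝ} (hC : 0 ≤ C) (h : ∀ p, |Φ p| ≤ C) (t : ℝ) : |Y.avg L a Φ t| ≤ C := by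
  rw [Y.avg_apply]
  rcases L.eq_zero_or_pos with rfl | hL
  · simpa using hC
  have hL' : (0:ℝ) < L := by exact_mod_cast hL
  rw [abs_mul, abs_of_pos (inv_pos.mpr hL'), inv_mul_le_iff₀ hL']
  exact (Finset.abs_sum_le_sum_abs _ _).trans ((Finset.sum_le_sum fun n _ => h _).trans (by simp))

/-- the averaged square is good -/
theorem good_aH (W : Finset Y.V) (hv : ∀ j, v j ∈ W) [DecidableEq Y.V]
    (hW : ∀ h h' : ℕ, GG Y (W.image (Y.S^[h]) ∪ W.image (Y.S^[h']))) (hf : ∀ j, f j ∈ CC X) (hf1 : ∀ j ω, |f j ω| ≤ 1) (H : ℕ) :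
    Good Y (X.m.part (aH Y X H (prA Y X v c f) * aH Y X H (prA Y X v c f))) := by
  rw [aH_eq, smul_mul_assoc, mul_smul_comm, map_smul, map_smul, Finset.sum_mul_sum, map_sum]
  refine Good.smul Y _ (Good.smul Y _ (Good.sum Y _ _ fun h _ => ?_))
  rw [map_sum]
  refine Good.sum Y _ _ fun h' _ => ?_
  unfold kp
  rw [prA_stp, prA_stp, prA_mul]
  refine hW h h' X (J ⊕ J) _ _ _ ?_ ?_ ?_
  · rintro (j | j)
    · exact Finset.mem_union_left _ (Finset.mem_image_of_mem _ (hv j))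
    · exact Finset.mem_union_right _ (Finset.mem_image_of_mem _ (hv j))
  · rintro (j | j) <;> exact hf j
  · rintro (j | j) <;> exact hf1 j

theorem rho (W : Finset Y.V) (hv : ∀ j, v j ∈ W) [DecidableEq Y.V]
    (hW : ∀ h h' : ℕ, GG Y (W.image (Y.S^[h]) ∪ W.image (Y.S^[h']))) (hf : ∀ j, f j ∈ CC X) (hf1 : ∀ j ω, |f j ω| ≤ 1)
    (B : Bd (Y.P × X.Ω)) (hB : ∀ t d d' ω, B ((t, d), ω) = B ((t, d'), ω)) (hB1 : ∀ q, |B q| ≤ 1)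
    (σ : ℕ → Bd ℝ) (hσ : ∀ L t, |σ L t| ≤ 1) (a : ℕ → ℝ → Y.Q) (U : Ultrafilter ℕ) (hU : (U : Filter ℕ) ≤ atTop)
    (ρ : ℝ) (hρ : Tendsto (fun L => EE (σ L * Y.avg L (a L) (X.m.part (B * prA Y X v c f)))) U (𝓝 ρ)) :
    ρ ^ 2 ≤ Y.mQ (cor Y X (prA Y X v c f)) := by
  obtain ⟨r, hr, hlim⟩ := erg Y X v c f hf hf1
  refine le_trans ?_ hr
  refine ge_of_tendsto hlim ?_
  filter_upwards [eventually_gt_atTop 0] with H hH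
  have hG := good_aH Y X v c f W hv hW hf hf1 H
  have hA1 := prA_le Y X v c f hf1
  set A := prA Y X v c f with hA
  set Φ := X.m.part (B * A) with hΦ
  set ΦH := X.m.part (B * aH Y X H A) with hΦH
  have hΦ1 : ∀ p, |Φ p| ≤ 1 := fun p => X.m.abs_le fun ω => by
    rw [Bd.comp_apply, Bd.mul_apply, abs_mul]
    exact mul_le_one₀ (hB1 _) (abs_nonneg _) (hA1 _)
  have hH' : (0:ℝ) < H := by exact_mod_cast hH
  have e1 : ∀ p, ΦH p = (H:ℝ)⁻¹ * ∑ h ∈ Finset.range H, Φ (Y.stp^[h] p) := by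
    intro p
    have : B * aH Y X H A = (H:ℝ)⁻¹ • ∑ h ∈ Finset.range H, kp Y X h (B * A) := by
      rw [aH_eq, mul_smul_comm, Finset.mul_sum]
      congr 1
      refine Finset.sum_congr rfl fun h _ => ?_
      rw [map_mul]
      congr 1
      ext ⟨⟨t, d⟩, ω⟩
      show _ = B (Y.stp^[h] (t, d), ω)
      rw [Y.stp_it]; exact hB _ _ _ _
    rw [hΦH, this, map_smul, map_sum, Bd.smul_apply, Bd.sum_apply]
    rfl
  have e2 : ∀ L t, 0 < L → |Y.avg L (a L) Φ t - Y.avg L (a L) ΦH t| ≤ 2 * H / L := by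
    intro L t hL
    have hL' : (0:ℝ) < L := by exact_mod_cast hL
    rw [Y.avg_apply, Y.avg_apply]
    simp only [e1, ← Function.iterate_add_apply]
    set φ : ℕ → ℝ := fun n => Φ (Y.stp^[n] (t, a L t)) with hφ
    have e3 : (L:ℝ)⁻¹ * ∑ n ∈ Finset.range L, φ n - (L:ℝ)⁻¹ * ∑ n ∈ Finset.range L, ((H:ℝ)⁻¹ * ∑ h ∈ Finset.range H, φ (h + n))
        = (L:ℝ)⁻¹ * ((H:ℝ)⁻¹ * ∑ h ∈ Finset.range H, (∑ n ∈ Finset.range L, φ n - ∑ n ∈ Finset.range L, φ (n + h))) := by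
      rw [Finset.sum_sub_distrib, Finset.sum_const, Finset.card_range, nsmul_eq_mul, ← Finset.mul_sum, Finset.sum_comm]
      simp only [add_comm]
      field_simp
    rw [e3, abs_mul, abs_mul, abs_of_pos (inv_pos.mpr hL'), abs_of_pos (inv_pos.mpr hH')]
    have e4 : |∑ h ∈ Finset.range H, (∑ n ∈ Finset.range L, φ n - ∑ n ∈ Finset.range L, φ (n + h))| ≤ H * (2 * H) := by
      refine (Finset.abs_sum_le_sum_abs _ _).trans ((Finset.sum_le_sum (g := fun _ => (2 * H : ℝ)) fun h hh => ?_).trans (by simp))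
      refine (shift_sum φ (fun n => hΦ1 _) L h).trans ?_
      have : (h:ℝ) ≤ H := by exact_mod_cast (Finset.mem_range.mp hh).le
      linarith
    calc _ ≤ (L:ℝ)⁻¹ * ((H:ℝ)⁻¹ * (H * (2 * H))) := by gcongr
      _ = _ := by field_simp
  have e5 : Tendsto (fun L => EE (σ L * Y.avg L (a L) ΦH)) U (𝓝 ρ) := by
    have h0 : Tendsto (fun L : ℕ => EE (σ L * Y.avg L (a L) Φ) - EE (σ L * Y.avg L (a L) ΦH)) U (𝓝 0) := by
      refine squeeze_zero_norm' (a := fun L : ℕ => 2 * H / (L:ℝ)) ?_ ((tendsto_const_div_atTop_nhds_zero_nat _).mono_left hU)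
      filter_upwards [hU (eventually_gt_atTop 0)] with L hL
      rw [← map_sub, ← mul_sub, Real.norm_eq_abs]
      refine EE.abs_le fun t => ?_
      rw [Bd.mul_apply, abs_mul]
      have := e2 L t hL
      rw [Bd.sub_apply]
      calc _ ≤ 1 * (2 * H / (L:ℝ)) := mul_le_mul (hσ L t) this (abs_nonneg _) zero_le_one
        _ = _ := one_mul _
    have := hρ.sub h0
    simpa using this
  refine le_of_tendsto_of_tendsto (e5.pow 2) ((hG.lim Y a).mono_left hU) (Eventually.of_forall fun L => ?_)
  refine (EE.sq_le _).trans (EE.mono fun t => ?_)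
  have s1 : |σ L t| ^ 2 ≤ 1 := pow_le_one₀ (abs_nonneg _) (hσ L t)
  rw [sq_abs] at s1
  calc (σ L * Y.avg L (a L) ΦH * (σ L * Y.avg L (a L) ΦH)) t = σ L t ^ 2 * (Y.avg L (a L) ΦH t) ^ 2 := by
        simp only [Bd.mul_apply]; ring
    _ ≤ (Y.avg L (a L) ΦH t) ^ 2 := mul_le_of_le_one_left (sq_nonneg _) s1
    _ ≤ Y.avg L (a L) (ΦH * ΦH) t := avg_sq Y L _ _ t
    _ ≤ _ := avg_mono Y L _ (fun p => ?_) t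
  rw [Bd.mul_apply, ← sq]
  refine (prod_part_mono X.m _ p).trans (X.m.mono fun ω => ?_)
  simp only [Bd.comp_apply, Bd.mul_apply]
  have := hB1 (p, ω)
  have hb : B (p, ω) ^ 2 ≤ 1 := by rw [← sq_abs]; exact pow_le_one₀ (abs_nonneg _) this
  nlinarith [mul_self_nonneg (aH Y X H A (p, ω))]
end
end Sz

/-! Part 16 -/

namespace Sz
open Topology

/-- extension of a system by trivial coordinates -/
noncomputable def Sys.ext' (X : Sys) {Z : Type} (n : Mean Z) (U : Ultrafilter ℕ) (hU : (U : Filter ℕ) ≤ atTop) : Sys where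
  Ω := ℕ × (Z × X.Ω)
  m := (ultraMean U).prod (n.prod X.m)
  T s w := (w.1, w.2.1, X.T s w.2.2)
  T_zero w := by simp [X.T_zero]
  T_add s s' w := by simp [X.T_add]
  inv s F := by
    rw [Mean.prod_apply, Mean.prod_apply]
    congr 1; ext i
    exact prod_act X n (fun _ => s) (Bd.comp (fun w => (i, w)) F)
  cpl := L2C_prod U hU _

section
variable (X : Sys) {Z : Type} (n : Mean Z) (U : Ultrafilter ℕ) (hU : (U : Filter ℕ) ≤ atTop)

def Sys.emb : Bd (Z × X.Ω) →ₐ[ℝ] Bd (X.ext' n U hU).Ω := Bd.comp (fun w : ℕ × (Z × X.Ω) => w.2)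

theorem ext_m (F : Bd (Z × X.Ω)) : (X.ext' n U hU).m (X.emb n U hU F) = n.prod X.m F := by
  show (ultraMean U) ((n.prod X.m).part _) = _
  have : (n.prod X.m).part (Bd.comp (fun w : ℕ × (Z × X.Ω) => w.2) F) = algebraMap ℝ _ (n.prod X.m F) := by
    ext i; rfl
  exact (congrArg (ultraMean U) this).trans ((ultraMean U).const _)

theorem ext_CC (x : Z → ℝ) (f : Bd X.Ω) (hf : f ∈ CC X) : X.emb n U hU (X.act x f) ∈ CC (X.ext' n U hU) := by
  intro ε hε
  filter_upwards [hf ε hε] with s hs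
  have e : (X.ext' n U hU).tr s (X.emb n U hU (X.act x f)) = X.emb n U hU (X.act x (X.tr s f)) := by
    ext w
    show f (X.T (x w.2.1) (X.T s w.2.2)) = f (X.T s (X.T (x w.2.1) w.2.2))
    rw [← X.T_add, ← X.T_add, add_comm]
  rw [e]
  unfold Mean.d2
  rw [← map_sub, ← map_mul, ext_m]
  exact (d2_act X n x _ _).trans_le hs
end

section
variable (Y : Par) (X : Sys)
variable {J : Type} [Fintype J] [DecidableEq J] (v : J → Y.V) (c : J → ℝ) (f : J → Bd X.Ω)

theorem prA_update (j0 : J) (g : Bd X.Ω) : prA Y X v c (Function.update f j0 g) =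
    X.act (fun p : Y.P => v j0 p.2 + c j0 * p.1) g * ∏ j ∈ Finset.univ.erase j0, X.act (fun p : Y.P => v j p.2 + c j * p.1) (f j) := by
  unfold prA
  rw [← Finset.mul_prod_erase _ _ (Finset.mem_univ j0), Function.update_self]
  congr 1
  refine Finset.prod_congr rfl fun j hj => ?_
  rw [Function.update_of_ne (Finset.ne_of_mem_erase hj)]

theorem zinv (s0 : Y.Q) (p0 : Y.P) (F : Bd (Y.Q × Y.P)) :
    (Y.mQ.prod Y.mP) (Bd.comp (fun z : Y.Q × Y.P => (z.1 + s0, z.2 + p0)) F) = Y.mQ.prod Y.mP F := by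
  rw [Mean.prod_apply, Mean.prod_apply, ← Y.inv s0 (Y.mP.part F)]
  congr 1; ext s
  exact Y.mP_add p0 (Bd.comp (fun p => (s + s0, p)) F)

theorem dualD (U : Ultrafilter ℕ) (hU : (U : Filter ℕ) ≤ atTop) (hf : ∀ j, f j ∈ CC X) (hf1 : ∀ j ω, |f j ω| ≤ 1) (j0 : J)
    (v' : J → Y.V) (g : J → Bd X.Ω) (hg : ∀ j, g j ∈ CC X) (hg1 : ∀ j ω, |g j ω| ≤ 1) (h0 : v' j0 = v j0)
    (hvg : ∀ j, v' j = v j ∨ g j = 1) :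
    ∃ D ∈ CC X, X.m (D * g j0) = Y.mQ (cor Y X (prA Y X v' c g)) ∧ ∃ (X' : Sys) (F : J ⊕ J → Bd X'.Ω), (∀ j, F j ∈ CC X') ∧
      (∀ j ω, |F j ω| ≤ 1) ∧ Phi Y X v c (Function.update f j0 D) =
        Phi Y X' (Sum.elim (fun j => if j = j0 then 0 else v j) (fun _ => 0)) (Sum.elim (fun j => if j = j0 then 0 else c j) c) F := by
  set n : Mean (Y.Q × Y.P) := Y.mQ.prod Y.mP with hn
  let x0 : Y.P → ℝ := fun p => v j0 p.2 + c j0 * p.1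
  let x' : J → Y.P → ℝ := fun j p => v' j p.2 + c j * p.1
  let A0 : Bd (Y.P × X.Ω) := ∏ j ∈ Finset.univ.erase j0, X.act (x' j) (g j)
  set A := prA Y X v' c g with hA
  have hA1 : ∀ q, |A q| ≤ 1 := prA_le Y X v' c g hg1
  have hA01 : ∀ q, |A0 q| ≤ 1 := fun q => by
    rw [Bd.prod_apply, Finset.abs_prod]
    exact Finset.prod_le_one (fun j _ => abs_nonneg _) (fun j _ => hg1 j _)
  let E : Bd ((Y.Q × Y.P) × X.Ω) := Bd.comp (fun w => (w.1.2, w.2)) A0 * Bd.comp (fun w => (w.1.2 + (0, w.1.1), w.2)) A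
  have hE1 : ∀ w, |E w| ≤ 1 := fun w => by
    rw [Bd.mul_apply, abs_mul]; exact mul_le_one₀ (hA01 _) (abs_nonneg _) (hA1 _)
  let χ : Bd X.Ω →ₗ[ℝ] ℝ := {
    toFun := fun h => n.prod X.m (X.act (fun z => x0 z.2) h * E)
    map_add' := fun h h' => by rw [map_add, add_mul, map_add]
    map_smul' := fun r h => by rw [map_smul, smul_mul_assoc, map_smul]; rfl }
  have hχ : ∀ h, χ h = n.prod X.m (X.act (fun z => x0 z.2) h * E) := fun h => rfl
  have hχb : ∀ h ∈ CC X, |χ h| ≤ 1 * X.m h.abs := by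
    intro h _
    refine ((n.prod X.m).mul_bound _ E hE1).trans (le_of_eq ?_)
    congr 1
    have : (X.act (fun z : Y.Q × Y.P => x0 z.2) h).abs = X.act (fun z => x0 z.2) h.abs := rfl
    rw [this, Mean.prod_apply]
    have e : X.m.part (X.act (fun z : Y.Q × Y.P => x0 z.2) h.abs) = algebraMap ℝ _ (X.m h.abs) := by
      ext p; rw [Mean.part_apply, X.comp_act, X.m_tr]; rfl
    rw [e, n.const]
  obtain ⟨D, hD, hD1, hDχ⟩ := lemR X.cpl (clo_CC X) χ zero_le_one hχb
  refine ⟨D, hD, ?_, X.ext' n U hU, Sum.elim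
    (fun j => if j = j0 then 1 else X.emb n U hU (X.act (fun _ => 0) (f j) * X.act (fun z => x' j z.2 - x0 z.2) (g j)))
    (fun j => X.emb n U hU (X.act (fun z => x' j (z.2 + (0, z.1)) - x0 z.2) (g j))), ?_, ?_, ?_⟩
  · rw [hDχ _ (hg j0), hχ]
    have e : cor Y X A = Y.mP.part (X.m.part (X.act (fun z => x0 z.2) (g j0) * E)) := by
      ext s
      rw [cor_apply]
      show Y.mP _ = Y.mP _
      congr 1
      ext p
      show X.m _ = X.m _
      congr 1
      ext ω
      have : A = X.act x0 (g j0) * A0 := by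
        rw [hA]; unfold prA
        rw [← Finset.mul_prod_erase _ _ (Finset.mem_univ j0), h0]
      have h2 : A (p, ω) = X.act x0 (g j0) (p, ω) * A0 (p, ω) := by rw [this]; rfl
      show A (p, ω) * A (p + (0, s), ω) = X.act x0 (g j0) (p, ω) * (A0 (p, ω) * A (p + (0, s), ω))
      rw [h2]; ring
    rw [e]; rfl
  · rintro (j | j)
    · simp only [Sum.elim_inl]
      split_ifs
      · exact (CC _).one_mem
      · rw [map_mul]; exact (CC _).mul_mem (ext_CC X n U hU _ _ (hf j)) (ext_CC X n U hU _ _ (hg j))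
    · exact ext_CC X n U hU _ _ (hg j)
  · rintro (j | j) w
    · simp only [Sum.elim_inl]
      split_ifs
      · simp
      · show |f j _ * g j _| ≤ 1
        rw [abs_mul]; exact mul_le_one₀ (hf1 _ _) (abs_nonneg _) (hg1 _ _)
    · exact hg1 j _
  · ext p
    -- left side
    let hp : Bd X.Ω := ∏ j ∈ Finset.univ.erase j0, X.tr (v j p.2 + c j * p.1 - x0 p) (f j)
    have hpC : hp ∈ CC X := (CC X).prod_mem fun j _ => tinv_CC X _ _ (hf j)
    have e1 : Phi Y X v c (Function.update f j0 D) p = χ hp := by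
      rw [← hDχ _ hpC]
      unfold Phi
      rw [prA_update, Mean.part_apply, map_mul, map_prod, X.comp_act]
      show X.m (X.tr (x0 p) D * _) = _
      rw [X.m_tr_mul, map_prod]
      congr 2
      refine Finset.prod_congr rfl fun j _ => ?_
      rw [X.comp_act, X.tr_tr]; congr 2; ring
    rw [e1, hχ]
    rw [← prod_fst n X.m (fun z => (z.1 + (-p.2), z.2 + p)) (zinv Y (-p.2) p), ← prod_act X n (fun z => - x0 z.2), Phi_apply]
    rw [← ext_m X n U hU]
    congr 1
    ext w
    rw [Bd.prod_apply, Fintype.prod_sum_type, ← Finset.mul_prod_erase Finset.univ (fun j => _) (Finset.mem_univ j0)]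
    simp only [Sum.elim_inl, Sum.elim_inr, if_true]
    rw [map_one, Bd.one_apply, one_mul]
    obtain ⟨i, ⟨s, p'⟩, ω⟩ := w
    have hx0 : ∀ p p' : Y.P, x0 (p + p') = x0 p + x0 p' := fun p p' => by
      show v j0 (p.2 + p'.2) + c j0 * (p.1 + p'.1) = v j0 p.2 + c j0 * p.1 + (v j0 p'.2 + c j0 * p'.1)
      rw [map_add]; ring
    have hx' : ∀ j (p p' : Y.P), x' j (p + p') = x' j p + x' j p' := fun j p p' => by
      show v' j (p.2 + p'.2) + c j * (p.1 + p'.1) = v' j p.2 + c j * p.1 + (v' j p'.2 + c j * p'.1)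
      rw [map_add]; ring
    have L : (X.emb n U hU) (Bd.comp (fun p => (p.1, X.T (-x0 p.1.2) p.2)) (Bd.comp (fun q => ((q.1.1 + -p.2, q.1.2 + p), q.2))
        (X.act (fun z : Y.Q × Y.P => x0 z.2) hp * E))) (i, (s, p'), ω) =
        hp (X.T (x0 (p' + p)) (X.T (-x0 p') ω)) * (A0 (p' + p, X.T (-x0 p') ω) * A (p' + p + (0, s + -p.2), X.T (-x0 p') ω)) := rfl
    refine L.trans ?_
    have l1 : hp (X.T (x0 (p' + p)) (X.T (-x0 p') ω)) = ∏ j ∈ Finset.univ.erase j0, f j (X.T (v j p.2 + c j * p.1) ω) := by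
      rw [Bd.prod_apply]
      refine Finset.prod_congr rfl fun j _ => ?_
      rw [X.tr_apply, ← X.T_add, ← X.T_add, hx0]
      refine congrArg (fun r => f j (X.T r ω)) ?_; ring
    have l2 : A0 (p' + p, X.T (-x0 p') ω) = ∏ j ∈ Finset.univ.erase j0, g j (X.T (x' j p + (x' j p' - x0 p')) ω) := by
      rw [Bd.prod_apply]
      refine Finset.prod_congr rfl fun j _ => ?_
      rw [X.act_apply, ← X.T_add, hx']
      refine congrArg (fun r => g j (X.T r ω)) ?_; ring
    have l3 : A (p' + p + (0, s + -p.2), X.T (-x0 p') ω) = ∏ j, g j (X.T (c j * p.1 + (x' j (p' + (0, s)) - x0 p')) ω) := by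
      rw [hA, prA_apply]
      refine Finset.prod_congr rfl fun j _ => ?_
      rw [← X.T_add]
      refine congrArg (fun r => g j (X.T r ω)) ?_
      show v' j (p'.2 + p.2 + (s + -p.2)) + c j * (p'.1 + p.1 + 0) + -x0 p' = c j * p.1 + (v' j (p'.2 + s) + c j * (p'.1 + 0) - x0 p')
      rw [show p'.2 + p.2 + (s + -p.2) = p'.2 + s by abel]; ring
    rw [l1, l2, l3, ← mul_assoc, ← Finset.prod_mul_distrib]
    congr 1
    · refine Finset.prod_congr rfl fun j hj => ?_
      rw [if_neg (Finset.ne_of_mem_erase hj), if_neg (Finset.ne_of_mem_erase hj), if_neg (Finset.ne_of_mem_erase hj)]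
      show _ = f j (X.T 0 (X.T (v j p.2 + c j * p.1) ω)) * g j (X.T (x' j p' - x0 p') (X.T (v j p.2 + c j * p.1) ω))
      rw [X.T_zero]
      rcases hvg j with h | h
      · rw [← X.T_add]
        refine congrArg (fun r => _ * g j (X.T r ω)) ?_
        show v' j p.2 + c j * p.1 + _ = _ + _
        rw [h]; ring
      · rw [h]; simp
    · refine Finset.prod_congr rfl fun j hj => ?_
      show _ = g j (X.T (x' j (p' + (0, s)) - x0 p') (X.T ((0 : Y.V) p.2 + c j * p.1) ω))
      rw [← X.T_add]
      refine congrArg (fun r => g j (X.T r ω)) ?_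
      simp; ring
end
end Sz

/-! Part 17 -/

namespace Sz
open Topology

section
variable (Y : Par)

theorem lam_le {Φ : Bd Y.P} {C : ℝ} (h : ∀ p, |Φ p| ≤ C) (t : ℝ) : |Y.lam Φ t| ≤ C := Y.mQ.abs_le fun d => h _

open Classical in
theorem step (W : Finset Y.V) (h0 : (0 : Y.V) ∉ W) (m' : Y.V) (hm : m' ∈ W) (hE : GG Y (insert 0 (W.erase m')))
    (hW : ∀ h h' : ℕ, GG Y (W.image (Y.S^[h]) ∪ W.image (Y.S^[h']))) : GG Y (insert 0 W) := by
  have hm0 : m' ≠ 0 := fun h => h0 (h ▸ hm)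
  suffices H : ∀ (N : ℕ) (X : Sys) (J : Type) [Fintype J] (v : J → Y.V) (c : J → ℝ) (f : J → Bd X.Ω),
      (∀ j, v j ∈ insert 0 W) → (∀ j, f j ∈ CC X) → (∀ j ω, |f j ω| ≤ 1) → (Finset.univ.filter (fun j => v j = m')).card ≤ N →
      Good Y (Phi Y X v c f) from fun X J _ v c f hv hf hf1 => H _ X J v c f hv hf hf1 le_rfl
  intro N
  induction N with
  | zero =>
    intro X J _ v c f hv hf hf1 hN
    refine hE X J v c f (fun j => ?_) hf hf1
    have : v j ≠ m' := by
      intro h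
      have : j ∈ Finset.univ.filter (fun j => v j = m') := by simp [h]
      rw [Finset.card_eq_zero.mp (Nat.le_zero.mp hN)] at this
      simp at this
    rcases Finset.mem_insert.mp (hv j) with h | h
    · rw [h]; exact Finset.mem_insert_self _ _
    · exact Finset.mem_insert_of_mem (Finset.mem_erase.mpr ⟨this, h⟩)
  | succ N ih =>
    intro X J _ v c f hv hf hf1 hN
    by_cases hex : ∃ j0, v j0 = m'
    swap
    · push Not at hex
      refine hE X J v c f (fun j => ?_) hf hf1
      rcases Finset.mem_insert.mp (hv j) with h | h
      · rw [h]; exact Finset.mem_insert_self _ _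
      · exact Finset.mem_insert_of_mem (Finset.mem_erase.mpr ⟨hex j, h⟩)
    obtain ⟨j0, hj0⟩ := hex
    by_contra hbad
    unfold Good at hbad
    push Not at hbad
    obtain ⟨a, ha⟩ := hbad
    rw [Metric.tendsto_atTop] at ha
    push Not at ha
    obtain ⟨ε, hε, ha⟩ := ha
    set Φ0 := Phi Y X v c f with hΦ0
    let diff : ℕ → Bd Y.P →ₗ[ℝ] Bd ℝ := fun L => Y.avg L (a L) - Y.lam
    have hdiff : ∀ L Φ, diff L Φ = Y.avg L (a L) Φ - Y.lam Φ := fun L Φ => rfl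
    have hfr : ∃ᶠ L in atTop, L ∈ {L : ℕ | ε ≤ EE (diff L Φ0).abs} := by
      rw [frequently_atTop]
      intro L0
      obtain ⟨L, hL, h⟩ := ha L0
      refine ⟨L, hL, ?_⟩
      rw [Real.dist_eq, sub_zero, abs_of_nonneg (EE.nonneg fun t => abs_nonneg _)] at h
      exact h
    haveI := frequently_mem_iff_neBot.mp hfr
    let U := Ultrafilter.of (atTop ⊓ 𝓟 {L : ℕ | ε ≤ EE (diff L Φ0).abs})
    have hU : (U : Filter ℕ) ≤ atTop := (Ultrafilter.of_le _).trans inf_le_left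
    have hUε : ∀ᶠ L in (U : Filter ℕ), ε ≤ EE (diff L Φ0).abs :=
      ((Ultrafilter.of_le _).trans inf_le_right) (mem_principal_self _)
    let σ : ℕ → Bd ℝ := fun L => Bd.mk' (fun t => if 0 ≤ diff L Φ0 t then 1 else -1) 1 (fun t => by split_ifs <;> simp)
    have hσ : ∀ L t, |σ L t| ≤ 1 := fun L t => by
      show |if 0 ≤ diff L Φ0 t then (1:ℝ) else -1| ≤ 1
      split_ifs <;> simp
    have hσ2 : ∀ L, σ L * diff L Φ0 = (diff L Φ0).abs := fun L => by
      ext t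
      show (if 0 ≤ diff L Φ0 t then (1:ℝ) else -1) * diff L Φ0 t = |diff L Φ0 t|
      split_ifs with h
      · rw [abs_of_nonneg h, one_mul]
      · rw [abs_of_neg (not_le.mp h), neg_one_mul]
    -- the linear dependence on the function at j0
    let Rj : Bd (Y.P × X.Ω) := ∏ j ∈ Finset.univ.erase j0, X.act (fun p : Y.P => v j p.2 + c j * p.1) (f j)
    have hRj : ∀ q, |Rj q| ≤ 1 := fun q => by
      rw [Bd.prod_apply, Finset.abs_prod]
      exact Finset.prod_le_one (fun j _ => abs_nonneg _) (fun j _ => hf1 j _)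
    let Φl : Bd X.Ω →ₗ[ℝ] Bd Y.P := {
      toFun := fun g => Phi Y X v c (Function.update f j0 g)
      map_add' := fun g g' => by unfold Phi; simp only [prA_update, map_add, add_mul]
      map_smul' := fun r g => by unfold Phi; simp only [prA_update, map_smul, smul_mul_assoc, RingHom.id_apply] }
    have hΦl : ∀ g, Φl g = Phi Y X v c (Function.update f j0 g) := fun g => rfl
    have hΦb : ∀ g p, |Φl g p| ≤ X.m g.abs := by
      intro g p
      rw [hΦl]; unfold Phi
      rw [prA_update, Mean.part_apply, map_mul, X.comp_act]
      refine (X.m.mul_bound _ _ (C := 1) (fun ω => hRj (p, ω))).trans ?_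
      rw [one_mul]
      exact le_of_eq (X.m_tr _ g.abs)
    have hdb : ∀ L g t, |diff L (Φl g) t| ≤ 2 * X.m g.abs := by
      intro L g t
      rw [hdiff, Bd.sub_apply]
      have h1 := avg_le Y L (a L) (X.m.nonneg fun ω => abs_nonneg _) (hΦb g) t
      have h2 := lam_le Y (hΦb g) t
      have := abs_sub (Y.avg L (a L) (Φl g) t) (Y.lam (Φl g) t)
      linarith
    have hδb : ∀ L (g : Bd X.Ω), |EE (σ L * diff L (Φl g))| ≤ 2 * X.m g.abs := by
      intro L g
      refine EE.abs_le fun t => ?_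
      rw [Bd.mul_apply, abs_mul]
      calc _ ≤ 1 * (2 * X.m g.abs) := mul_le_mul (hσ L t) (hdb L g t) (abs_nonneg _) zero_le_one
        _ = _ := one_mul _
    let dl : Bd X.Ω → Bd ℕ := fun g => Bd.mk' (fun L => EE (σ L * diff L (Φl g))) _ (fun L => hδb L g)
    let ψ : Bd X.Ω →ₗ[ℝ] ℝ := {
      toFun := fun g => (1/2) * ultraMean U (dl g)
      map_add' := fun g g' => by
        have : dl (g + g') = dl g + dl g' := by
          ext L
          show EE _ = EE _ + EE _
          rw [map_add, map_add, mul_add, map_add]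
        rw [this, map_add]; ring
      map_smul' := fun r g => by
        have : dl (r • g) = r • dl g := by
          ext L
          show EE _ = r * EE _
          rw [map_smul, map_smul, mul_smul_comm, EE.smul']
        rw [this, (ultraMean U).smul', RingHom.id_apply, smul_eq_mul]; ring }
    have hψ : ∀ g, 2 * ψ g = ultraMean U (dl g) := fun g => by
      show (2:ℝ) * ((1/2) * ultraMean U (dl g)) = _
      ring
    have hψt : ∀ g, Tendsto (fun L => EE (σ L * diff L (Φl g))) U (𝓝 (2 * ψ g)) := fun g => by
      rw [hψ]; exact ultraMean_tendsto U (dl g)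
    have hψb : ∀ g ∈ CC X, |ψ g| ≤ 1 * X.m g.abs := by
      intro g _
      have := (ultraMean U).abs_le (f := dl g) (c := 2 * X.m g.abs) (fun L => hδb L g)
      rw [← hψ, abs_mul, abs_two] at this
      linarith
    obtain ⟨G, hG, hG1, hGψ⟩ := lemR X.cpl (clo_CC X) ψ zero_le_one hψb
    have hpos : 0 < ψ (f j0) := by
      have h1 : ε ≤ 2 * ψ (f j0) := by
        refine ge_of_tendsto (hψt (f j0)) ?_
        filter_upwards [hUε] with L hL
        have : Φl (f j0) = Φ0 := by rw [hΦl, Function.update_eq_self]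
        rw [this, hσ2]; exact hL
      linarith
    have hψG : 0 < ψ G := by
      rw [← hGψ G hG]
      have h1 := X.m.cs G (f j0)
      rw [hGψ _ (hf j0)] at h1
      rcases (X.m.sq_nonneg' G).eq_or_lt with h | h
      · rw [← h, zero_mul] at h1; nlinarith
      · exact h
    -- the split
    let v' : J → Y.V := fun j => if v j = 0 then m' else v j
    let g : J → Bd X.Ω := fun j => if v j = 0 then 1 else Function.update f j0 G j
    have hv' : ∀ j, v' j ∈ W := fun j => by
      show (if v j = 0 then m' else v j) ∈ W
      split_ifs with h
      · exact hm
      · exact (Finset.mem_insert.mp (hv j)).resolve_left h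
    have hup : ∀ j, Function.update f j0 G j ∈ CC X ∧ ∀ ω, |Function.update f j0 G j ω| ≤ 1 := by
      intro j
      by_cases h : j = j0
      · subst h; rw [Function.update_self]; exact ⟨hG, hG1⟩
      · rw [Function.update_of_ne h]; exact ⟨hf j, hf1 j⟩
    have hg : ∀ j, g j ∈ CC X := fun j => by
      show (if v j = 0 then (1 : Bd X.Ω) else Function.update f j0 G j) ∈ CC X
      split_ifs
      · exact (CC X).one_mem
      · exact (hup j).1
    have hg1 : ∀ j ω, |g j ω| ≤ 1 := fun j ω => by
      show |(if v j = 0 then (1 : Bd X.Ω) else Function.update f j0 G j) ω| ≤ 1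
      split_ifs
      · simp
      · exact (hup j).2 ω
    have hgj0 : g j0 = G := by
      show (if v j0 = 0 then (1 : Bd X.Ω) else Function.update f j0 G j0) = G
      rw [if_neg (by rw [hj0]; exact hm0), Function.update_self]
    have hv'j0 : v' j0 = v j0 := if_neg (by rw [hj0]; exact hm0)
    set A := prA Y X v' c g with hA
    let fB : J → Bd X.Ω := fun j => if v j = 0 then Function.update f j0 G j else 1
    have hfB1 : ∀ j ω, |fB j ω| ≤ 1 := fun j ω => by
      show |(if v j = 0 then Function.update f j0 G j else (1 : Bd X.Ω)) ω| ≤ 1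
      split_ifs
      · exact (hup j).2 ω
      · simp
    let B := prA Y X (fun _ => 0) c fB
    have hB1 : ∀ q, |B q| ≤ 1 := prA_le Y X _ c fB hfB1
    have hBd : ∀ t d d' ω, B ((t, d), ω) = B ((t, d'), ω) := by
      intro t d d' ω
      show prA Y X (fun _ => 0) c fB _ = prA Y X (fun _ => 0) c fB _
      rw [prA_apply, prA_apply]; rfl
    have hBA : prA Y X v c (Function.update f j0 G) = B * A := by
      show _ = prA Y X (fun _ => 0) c fB * A
      rw [hA]; unfold prA
      rw [← Finset.prod_mul_distrib]
      refine Finset.prod_congr rfl fun j _ => ?_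
      by_cases h : v j = 0
      · have e1 : fB j = Function.update f j0 G j := if_pos h
        have e2 : g j = 1 := if_pos h
        rw [e1, e2, map_one, mul_one, h]
      · have e1 : fB j = 1 := if_neg h
        have e2 : g j = Function.update f j0 G j := if_neg h
        have e3 : v' j = v j := if_neg h
        rw [e1, e2, e3, map_one, one_mul]
    have hΦG : Φl G = X.m.part (B * A) := by rw [hΦl, ← hBA]; rfl
    set q := Y.mQ (cor Y X A) with hq
    have hq0 : 0 ≤ q := cor_nonneg Y X A
    let da : Bd ℕ := Bd.mk' (fun L => EE (σ L * Y.avg L (a L) (Φl G))) (X.m G.abs) (fun L => by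
      refine EE.abs_le fun t => ?_
      rw [Bd.mul_apply, abs_mul]
      have h1 := avg_le Y L (a L) (X.m.nonneg fun ω => abs_nonneg _) (hΦb G) t
      calc _ ≤ 1 * (X.m G.abs) := mul_le_mul (hσ L t) h1 (abs_nonneg _) zero_le_one
        _ = _ := one_mul _)
    set ρ := ultraMean U da with hρ
    have hρt : Tendsto (fun L => EE (σ L * Y.avg L (a L) (X.m.part (B * A)))) U (𝓝 ρ) := by
      rw [← hΦG]; exact ultraMean_tendsto U da
    have hρq : ρ ^ 2 ≤ q := rho Y X v' c g W hv' hW hg hg1 B hBd hB1 σ hσ a U hU ρ hρt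
    have hτt : Tendsto (fun L => EE (σ L * Y.lam (X.m.part (B * A)))) U (𝓝 (ρ - 2 * ψ G)) := by
      refine (hρt.sub (hψt G)).congr fun L => ?_
      rw [← map_sub, hdiff, hΦG]; congr 1; ring
    have hτq : (ρ - 2 * ψ G) ^ 2 ≤ q := by
      refine le_of_tendsto (hτt.pow 2) (Eventually.of_forall fun L => ?_)
      have e : EE (σ L * Y.lam (X.m.part (B * A))) = MM Y X ((Bd.comp (fun w : Y.P × X.Ω => w.1.1) (σ L) * B) * A) := by
        show _ = EE (Y.mQ.part (X.m.part _))
        congr 1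
        ext t
        rw [Bd.mul_apply, Y.lam_apply, Mean.part_apply, ← Y.mQ.smul']
        congr 1
        ext d
        show σ L t * X.m (Bd.comp (fun ω => ((t, d), ω)) (B * A)) = X.m _
        rw [← X.m.smul']
        congr 1
        ext ω
        simp only [Bd.smul_apply, Bd.comp_apply, Bd.mul_apply]; ring
      rw [e]
      refine lamb Y X A _ (fun s => ?_) (fun w => ?_)
      · ext ⟨⟨t, d⟩, ω⟩
        show σ L (t + 0) * B ((t + 0, d + s), ω) = σ L t * B ((t, d), ω)
        rw [add_zero, hBd t (d + s) d]
      · rw [Bd.mul_apply, abs_mul]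
        exact mul_le_one₀ (hσ _ _) (abs_nonneg _) (hB1 _)
    have hqpos : 0 < q := by
      rcases hq0.eq_or_lt with h | h
      · rw [← h] at hρq hτq
        have h1 : ρ = 0 := by nlinarith
        rw [h1] at hτq
        nlinarith
      · exact h
    obtain ⟨D, hD, hDG, X', F, hF, hF1, hPhi⟩ := dualD Y X v c f U hU hf hf1 j0 v' g hg hg1 hv'j0 (fun j => by
      by_cases h : v j = 0
      · exact Or.inr (if_pos h)
      · exact Or.inl (if_neg h))
    have hψD : ψ D = q := by rw [← hGψ D hD, mul_comm, ← hgj0, hDG]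
    have hgood : Good Y (Φl D) := by
      rw [hΦl, hPhi]
      refine ih X' (J ⊕ J) _ _ F ?_ hF hF1 ?_
      · rintro (j | j)
        · simp only [Sum.elim_inl]
          split_ifs
          · exact Finset.mem_insert_self _ _
          · exact hv j
        · exact Finset.mem_insert_self _ _
      · have hsub : (Finset.univ.filter (fun j : J ⊕ J => Sum.elim (fun j => if j = j0 then 0 else v j) (fun _ => (0 : Y.V)) j = m'))
            ⊆ ((Finset.univ.filter (fun j => v j = m')).erase j0).map Function.Embedding.inl := by
          rintro (j | j) hj
          · simp only [Finset.mem_filter, Finset.mem_univ, true_and, Sum.elim_inl] at hj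
            by_cases h : j = j0
            · rw [if_pos h] at hj; exact absurd hj.symm hm0
            · rw [if_neg h] at hj
              simp [h, hj]
          · simp only [Finset.mem_filter, Finset.mem_univ, true_and, Sum.elim_inr] at hj
            exact absurd hj.symm hm0
        refine (Finset.card_le_card hsub).trans ?_
        rw [Finset.card_map, Finset.card_erase_of_mem (by simp [hj0])]
        omega
    have hψD0 : 2 * ψ D = 0 := by
      refine tendsto_nhds_unique (hψt D) (squeeze_zero_norm (fun L => ?_) ((hgood a).mono_left hU))
      rw [Real.norm_eq_abs]
      refine (EE.abs_le_abs _).trans (EE.mono fun t => ?_)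
      show |σ L t * diff L (Φl D) t| ≤ |diff L (Φl D) t|
      rw [abs_mul]
      exact mul_le_of_le_one_left (abs_nonneg _) (hσ L t)
    linarith

theorem S_sub_pow (i : ℕ) (w : Y.V) : Y.S w - w = (Y.N.dualMap - 1) w := rfl

/-- Theorem A -/
theorem GG_all : ∀ U, GG Y U := by
  refine pet Y.S (fun i => (LinearMap.range ((Y.N.dualMap - 1) ^ i)).toAddSubgroup) (GG Y) Y.k ?_ ?_ ?_ ?_ (fun U U' => GG_sub Y U U') (GG_tr Y) (GG_base Y) (step Y)
  · intro v; exact ⟨v, rfl⟩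
  · rintro v ⟨w, rfl⟩
    have : (Y.N.dualMap - 1) ^ Y.k = 0 := by
      have h : ∀ (i : ℕ) (w : Y.V) d, ((Y.N.dualMap - 1) ^ i) w d = w (((Y.N - 1) ^ i) d) := by
        intro i
        induction i with
        | zero => intro w d; rfl
        | succ i ih =>
          intro w d
          rw [pow_succ, Module.End.mul_apply, ih, pow_succ', Module.End.mul_apply]
          show w (Y.N _) - w _ = w (Y.N _ - _)
          rw [map_sub]; rfl
      ext w d
      rw [h, Y.nil]; simp
    rw [this]; rfl
  · rintro i v ⟨w, rfl⟩
    exact ⟨w, by rw [pow_succ', Module.End.mul_apply]; rfl⟩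
  · rintro i v ⟨w, rfl⟩
    exact ⟨(Y.N.dualMap - 1) w, by rw [pow_succ, Module.End.mul_apply]⟩
end
end Sz

/-! Part 18 -/

namespace Sz
open Topology

def dif (g : ℕ → ℝ) (n : ℕ) : ℝ := g (n + 1) - g n

structure ParH (k : ℕ) where
  Y : Par
  h : Y.V
  ht : ℝ
  sur : ∀ (d : Y.Q) (x : ℝ), ∃ (t : ℝ) (d' : Y.Q), Y.N d' - d' + t • Y.b = d ∧ h d' + ht * t = x
  marg : ∀ F : Bd ℝ, Y.mP (Bd.comp (fun p => h p.2 + ht * p.1) F) = EE F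
  appr : ∀ (g : ℕ → ℝ) (t ε : ℝ) (L : ℕ), 0 ≤ ε → (∀ n < L, |dif^[k] g n - t| ≤ ε) →
    ∃ d : Y.Q, ∀ n < L, |h (Y.stp^[n] (t, d)).2 + ht * t - g n| ≤ L ^ k * ε

noncomputable def par0 : Par where
  Q := PUnit
  N := 0
  b := 0
  mQ := Mean.map (fun _ => PUnit.unit) EE
  inv s f := rfl
  invN f := rfl
  k := 0
  nil := by ext
  surj d := ⟨0, 0, Subsingleton.elim _ _⟩

noncomputable def parH0 : ParH 0 where
  Y := par0
  h := 0
  ht := 1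
  sur d x := ⟨x, 0, Subsingleton.elim (α := PUnit) _ _, by simp⟩
  marg F := by
    show EE (Mean.part _ _) = _
    congr 1; ext t
    rw [Mean.part_apply]
    have e : Bd.comp (fun ω => (t, ω)) (Bd.comp (fun p : par0.P => (0 : par0.V) p.2 + 1 * p.1) F) = algebraMap ℝ _ (F t) := by
      ext d; simp
    rw [e, Mean.const]
  appr g t ε L hε h := ⟨0, fun n hn => by
    have := h n hn
    simp only [Function.iterate_zero, id] at this
    rw [abs_sub_comm] at this
    simpa using this⟩

noncomputable def parS {k : ℕ} (H : ParH k) : Par where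
  Q := H.Y.Q × ℝ
  N := LinearMap.prod (H.Y.N ∘ₗ LinearMap.fst ℝ _ _) (LinearMap.snd ℝ _ _ + H.h ∘ₗ LinearMap.fst ℝ _ _)
  b := (H.Y.b, H.ht)
  mQ := H.Y.mQ.prod EE
  inv s f := by
    rw [Mean.prod_apply, Mean.prod_apply, ← H.Y.inv s.1 (EE.part f)]
    congr 1; ext d
    exact EE_add s.2 (Bd.comp (fun x => (d + s.1, x)) f)
  invN f := by
    rw [Mean.prod_apply, Mean.prod_apply, ← H.Y.invN (EE.part f)]
    congr 1; ext d
    exact EE_add (H.h d) (Bd.comp (fun x => (H.Y.N d, x)) f)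
  k := H.Y.k + 1
  nil := by
    have key : ∀ (j : ℕ) (d : H.Y.Q) (x : ℝ), ∃ y, (((LinearMap.prod (H.Y.N ∘ₗ LinearMap.fst ℝ _ _) (LinearMap.snd ℝ _ _ + H.h ∘ₗ LinearMap.fst ℝ _ _) : H.Y.Q × ℝ →ₗ[ℝ] H.Y.Q × ℝ) - 1) ^ j) (d, x)
        = (((H.Y.N - 1) ^ j) d, y) := by
      intro j
      induction j with
      | zero => intro d x; exact ⟨x, rfl⟩
      | succ j ih =>
        intro d x
        obtain ⟨y, hy⟩ := ih d x
        rw [pow_succ', Module.End.mul_apply, hy, pow_succ', Module.End.mul_apply]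
        exact ⟨_, rfl⟩
    refine LinearMap.ext fun z => ?_
    obtain ⟨y, hy⟩ := key H.Y.k z.1 z.2
    rw [pow_succ', Module.End.mul_apply, hy, H.Y.nil]
    ext <;> simp
  surj d := by
    obtain ⟨t, d', h1, h2⟩ := H.sur d.1 d.2
    refine ⟨t, (d', 0), ?_⟩
    ext
    · exact h1
    · simpa [mul_comm] using h2


theorem parS_stp {k : ℕ} (H : ParH k) (t : ℝ) (d : H.Y.Q) (x : ℝ) (n : ℕ) : ((parS H).stp^[n] (t, (d, x))) =
    (t, ((H.Y.stp^[n] (t, d)).2, x + ∑ i ∈ Finset.range n, (H.h (H.Y.stp^[i] (t, d)).2 + H.ht * t))) := by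
  induction n with
  | zero => simp; rfl
  | succ n ih =>
    rw [Function.iterate_succ_apply', ih, Function.iterate_succ_apply', Finset.sum_range_succ]
    have e : (H.Y.stp^[n] (t, d)).1 = t := by rw [H.Y.stp_it]
    refine Prod.ext rfl (Prod.ext ?_ ?_)
    · show H.Y.N (H.Y.stp^[n] (t, d)).2 + t • H.Y.b = H.Y.N (H.Y.stp^[n] (t, d)).2 + (H.Y.stp^[n] (t, d)).1 • H.Y.b
      rw [e]
    · show (x + ∑ i ∈ Finset.range n, (H.h (H.Y.stp^[i] (t, d)).2 + H.ht * t)) + H.h (H.Y.stp^[n] (t, d)).2 + t * H.ht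
        = x + (∑ i ∈ Finset.range n, (H.h (H.Y.stp^[i] (t, d)).2 + H.ht * t) + (H.h (H.Y.stp^[n] (t, d)).2 + H.ht * t))
      ring

noncomputable def parHS {k : ℕ} (H : ParH k) : ParH (k + 1) where
  Y := parS H
  h := LinearMap.snd ℝ H.Y.Q ℝ
  ht := 0
  sur d x := by
    obtain ⟨t, d', h1, h2⟩ := H.sur d.1 d.2
    refine ⟨t, (d', x), ?_, ?_⟩
    · apply Prod.ext
      · exact h1
      · show x + H.h d' - x + t * H.ht = d.2
        rw [← h2]; ring
    · show x + 0 * t = x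
      ring
  marg F := by
    show EE (Mean.part _ _) = _
    have : (parS H).mQ.part (Bd.comp (fun p : (parS H).P => LinearMap.snd ℝ H.Y.Q ℝ p.2 + 0 * p.1) F) = algebraMap ℝ _ (EE F) := by
      ext t
      rw [Mean.part_apply]
      show H.Y.mQ (EE.part _) = EE F
      have e : EE.part (Bd.comp (fun d : H.Y.Q × ℝ => (t, d)) (Bd.comp (fun p : (parS H).P => LinearMap.snd ℝ H.Y.Q ℝ p.2 + 0 * p.1) F)) = algebraMap ℝ _ (EE F) := by
        ext d
        show EE _ = EE F
        congr 1; ext x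
        show F (x + 0 * t) = F x
        simp
      exact (congrArg H.Y.mQ e).trans (H.Y.mQ.const _)
    exact (congrArg EE this).trans (EE.const _)
  appr g t ε L hε hg := by
    obtain ⟨d, hd⟩ := H.appr (dif g) t ε L hε (by
      intro n hn; have := hg n hn; rwa [Function.iterate_succ_apply] at this)
    refine ⟨(d, g 0), fun n hn => ?_⟩
    rw [parS_stp]
    show |g 0 + ∑ i ∈ Finset.range n, (H.h (H.Y.stp^[i] (t, d)).2 + H.ht * t) + 0 * t - g n| ≤ _
    have e : g n = g 0 + ∑ i ∈ Finset.range n, dif g i := by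
      unfold dif; rw [Finset.sum_range_sub]; ring
    have e2 : g 0 + ∑ i ∈ Finset.range n, (H.h (H.Y.stp^[i] (t, d)).2 + H.ht * t) + 0 * t - g n
        = ∑ i ∈ Finset.range n, ((H.h (H.Y.stp^[i] (t, d)).2 + H.ht * t) - dif g i) := by
      rw [e, Finset.sum_sub_distrib]; ring
    rw [e2]
    refine (Finset.abs_sum_le_sum_abs _ _).trans ((Finset.sum_le_sum fun i hi => hd i ((Finset.mem_range.mp hi).trans hn)).trans ?_)
    rw [Finset.sum_const, Finset.card_range, nsmul_eq_mul, pow_succ]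
    have : (n:ℝ) ≤ L := by exact_mod_cast hn.le
    have h2 : 0 ≤ (L:ℝ)^k * ε := by positivity
    nlinarith [mul_le_mul_of_nonneg_right this h2]

noncomputable def parH : (k : ℕ) → ParH k
  | 0 => parH0
  | k + 1 => parHS (parH k)

/-- combination of Theorems A and B -/
theorem thmAB (k ℓ : ℕ) (X : Sys) (f : Bd X.Ω) (hf : f ∈ CC X) (hf0 : ∀ ω, 0 ≤ f ω) (hf1 : ∀ ω, f ω ≤ 1) (hp : 0 < X.m f) :
    ∃ κ > 0, ∃ L : ℕ, ∀ x0 : ℝ, ∃ t ≥ x0, ∀ d : (parH k).Y.Q, ∃ n < L,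
      κ < Av X ℓ f ((parH k).h ((parH k).Y.stp^[n] (t, d)).2 + (parH k).ht * t) := by
  set H := parH k
  set Y := H.Y with hY
  have hB := thmB X ℓ f hf0 hp
  set κ := EE (Av X ℓ f) with hκ
  refine ⟨κ / 4, by positivity, ?_⟩
  by_contra hcon
  push Not at hcon
  choose x0 hx0 using hcon
  classical
  choose a ha using hx0
  let aa : ℕ → ℝ → Y.Q := fun L t => if h : t ≥ x0 L then a L t h else 0
  let Φ := Phi Y X (fun j : Fin (ℓ + 1) => (j : ℝ) • H.h) (fun j => (j : ℝ) * H.ht) (fun _ => f)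
  have hΦ : ∀ p : Y.P, Φ p = Av X ℓ f (H.h p.2 + H.ht * p.1) := by
    intro p
    rw [Phi_apply, Av_apply, Finset.prod_range]
    congr 1
    refine Finset.prod_congr rfl fun j _ => ?_
    congr 2
    rw [LinearMap.smul_apply, smul_eq_mul]; ring
  have hG : Good Y Φ := GG_all Y (Finset.univ.image (fun j : Fin (ℓ + 1) => (j : ℝ) • H.h)) X _ _ _ _
    (fun j => Finset.mem_image_of_mem _ (Finset.mem_univ j)) (fun _ => hf) (fun _ ω => abs_le.mpr ⟨by linarith [hf0 ω], hf1 ω⟩)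
  have hlim := hG.lim Y aa
  have hm : Y.mP Φ = κ := by
    rw [hκ, ← H.marg]
    congr 1; ext p; exact hΦ p
  rw [hm] at hlim
  have hle : κ ≤ κ / 4 := by
    refine le_of_tendsto hlim (Eventually.of_forall fun L => ?_)
    let g := Y.avg L (aa L) Φ - algebraMap ℝ _ (κ / 4)
    have hg : ∀ t, x0 L ≤ t → g t ≤ 0 := by
      intro t ht
      show Y.avg L (aa L) Φ t - κ / 4 ≤ 0
      rw [Y.avg_apply]
      have e : aa L t = a L t ht := dif_pos ht
      rcases L.eq_zero_or_pos with h | hL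
      · subst h; simp; positivity
      have hL' : (0:ℝ) < L := by exact_mod_cast hL
      rw [sub_nonpos, inv_mul_le_iff₀ hL']
      refine (Finset.sum_le_sum (g := fun _ => κ / 4) fun n hn => ?_).trans (by simp)
      rw [hΦ, e]
      have h1 : (Y.stp^[n] (t, a L t ht)).1 = t := by rw [Y.stp_it]
      rw [h1]
      exact ha L t ht n (Finset.mem_range.mp hn)
    have hcont : Continuous (fun x : ℝ => max x 0) := continuous_id.max continuous_const
    have h0 : EE (g.post _ hcont) = 0 := EE_supp (x0 L) _ fun t ht => max_eq_right (hg t ht)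
    have h1 : EE g ≤ EE (g.post _ hcont) := EE.mono fun t => le_max_left _ _
    rw [h0, map_sub, EE.const] at h1
    linarith
  linarith
end Sz

/-! Part 19 -/

namespace Sz
open Topology

def Dr (φ : ℝ → ℝ) (x : ℝ) : ℝ := φ (x + 1) - φ x

noncomputable def Rp (k : ℕ) (α : ℝ) : ℝ → ℝ := Dr^[k] (fun y => y ^ α)

theorem Rp_succ (k : ℕ) (α x : ℝ) : Rp (k + 1) α x = Rp k α (x + 1) - Rp k α x := by
  unfold Rp; rw [Function.iterate_succ_apply']; rfl

theorem Rp_deriv (k : ℕ) : ∀ (α x : ℝ), 0 < x → HasDerivAt (Rp k α) (α * Rp k (α - 1) x) x := by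
  induction k with
  | zero => intro α x hx; exact Real.hasDerivAt_rpow_const (Or.inl hx.ne')
  | succ k ih =>
    intro α x hx
    have h1 := (ih α (x + 1) (by linarith)).comp_add_const x 1
    have h2 := h1.sub (ih α x hx)
    rw [Rp_succ, mul_sub]
    refine h2.congr_of_eventuallyEq (Eventually.of_forall fun y => ?_)
    exact Rp_succ k α y

theorem Rp_mvt (k : ℕ) (α x : ℝ) (hx : 0 < x) : ∃ ξ, x ≤ ξ ∧ Rp (k + 1) α x = α * Rp k (α - 1) ξ := by
  obtain ⟨c, hc, h⟩ := exists_hasDerivAt_eq_slope (Rp k α) (fun y => α * Rp k (α - 1) y) (show x < x + 1 by linarith)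
    (fun y hy => (Rp_deriv k α y (by linarith [hy.1])).continuousAt.continuousWithinAt)
    (fun y hy => Rp_deriv k α y (by linarith [hy.1]))
  refine ⟨c, hc.1.le, ?_⟩
  rw [Rp_succ, h]; ring

theorem Rp_mvt' (k : ℕ) (α : ℝ) : ∃ ξ : ℝ → ℝ, Tendsto ξ atTop atTop ∧ ∀ x > 0, Rp (k + 1) α x = α * Rp k (α - 1) (ξ x) := by
  have : ∀ x : ℝ, ∃ ξ, x ≤ ξ ∧ (0 < x → Rp (k + 1) α x = α * Rp k (α - 1) ξ) := by
    intro x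
    by_cases hx : 0 < x
    · obtain ⟨ξ, h1, h2⟩ := Rp_mvt k α x hx
      exact ⟨ξ, h1, fun _ => h2⟩
    · exact ⟨x, le_rfl, fun h => absurd h hx⟩
  choose ξ h1 h2 using this
  exact ⟨ξ, tendsto_atTop_mono h1 tendsto_id, h2⟩

theorem Rp_top (k : ℕ) : ∀ (α : ℝ), (k : ℝ) < α → Tendsto (Rp k α) atTop atTop := by
  induction k with
  | zero => intro α hα; exact tendsto_rpow_atTop (by simpa using hα)
  | succ k ih =>
    intro α hα
    push_cast at hα
    obtain ⟨ξ, h1, h2⟩ := Rp_mvt' k α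
    have h3 := (ih (α - 1) (by linarith)).comp h1
    have hk : (0:ℝ) ≤ k := by positivity
    refine (h3.const_mul_atTop (show 0 < α by linarith)).congr' ?_
    filter_upwards [eventually_gt_atTop 0] with x hx
    exact (h2 x hx).symm

theorem Rp_zero (k : ℕ) : ∀ (α : ℝ), α < (k : ℝ) → Tendsto (Rp k α) atTop (𝓝 0) := by
  induction k with
  | zero =>
    intro α hα
    have := tendsto_rpow_neg_atTop (y := -α) (by simpa using hα)
    rw [neg_neg] at this
    exact this
  | succ k ih =>
    intro α hα
    push_cast at hα
    obtain ⟨ξ, h1, h2⟩ := Rp_mvt' k α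
    have h3 := ((ih (α - 1) (by linarith)).comp h1).const_mul α
    rw [mul_zero] at h3
    refine h3.congr' ?_
    filter_upwards [eventually_gt_atTop 0] with x hx
    exact (h2 x hx).symm

theorem dif_Rp (k : ℕ) (α c : ℝ) : ∃ c', ∀ N n : ℕ, dif^[k] (fun i => ((N + i : ℕ) : ℝ) ^ α - c) n = Rp k α ((N + n : ℕ) : ℝ) - c' := by
  induction k with
  | zero => exact ⟨c, fun N n => rfl⟩
  | succ k ih =>
    obtain ⟨c', h⟩ := ih
    refine ⟨0, fun N n => ?_⟩
    rw [Function.iterate_succ_apply', dif, h, h, Rp_succ]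
    push_cast
    rw [← add_assoc]; ring

theorem slow (u : ℕ → ℝ) (hu : Tendsto u atTop atTop) (hd : Tendsto (fun n => u (n + 1) - u n) atTop (𝓝 0))
    (L : ℕ) (ε : ℝ) (hε : 0 < ε) (N0 : ℕ) : ∃ x0 : ℝ, ∀ t ≥ x0, ∃ N ≥ N0, ∀ n < L, |u (N + n) - t| ≤ ε := by
  set e := ε / (L + 1) with he
  have he0 : 0 < e := by positivity
  have h1 : ∀ᶠ n in atTop, |u (n + 1) - u n| ≤ e := by
    have := (hd.abs).eventually (ge_mem_nhds (show |(0:ℝ)| < e by simpa using he0))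
    exact this
  obtain ⟨N1, hN1⟩ := eventually_atTop.mp (h1.and (eventually_ge_atTop N0))
  refine ⟨u N1 + 1, fun t ht => ?_⟩
  have hex : ∃ i, t ≤ u (N1 + i) := by
    obtain ⟨m, hm, hm2⟩ := ((hu.eventually_ge_atTop t).and (eventually_ge_atTop N1)).exists
    exact ⟨m - N1, by rwa [Nat.add_sub_cancel' hm2]⟩
  classical
  obtain ⟨i, hi⟩ : ∃ i, Nat.find hex = i + 1 := by
    refine Nat.exists_eq_succ_of_ne_zero fun h => ?_
    have := Nat.find_spec hex
    rw [h, add_zero] at this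
    linarith
  have h2 := Nat.find_spec hex
  rw [hi] at h2
  have h3 := Nat.find_min hex (m := i) (by omega)
  push Not at h3
  have hN := fun j => (hN1 (N1 + i + j) (by omega)).1
  refine ⟨N1 + i, (hN1 (N1 + i) (by omega)).2, fun n hn => ?_⟩
  have h4 : |u (N1 + i) - t| ≤ e := by
    have := abs_le.mp (hN 0)
    rw [add_zero, add_assoc] at this
    rw [abs_le]; constructor <;> linarith [this.2]
  have h5 : ∀ n : ℕ, |u (N1 + i + n) - t| ≤ (n + 1) * e := by
    intro n
    induction n with
    | zero => simpa using h4
    | succ n ih =>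
      have := abs_le.mp (hN n)
      have ih' := abs_le.mp ih
      rw [add_assoc (N1 + i) n 1] at this
      push_cast
      rw [abs_le]; constructor <;> nlinarith [this.1, this.2, ih'.1, ih'.2]
  refine (h5 n).trans ?_
  have : (n:ℝ) + 1 ≤ L + 1 := by exact_mod_cast (by omega : n + 1 ≤ L + 1)
  calc (n + 1) * e ≤ (L + 1) * e := by gcongr
    _ = ε := by rw [he]; field_simp

theorem slow_pow (δ c : ℝ) (k : ℕ) (h1 : (k : ℝ) < δ) (h2 : δ < k + 1) (L : ℕ) (ε : ℝ) (hε : 0 < ε) (N0 : ℕ) :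
    ∃ x0 : ℝ, ∀ t ≥ x0, ∃ N ≥ N0, ∀ n < L, |dif^[k] (fun i => ((N + i : ℕ) : ℝ) ^ δ - c) n - t| ≤ ε := by
  obtain ⟨c', hc⟩ := dif_Rp k δ c
  obtain ⟨x0, h⟩ := slow (fun n => Rp k δ (n : ℝ) - c')
    (tendsto_atTop_add_const_right _ _ ((Rp_top k δ h1).comp tendsto_natCast_atTop_atTop))
    (by
      refine ((Rp_zero (k + 1) δ (by push_cast; exact h2)).comp tendsto_natCast_atTop_atTop).congr fun n => ?_
      rw [Function.comp_apply, Rp_succ]; push_cast; ring) L ε hε N0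
  refine ⟨x0, fun t ht => ?_⟩
  obtain ⟨N, hN, h⟩ := h t ht
  refine ⟨N, hN, fun n hn => ?_⟩
  rw [hc]; exact h n hn

end Sz

/-! Part 20 -/

namespace Sz
open Topology

/-- averages over symmetric intervals -/
noncomputable def symAvg : Bd ℤ →ₗ[ℝ] Bd ℕ where
  toFun F := ⟨fun N => (2 * (N : ℝ) + 1)⁻¹ * ∑ i ∈ Finset.range (2 * N + 1), F ((i : ℤ) - N), by
    obtain ⟨C, hC⟩ := F.2
    refine ⟨C, fun N => ?_⟩
    have h : (0:ℝ) < 2 * N + 1 := by positivity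
    rw [abs_mul, abs_of_pos (inv_pos.mpr h), inv_mul_le_iff₀ h]
    refine (Finset.abs_sum_le_sum_abs _ _).trans ((Finset.sum_le_sum fun i _ => hC _).trans ?_)
    simp⟩
  map_add' F G := by
    ext N
    show (2 * (N : ℝ) + 1)⁻¹ * ∑ i ∈ Finset.range (2 * N + 1), (F ((i : ℤ) - N) + G ((i : ℤ) - N)) =
      (2 * (N : ℝ) + 1)⁻¹ * ∑ i ∈ Finset.range (2 * N + 1), F ((i : ℤ) - N) + (2 * (N : ℝ) + 1)⁻¹ * ∑ i ∈ Finset.range (2 * N + 1), G ((i : ℤ) - N)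
    rw [Finset.sum_add_distrib, mul_add]
  map_smul' c F := by
    ext N
    show (2 * (N : ℝ) + 1)⁻¹ * ∑ i ∈ Finset.range (2 * N + 1), (c * F ((i : ℤ) - N)) =
      c * ((2 * (N : ℝ) + 1)⁻¹ * ∑ i ∈ Finset.range (2 * N + 1), F ((i : ℤ) - N))
    rw [← Finset.mul_sum]; ring

theorem symAvg_apply (F : Bd ℤ) (N : ℕ) : symAvg F N = (2 * (N : ℝ) + 1)⁻¹ * ∑ i ∈ Finset.range (2 * N + 1), F ((i : ℤ) - N) := rfl

noncomputable def meanZ (U : Ultrafilter ℕ) : Mean ℤ where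
  lin := (ultraMean U).lin ∘ₗ symAvg
  nonneg' F h := (ultraMean U).nonneg' _ fun N => by
    rw [symAvg_apply]
    have : 0 ≤ ∑ i ∈ Finset.range (2 * N + 1), F ((i : ℤ) - N) := Finset.sum_nonneg fun i _ => h _
    positivity
  one' := by
    have : symAvg 1 = 1 := by
      ext N
      rw [symAvg_apply]
      have h : (2 * (N:ℝ) + 1) ≠ 0 := by positivity
      simp [h]
    rw [LinearMap.comp_apply, this]; exact (ultraMean U).one'

theorem meanZ_apply (U : Ultrafilter ℕ) (F : Bd ℤ) : meanZ U F = ultraMean U (symAvg F) := rfl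

theorem meanZ_one (U : Ultrafilter ℕ) (hU : (U : Filter ℕ) ≤ atTop) (F : Bd ℤ) : meanZ U (Bd.comp (fun n => n + 1) F) = meanZ U F := by
  have h : meanZ U (Bd.comp (fun n => n + 1) F - F) = 0 := by
    rw [meanZ_apply]
    refine ultraMean_eq U _ ?_
    obtain ⟨C, hC0, hC⟩ := F.bound
    have ht : Tendsto (fun N : ℕ => (2 * (N:ℝ) + 1)⁻¹ * (2 * C)) (U : Filter ℕ) (𝓝 (0 * (2 * C))) := by
      refine Tendsto.mul_const _ (Tendsto.mono_left ?_ hU)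
      refine tendsto_inv_atTop_zero.comp ?_
      exact tendsto_atTop_add_const_right _ _ (tendsto_natCast_atTop_atTop.const_mul_atTop (by norm_num))
    rw [zero_mul] at ht
    refine squeeze_zero_norm (fun N => ?_) ht
    rw [Real.norm_eq_abs]
    show |symAvg (Bd.comp (fun n => n + 1) F - F) N| ≤ _
    rw [symAvg_apply]
    have e : ∑ i ∈ Finset.range (2 * N + 1), (Bd.comp (fun n => n + 1) F - F : Bd ℤ) ((i : ℤ) - N) = F (((2 * N + 1 : ℕ) : ℤ) - N) - F (((0:ℕ):ℤ) - N) := by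
      rw [← Finset.sum_range_sub (fun i : ℕ => F ((i : ℤ) - N))]
      refine Finset.sum_congr rfl fun i _ => ?_
      rw [Bd.sub_apply, Bd.comp_apply]
      have : (i : ℤ) - N + 1 = ((i + 1 : ℕ) : ℤ) - N := by push_cast; ring
      rw [this]
    rw [e, abs_mul, abs_of_nonneg (by positivity)]
    refine mul_le_mul_of_nonneg_left ?_ (by positivity)
    refine (abs_sub _ _).trans ?_
    linarith [hC (((2 * N + 1 : ℕ) : ℤ) - N), hC (((0:ℕ):ℤ) - N)]
  rw [map_sub] at h; linarith

theorem meanZ_add (U : Ultrafilter ℕ) (hU : (U : Filter ℕ) ≤ atTop) (F : Bd ℤ) (s : ℤ) : meanZ U (Bd.comp (fun n => n + s) F) = meanZ U F := by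
  induction s with
  | zero => congr 1; ext n; simp
  | succ i ih =>
    rw [← ih, ← meanZ_one U hU (Bd.comp (fun n => n + (i:ℤ)) F)]
    congr 1; ext n
    rw [Bd.comp_apply, Bd.comp_apply, Bd.comp_apply]
    congr 1; ring
  | pred i ih =>
    rw [← ih, ← meanZ_one U hU (Bd.comp (fun n => n + (-(i:ℤ) - 1)) F)]
    congr 1; ext n
    rw [Bd.comp_apply, Bd.comp_apply, Bd.comp_apply]
    congr 1; ring

open Classical in
noncomputable def indZ (Λ : Set ℤ) : Bd ℤ := Bd.mk' (fun n => if n ∈ Λ then 1 else 0) 1 (fun n => by split_ifs <;> simp)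

open Classical in
theorem indZ_apply (Λ : Set ℤ) (n : ℤ) : indZ Λ n = if n ∈ Λ then 1 else 0 := rfl

theorem symAvg_ind (Λ : Set ℤ) (N : ℕ) : symAvg (indZ Λ) N = (Nat.card ↥(Λ ∩ Set.Icc (-(N : ℤ)) (N : ℤ)) : ℝ) / (2 * N + 1) := by
  classical
  rw [symAvg_apply, div_eq_inv_mul]
  congr 1
  have h1 : Λ ∩ Set.Icc (-(N : ℤ)) (N : ℤ) = ((((Finset.range (2 * N + 1)).filter (fun i : ℕ => ((i : ℤ) - N) ∈ Λ)).image (fun i : ℕ => (i : ℤ) - N) : Finset ℤ) : Set ℤ) := by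
    ext n
    simp only [Set.mem_inter_iff, Set.mem_Icc, Finset.coe_image, Finset.coe_filter, Finset.mem_range, Set.mem_image, Set.mem_setOf_eq]
    constructor
    · rintro ⟨h, h1, h2⟩
      refine ⟨(n + N).toNat, ⟨by omega, ?_⟩, by omega⟩
      rwa [show (((n + N).toNat : ℤ) - N) = n by omega]
    · rintro ⟨i, ⟨h1, h2⟩, rfl⟩
      exact ⟨h2, by omega, by omega⟩
  have h2 : Nat.card ↥(Λ ∩ Set.Icc (-(N : ℤ)) (N : ℤ)) = ((Finset.range (2 * N + 1)).filter (fun i : ℕ => ((i : ℤ) - N) ∈ Λ)).card := by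
    rw [h1, Nat.card_coe_set_eq, Set.ncard_coe_finset, Finset.card_image_of_injective]
    intro a b h
    simp only at h
    omega
  rw [h2, Finset.card_filter]
  push_cast
  exact Finset.sum_congr rfl fun i _ => by rw [indZ_apply]

theorem exists_meanZ (Λ : Set ℤ) (hΛ : 0 < upperDensity Λ) : ∃ U : Ultrafilter ℕ, (U : Filter ℕ) ≤ atTop ∧ 0 < meanZ U (indZ Λ) := by
  have hf : ∃ᶠ N : ℕ in atTop, upperDensity Λ / 2 < (Nat.card ↥(Λ ∩ Set.Icc (-(N : ℤ)) (N : ℤ)) : ℝ) / (2 * N + 1) := by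
    refine frequently_lt_of_lt_limsup ?_ (show upperDensity Λ / 2 < upperDensity Λ by linarith)
    exact IsCoboundedUnder.of_frequently_ge (a := 0) (Eventually.frequently (Eventually.of_forall fun N => by positivity))
  have hne := frequently_mem_iff_neBot.mp hf
  refine ⟨@Ultrafilter.of _ _ hne, (@Ultrafilter.of_le _ _ hne).trans inf_le_left, ?_⟩
  refine lt_of_lt_of_le (show 0 < upperDensity Λ / 2 by linarith) ?_
  rw [meanZ_apply]
  refine ge_of_tendsto (ultraMean_tendsto _ _) ?_
  have := (@Ultrafilter.of_le _ _ hne).trans inf_le_right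
  refine (le_principal_iff.mp this) |> fun h => mem_of_superset h fun N hN => ?_
  show _ ≤ symAvg (indZ Λ) N
  rw [symAvg_ind]
  exact le_of_lt hN

/-- bump -/
noncomputable def psi (x : ℝ) : ℝ := max 0 (min (Int.fract x) (1 / 8 - Int.fract x))
theorem psi_nonneg (x : ℝ) : 0 ≤ psi x := le_max_left _ _
theorem psi_le_fract (x : ℝ) : psi x ≤ Int.fract x := max_le (Int.fract_nonneg x) (min_le_left _ _)
theorem psi_le (x : ℝ) : psi x ≤ 1 := (psi_le_fract x).trans (Int.fract_lt_one x).le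
theorem psi_le' (x : ℝ) : psi x ≤ 1 - Int.fract x :=
  max_le (by linarith [Int.fract_lt_one x]) ((min_le_right _ _).trans (by linarith))
theorem psi_pos {x : ℝ} (h : psi x ≠ 0) : 0 < Int.fract x ∧ Int.fract x < 1 / 8 := by
  unfold psi at h
  by_contra hc
  apply h
  apply max_eq_left
  rw [not_and_or] at hc
  rcases hc with hc | hc
  · exact (min_le_left _ _).trans (not_lt.mp hc)
  · exact (min_le_right _ _).trans (by linarith [not_lt.mp hc])
theorem psi_add_int (x : ℝ) (n : ℤ) : psi (n + x) = psi x := by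
  unfold psi; rw [Int.fract_intCast_add]
theorem psi_ge {x : ℝ} (h1 : 1 / 32 ≤ x) (h2 : x ≤ 3 / 32) : 1 / 32 ≤ psi x := by
  have : Int.fract x = x := Int.fract_eq_self.mpr ⟨by linarith, by linarith⟩
  unfold psi
  rw [this]
  exact le_max_of_le_right (le_min h1 (by linarith))
theorem psi_same {x y : ℝ} (h : ⌊x⌋ = ⌊y⌋) : |psi x - psi y| ≤ |x - y| := by
  unfold psi
  have e : Int.fract x - Int.fract y = x - y := by unfold Int.fract; rw [h]; ring
  rw [← e]
  refine (abs_max_sub_max_le_max _ _ _ _).trans ?_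
  rw [sub_self, abs_zero]
  refine max_le (abs_nonneg _) ((abs_min_sub_min_le_max _ _ _ _).trans (max_le le_rfl ?_))
  rw [abs_sub_comm]
  apply le_of_eq
  congr 1; ring

noncomputable def fL (Λ : Set ℤ) : Bd ℝ := Bd.mk' (fun x => indZ Λ ⌊x⌋ * psi x) 1 (fun x => by
  rw [indZ_apply]
  split_ifs
  · rw [one_mul, abs_of_nonneg (psi_nonneg x)]; exact psi_le x
  · simp)
theorem fL_apply (Λ : Set ℤ) (x : ℝ) : fL Λ x = indZ Λ ⌊x⌋ * psi x := rfl
theorem fL_nonneg (Λ : Set ℤ) (x : ℝ) : 0 ≤ fL Λ x := by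
  rw [fL_apply, indZ_apply]; have := psi_nonneg x; split_ifs <;> simp [this]
theorem fL_le_psi (Λ : Set ℤ) (x : ℝ) : fL Λ x ≤ psi x := by
  rw [fL_apply, indZ_apply]; have := psi_nonneg x; split_ifs <;> simp [this]
theorem fL_ne {Λ : Set ℤ} {x : ℝ} (h : fL Λ x ≠ 0) : ⌊x⌋ ∈ Λ ∧ 0 < Int.fract x ∧ Int.fract x < 1 / 8 := by
  rw [fL_apply, indZ_apply] at h
  refine ⟨?_, psi_pos (right_ne_zero_of_mul h)⟩
  by_contra hc
  simp [hc] at h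

theorem fL_lip1 (Λ : Set ℤ) {x y : ℝ} (h : x ≤ y) : |fL Λ x - fL Λ y| ≤ |x - y| := by
  by_cases e : ⌊x⌋ = ⌊y⌋
  · refine le_trans ?_ (psi_same e)
    rw [fL_apply, fL_apply, e, ← mul_sub, abs_mul, indZ_apply]
    split_ifs <;> simp
  · have hlt : ⌊x⌋ + 1 ≤ ⌊y⌋ := lt_of_le_of_ne (Int.floor_le_floor h) e
    have hlt' : (⌊x⌋ : ℝ) + 1 ≤ ⌊y⌋ := by exact_mod_cast hlt
    have h1 := (fL_le_psi Λ x).trans (psi_le' x)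
    have h2 := (fL_le_psi Λ y).trans (psi_le_fract y)
    have h3 := fL_nonneg Λ x
    have h4 := fL_nonneg Λ y
    have h5 := Int.floor_add_fract x
    have h6 := Int.floor_add_fract y
    have h7 := Int.fract_nonneg y
    have h8 := (Int.fract_lt_one x).le
    rw [abs_sub_comm x y, abs_of_nonneg (sub_nonneg.mpr h), abs_le]
    constructor <;> linarith
theorem fL_lip (Λ : Set ℤ) (x y : ℝ) : |fL Λ x - fL Λ y| ≤ |x - y| := by
  rcases le_total x y with h | h
  · exact fL_lip1 Λ h
  · rw [abs_sub_comm, abs_sub_comm x y]; exact fL_lip1 Λ h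

noncomputable def mR (U : Ultrafilter ℕ) : Mean ℝ := Mean.map (fun p : ℝ × ℤ => (p.2 : ℝ) + p.1) (EE.prod (meanZ U))
theorem mR_inv (U : Ultrafilter ℕ) (s : ℝ) (F : Bd ℝ) : mR U (Bd.comp (fun x => x + s) F) = mR U F := by
  show EE ((meanZ U).part _) = EE ((meanZ U).part _)
  refine Eq.trans ?_ (EE_add s ((meanZ U).part (Bd.comp (fun p : ℝ × ℤ => (p.2 : ℝ) + p.1) F)))
  congr 1; ext u
  show meanZ U _ = meanZ U _
  congr 1; ext n
  show F ((n:ℝ) + u + s) = F ((n:ℝ) + (u + s))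
  rw [add_assoc]

noncomputable def psiB : Bd ℝ := Bd.mk' psi 1 (fun x => by rw [abs_of_nonneg (psi_nonneg x)]; exact psi_le x)

theorem EE_psi : 0 < EE psiB := by
  have h1 : EE (∑ i ∈ Finset.range 18, Bd.comp (fun x => x + (i:ℝ) / 16) psiB) = 18 * EE psiB := by
    rw [map_sum]
    simp [EE_add]
  have h2 : 1 / 32 ≤ EE (∑ i ∈ Finset.range 18, Bd.comp (fun x => x + (i:ℝ) / 16) psiB) := by
    refine EE.const_le fun u => ?_
    rw [Bd.sum_apply]
    set w := Int.fract u
    have hw0 : 0 ≤ w := Int.fract_nonneg u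
    have hw1 : w < 1 := Int.fract_lt_one u
    set i := ⌈16 * (1 + 1 / 32 - w)⌉₊ with hi
    have hi1 : 16 * (1 + 1 / 32 - w) ≤ i := Nat.le_ceil _
    have hi2 : (i:ℝ) < 16 * (1 + 1 / 32 - w) + 1 := Nat.ceil_lt_add_one (by linarith)
    have hi3 : i < 18 := by
      have : (i:ℝ) < 18 := by linarith
      exact_mod_cast this
    refine le_trans ?_ (Finset.single_le_sum (f := fun j : ℕ => Bd.comp (fun x => x + (j:ℝ) / 16) psiB u) (fun j _ => psi_nonneg _) (Finset.mem_range.mpr hi3))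
    show 1 / 32 ≤ psi (u + (i:ℝ) / 16)
    have e : u + (i:ℝ) / 16 = ((⌊u⌋ + 1 : ℤ) : ℝ) + (w + i / 16 - 1) := by
      have := Int.floor_add_fract u
      push_cast
      linarith
    rw [e, psi_add_int]
    exact psi_ge (by linarith) (by linarith)
  linarith

theorem mR_fL (U : Ultrafilter ℕ) (hU : (U : Filter ℕ) ≤ atTop) (Λ : Set ℤ) : mR U (fL Λ) = meanZ U (indZ Λ) * EE psiB := by
  rw [← EE.smul']
  show EE ((meanZ U).part _) = _
  congr 1; ext u
  show meanZ U _ = meanZ U (indZ Λ) * psi u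
  rw [← meanZ_add U hU (indZ Λ) ⌊u⌋, mul_comm, ← Mean.smul']
  congr 1; ext n
  show indZ Λ ⌊(n:ℝ) + u⌋ * psi ((n:ℝ) + u) = psi u * indZ Λ (n + ⌊u⌋)
  rw [psi_add_int, Int.floor_intCast_add, mul_comm]

noncomputable def sysR (U : Ultrafilter ℕ) (hU : (U : Filter ℕ) ≤ atTop) : Sys where
  Ω := ℕ × ℝ
  m := (ultraMean U).prod (mR U)
  T s ω := (ω.1, ω.2 + s)
  T_zero ω := by simp
  T_add s s' ω := by ext <;> simp; ring
  inv s f := by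
    rw [Mean.prod_apply, Mean.prod_apply]
    congr 1; ext p
    exact mR_inv U s (Bd.comp (fun x => (p, x)) f)
  cpl := L2C_prod U hU _

noncomputable def fX (U : Ultrafilter ℕ) (hU : (U : Filter ℕ) ≤ atTop) (Λ : Set ℤ) : Bd (sysR U hU).Ω := Bd.comp (fun ω : ℕ × ℝ => ω.2) (fL Λ)

theorem fX_tr (U : Ultrafilter ℕ) (hU : (U : Filter ℕ) ≤ atTop) (Λ : Set ℤ) (s : ℝ) (ω : ℕ × ℝ) :
    (sysR U hU).tr s (fX U hU Λ) ω = fL Λ (ω.2 + s) := rfl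

theorem fX_mean (U : Ultrafilter ℕ) (hU : (U : Filter ℕ) ≤ atTop) (Λ : Set ℤ) : (sysR U hU).m (fX U hU Λ) = meanZ U (indZ Λ) * EE psiB := by
  rw [← mR_fL U hU]
  have : (mR U).part (Bd.comp (fun ω : ℕ × ℝ => ω.2) (fL Λ)) = algebraMap ℝ _ (mR U (fL Λ)) := rfl
  exact (congrArg (ultraMean U) this).trans ((ultraMean U).const _)

theorem fX_CC (U : Ultrafilter ℕ) (hU : (U : Filter ℕ) ≤ atTop) (Λ : Set ℤ) : fX U hU Λ ∈ CC (sysR U hU) := by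
  intro ε hε
  have h : Tendsto (fun s : ℝ => s * s) (𝓝 0) (𝓝 (0 * 0)) := (continuous_id.mul continuous_id).tendsto 0
  rw [mul_zero] at h
  filter_upwards [h.eventually (ge_mem_nhds hε)] with s hs
  refine le_trans ?_ hs
  refine (sysR U hU).m.le_const fun ω => ?_
  show (fL Λ (ω.2 + s) - fL Λ ω.2) * (fL Λ (ω.2 + s) - fL Λ ω.2) ≤ s * s
  have := fL_lip Λ (ω.2 + s) ω.2
  rw [add_sub_cancel_left] at this
  exact abs_le_iff_mul_self_le.mp this

theorem prod_lip {n : ℕ} (a b : ℕ → ℝ) (ha : ∀ i, |a i| ≤ 1) (hb : ∀ i, |b i| ≤ 1) :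
    |∏ i ∈ Finset.range n, a i - ∏ i ∈ Finset.range n, b i| ≤ ∑ i ∈ Finset.range n, |a i - b i| := by
  induction n with
  | zero => simp
  | succ n ih =>
    rw [Finset.prod_range_succ, Finset.prod_range_succ, Finset.sum_range_succ]
    have e : (∏ i ∈ Finset.range n, a i) * a n - (∏ i ∈ Finset.range n, b i) * b n
      = (∏ i ∈ Finset.range n, a i - ∏ i ∈ Finset.range n, b i) * a n + (∏ i ∈ Finset.range n, b i) * (a n - b n) := by ring
    rw [e]
    refine (abs_add_le _ _).trans (add_le_add ?_ ?_)
    · rw [abs_mul]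
      exact (mul_le_of_le_one_right (abs_nonneg _) (ha n)).trans ih
    · rw [abs_mul]
      refine mul_le_of_le_one_left (abs_nonneg _) ?_
      rw [Finset.abs_prod]
      exact Finset.prod_le_one (fun _ _ => abs_nonneg _) (fun i _ => hb i)

theorem fL_abs (Λ : Set ℤ) (x : ℝ) : |fL Λ x| ≤ 1 := by
  rw [abs_of_nonneg (fL_nonneg Λ x)]; exact (fL_le_psi Λ x).trans (psi_le x)

theorem Av_lip (U : Ultrafilter ℕ) (hU : (U : Filter ℕ) ≤ atTop) (Λ : Set ℤ) (ℓ : ℕ) (r r' : ℝ) :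
    |Av (sysR U hU) ℓ (fX U hU Λ) r - Av (sysR U hU) ℓ (fX U hU Λ) r'| ≤ (ℓ + 1) * ℓ * |r - r'| := by
  rw [Av_apply, Av_apply, ← map_sub]
  refine (sysR U hU).m.abs_le fun ω => ?_
  rw [Bd.sub_apply, Bd.prod_apply, Bd.prod_apply]
  refine (prod_lip (fun j : ℕ => fL Λ (ω.2 + j * r)) (fun j : ℕ => fL Λ (ω.2 + j * r')) (fun _ => fL_abs _ _) (fun _ => fL_abs _ _)).trans ?_
  refine (Finset.sum_le_sum (g := fun _ => (ℓ : ℝ) * |r - r'|) fun j hj => ?_).trans (by simp; linarith)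
  refine (fL_lip _ _ _).trans ?_
  have e : ω.2 + j * r - (ω.2 + j * r') = j * (r - r') := by ring
  rw [e, abs_mul, Nat.abs_cast]
  have : (j:ℝ) ≤ ℓ := by exact_mod_cast Nat.lt_succ_iff.mp (Finset.mem_range.mp hj)
  gcongr

theorem Av_pos (U : Ultrafilter ℕ) (hU : (U : Filter ℕ) ≤ atTop) (Λ : Set ℤ) (ℓ : ℕ) (r : ℝ)
    (h : 0 < Av (sysR U hU) ℓ (fX U hU Λ) r) : ∃ x : ℝ, ∀ j : ℕ, j ≤ ℓ → fL Λ (x + j * r) ≠ 0 := by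
  by_contra hc
  push Not at hc
  rw [Av_apply] at h
  refine absurd h (not_lt.mpr ((sysR U hU).m.le_const fun ω => ?_))
  obtain ⟨j, hj, h0⟩ := hc ω.2
  rw [Bd.prod_apply]
  exact le_of_eq (Finset.prod_eq_zero (Finset.mem_range.mpr (Nat.lt_succ_of_le hj)) h0)

theorem conclude (Λ : Set ℤ) (ℓ : ℕ) (hℓ : 1 ≤ ℓ) (x a : ℝ) (h : ∀ j : ℕ, j ≤ ℓ → fL Λ (x + j * (a - 1 / 4)) ≠ 0) :
    ∀ j : ℕ, j ≤ ℓ → ⌊x⌋ + (j : ℤ) * ⌊a⌋ ∈ Λ := by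
  have h0 := fun j hj => fL_ne (h j hj)
  have hfl := fun j : ℕ => Int.floor_add_fract (x + j * (a - 1 / 4))
  have e0 : x + (0:ℕ) * (a - 1 / 4) = x := by simp
  have hD : ⌊a⌋ = ⌊x + (1:ℕ) * (a - 1 / 4)⌋ - ⌊x⌋ := by
    rw [Int.floor_eq_iff]
    have a0 := h0 0 (by omega)
    have a1 := h0 1 hℓ
    have f0 := hfl 0
    have f1 := hfl 1
    rw [e0] at a0 f0
    push_cast at a1 f1 ⊢
    constructor <;> linarith [a0.2.1, a0.2.2, a1.2.1, a1.2.2]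
  have key : ∀ j : ℕ, j ≤ ℓ → ⌊x + j * (a - 1 / 4)⌋ = ⌊x⌋ + (j : ℤ) * ⌊a⌋ := by
    intro j
    induction j with
    | zero => intro _; rw [e0]; simp
    | succ j ih =>
      intro hj
      have ih := ih (by omega)
      have a0 := h0 j (by omega)
      have a1 := h0 (j + 1) hj
      have f0 := hfl j
      have f1 := hfl (j + 1)
      have b0 := h0 0 (by omega)
      have b1 := h0 1 hℓ
      have g0 := hfl 0
      have g1 := hfl 1
      rw [e0] at b0 g0
      have hz : |⌊x + (j + 1 : ℕ) * (a - 1 / 4)⌋ - ⌊x + j * (a - 1 / 4)⌋ - ⌊a⌋| < 1 := by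
        have : |((⌊x + (j + 1 : ℕ) * (a - 1 / 4)⌋ - ⌊x + j * (a - 1 / 4)⌋ - ⌊a⌋ : ℤ) : ℝ)| < 1 := by
          rw [hD]
          push_cast at a1 f1 b1 g1 ⊢
          rw [abs_lt]
          constructor <;> linarith [a0.2.1, a0.2.2, a1.2.1, a1.2.2, b0.2.1, b0.2.2, b1.2.1, b1.2.2]
        exact_mod_cast this
      rw [Int.abs_lt_one_iff] at hz
      rw [ih] at hz
      push_cast at hz ⊢
      linarith
  intro j hj
  rw [← key j hj]
  exact (h0 j hj).1

end Sz

open Sz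

/-- The instance `a(x) = x^δ` of the paper's main theorem (Theorem A). -/
theorem stmt_3 (δ : ℝ) (hδpos : 0 < δ) (hδ : ∀ k : ℤ, δ ≠ (k : ℝ))
    (ℓ : ℕ) (hℓ : 1 ≤ ℓ)
    (Λ : Set ℤ) (hΛ : 0 < upperDensity Λ) :
    ∃ m : ℤ, ∃ n : ℕ, 1 ≤ n ∧ ⌊(n : ℝ) ^ δ⌋ ≠ 0 ∧
      ∀ j : ℕ, j ≤ ℓ → m + (j : ℤ) * ⌊(n : ℝ) ^ δ⌋ ∈ Λ := by
  obtain ⟨U, hU, hpos⟩ := exists_meanZ Λ hΛ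
  set k := ⌊δ⌋₊ with hk
  have hk1 : (k : ℝ) < δ := lt_of_le_of_ne (Nat.floor_le hδpos.le) (fun h => hδ (k : ℤ) (by rw [← h]; simp))
  have hk2 : δ < k + 1 := Nat.lt_floor_add_one δ
  obtain ⟨κ, hκ, L, hL⟩ := thmAB k ℓ (sysR U hU) (fX U hU Λ) (fX_CC U hU Λ) (fun ω => fL_nonneg _ _)
    (fun ω => (fL_le_psi _ _).trans (psi_le _)) (by rw [fX_mean]; exact mul_pos hpos EE_psi)
  set ε := κ / ((ℓ + 1) * ℓ * L ^ k + 1) with hε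
  have hε0 : 0 < ε := by positivity
  obtain ⟨x0, hx0⟩ := slow_pow δ (1 / 4) k hk1 hk2 L ε hε0 1
  obtain ⟨t, ht, hd⟩ := hL x0
  obtain ⟨N, hN, hg⟩ := hx0 t ht
  obtain ⟨d, hap⟩ := (parH k).appr _ t ε L hε0.le hg
  obtain ⟨n, hn, hlt⟩ := hd d
  have h1 := hap n hn
  have h2 := Av_lip U hU Λ ℓ ((parH k).h ((parH k).Y.stp^[n] (t, d)).2 + (parH k).ht * t) (((N + n : ℕ) : ℝ) ^ δ - 1 / 4)
  have h3 : ((ℓ:ℝ) + 1) * ℓ * (L ^ k * ε) ≤ κ := by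
    rw [hε]
    rw [show ((ℓ:ℝ) + 1) * ℓ * (L ^ k * (κ / ((ℓ + 1) * ℓ * L ^ k + 1))) = κ * (((ℓ + 1) * ℓ * L ^ k) / ((ℓ + 1) * ℓ * L ^ k + 1)) by ring]
    refine mul_le_of_le_one_right hκ.le ?_
    rw [div_le_one (by positivity)]
    linarith
  have h4 : ((ℓ:ℝ) + 1) * ℓ * |(parH k).h ((parH k).Y.stp^[n] (t, d)).2 + (parH k).ht * t - (((N + n : ℕ) : ℝ) ^ δ - 1 / 4)| ≤ κ :=
    (mul_le_mul_of_nonneg_left h1 (by positivity)).trans h3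
  have h5 := (abs_le.mp (h2.trans h4)).2
  obtain ⟨x, hx⟩ := Av_pos U hU Λ ℓ (((N + n : ℕ) : ℝ) ^ δ - 1 / 4) (by linarith)
  refine ⟨⌊x⌋, N + n, by omega, ?_, conclude Λ ℓ hℓ x _ hx⟩
  have : (1:ℝ) ≤ ((N + n : ℕ) : ℝ) ^ δ := Real.one_le_rpow (by exact_mod_cast (by omega : 1 ≤ N + n)) hδpos.le
  have h6 : 1 ≤ ⌊((N + n : ℕ) : ℝ) ^ δ⌋ := Int.le_floor.mpr (by exact_mod_cast this)
  omega
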